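/- Deduction theorem: for all graphs G and H, the following are equivalent: (i) Ḡ ⅋ H is provable in GS; (ii) Ḡ ⅋ H is provable in SGS; (iii) there is a derivation in SGS from G to H. -/

import Mathlib

namespace GSP

/-- Atoms: a propositional variable (coded by a natural number) with a polarity. -/
abbrev Atom := ℕ × Bool

/-- The dual atom. -/
def dualAtom (a : Atom) : Atom := (a.1, !a.2)

/-- A finite, simple, undirected graph whose vertices are labelled by atoms. -/
structure LGraph where
  V : Type
  [fintype : Fintype V]
  adj : V → V → Prop
  symm : ∀ {v w : V}, adj v w → adj w v
  irrefl : ∀ v : V, ¬ adj v v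
  label : V → Atom

attribute [instance] LGraph.fintype

namespace LGraph

/-- An isomorphism of labelled graphs: a vertex bijection preserving labels and
preserving and reflecting edges. -/
structure Iso (G H : LGraph) where
  toEquiv : G.V ≃ H.V
  adj_iff : ∀ v w : G.V, G.adj v w ↔ H.adj (toEquiv v) (toEquiv w)
  label_eq : ∀ v : G.V, H.label (toEquiv v) = G.label v

/-- `G ≅ H` : the graphs `G` and `H` are isomorphic. -/
def iso (G H : LGraph) : Prop := Nonempty (Iso G H)

/-- The empty graph. -/
def empty : LGraph where
  V := Empty
  adj _ _ := False
  symm h := h.elim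
  irrefl v := v.elim
  label v := v.elim

/-- The single-vertex graph labelled by the atom `a`. -/
def single (a : Atom) : LGraph where
  V := Unit
  adj _ _ := False
  symm h := h.elim
  irrefl _ h := h
  label _ := a

def parAdj (G H : LGraph) : G.V ⊕ H.V → G.V ⊕ H.V → Prop
  | .inl a, .inl b => G.adj a b
  | .inr a, .inr b => H.adj a b
  | _, _ => False

/-- The par `G ⅋ H` : disjoint union of `G` and `H`. -/
def par (G H : LGraph) : LGraph where
  V := G.V ⊕ H.V
  adj := parAdj G H
  symm := by
    rintro (a | a) (b | b) h
    · exact G.symm h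
    · exact h.elim
    · exact h.elim
    · exact H.symm h
  irrefl := by
    rintro (a | a) h
    · exact G.irrefl a h
    · exact H.irrefl a h
  label := Sum.elim G.label H.label

def tensorAdj (G H : LGraph) : G.V ⊕ H.V → G.V ⊕ H.V → Prop
  | .inl a, .inl b => G.adj a b
  | .inr a, .inr b => H.adj a b
  | .inl _, .inr _ => True
  | .inr _, .inl _ => True

/-- The tensor `G ⊗ H` : join of `G` and `H` (disjoint union plus all edges in between). -/
def tensor (G H : LGraph) : LGraph where
  V := G.V ⊕ H.V
  adj := tensorAdj G H
  symm := by
    rintro (a | a) (b | b) h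
    · exact G.symm h
    · exact trivial
    · exact trivial
    · exact H.symm h
  irrefl := by
    rintro (a | a) h
    · exact G.irrefl a h
    · exact H.irrefl a h
  label := Sum.elim G.label H.label

/-- The dual graph `Ḡ` : same vertices, complemented edges, dualized labels. -/
def dual (G : LGraph) : LGraph where
  V := G.V
  adj v w := v ≠ w ∧ ¬ G.adj v w
  symm h := ⟨fun e => h.1 e.symm, fun h' => h.2 (G.symm h')⟩
  irrefl _ h := h.1 rfl
  label v := dualAtom (G.label v)

def plugAdj (C : LGraph) (R : Set C.V) (X : LGraph) : C.V ⊕ X.V → C.V ⊕ X.V → Prop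
  | .inl a, .inl b => C.adj a b
  | .inr a, .inr b => X.adj a b
  | .inl a, .inr _ => a ∈ R
  | .inr _, .inl b => b ∈ R

/-- `C[X]_R` : the graph obtained from the context `C[·]_R` by inserting the graph `X`
as a module whose vertices are adjacent exactly to the vertices in `R`. -/
def plug (C : LGraph) (R : Set C.V) (X : LGraph) : LGraph where
  V := C.V ⊕ X.V
  adj := plugAdj C R X
  symm := by
    rintro (a | a) (b | b) h
    · exact C.symm h
    · exact h
    · exact h
    · exact X.symm h
  irrefl := by
    rintro (a | a) h
    · exact C.irrefl a h
    · exact X.irrefl a h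
  label := Sum.elim C.label X.label

def compAdj (G : LGraph) (H : G.V → LGraph) :
    (Σ v : G.V, (H v).V) → (Σ v : G.V, (H v).V) → Prop := fun x y =>
  (∃ (v : G.V) (a b : (H v).V), x = ⟨v, a⟩ ∧ y = ⟨v, b⟩ ∧ (H v).adj a b) ∨
    (x.1 ≠ y.1 ∧ G.adj x.1 y.1)

/-- The composition `G⟨H v₁, …, H vₙ⟩` of the family `H` via the graph `G`:
replace each vertex `v` of `G` by the graph `H v`. -/
def comp (G : LGraph) (H : G.V → LGraph) : LGraph where
  V := Σ v : G.V, (H v).V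
  adj := compAdj G H
  symm := by
    rintro x y (⟨v, a, b, hx, hy, hab⟩ | ⟨hne, hadj⟩)
    · exact Or.inl ⟨v, b, a, hy, hx, (H v).symm hab⟩
    · exact Or.inr ⟨hne.symm, G.symm hadj⟩
  irrefl := by
    rintro ⟨v, a⟩ (⟨w, x, y, hx, hy, hxy⟩ | ⟨hne, _⟩)
    · have h := hx.symm.trans hy
      obtain rfl : x = y := by simpa using h
      exact (H w).irrefl x hxy
    · exact hne rfl
  label x := (H x.1).label x.2

/-- A module of `G` : a set `M` of vertices such that every vertex outside `M`
is adjacent either to all vertices of `M` or to none of them. -/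
def IsModule (G : LGraph) (M : Set G.V) : Prop :=
  ∀ v ∉ M, ∀ x ∈ M, ∀ y ∈ M, (G.adj v x ↔ G.adj v y)

/-- A prime graph: at least 2 vertices and only trivial modules. -/
def Prime (G : LGraph) : Prop :=
  2 ≤ Fintype.card G.V ∧
    ∀ M : Set G.V, G.IsModule M → M = ∅ ∨ (∃ v, M = {v}) ∨ M = Set.univ

/-- `G` is `P₄`-free: no four distinct vertices induce a path on 4 vertices. -/
def P4Free (G : LGraph) : Prop :=
  ¬ ∃ v₁ v₂ v₃ v₄ : G.V,
      v₁ ≠ v₂ ∧ v₁ ≠ v₃ ∧ v₁ ≠ v₄ ∧ v₂ ≠ v₃ ∧ v₂ ≠ v₄ ∧ v₃ ≠ v₄ ∧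
      G.adj v₁ v₂ ∧ G.adj v₂ v₃ ∧ G.adj v₃ v₄ ∧
      ¬ G.adj v₁ v₃ ∧ ¬ G.adj v₁ v₄ ∧ ¬ G.adj v₂ v₄

end LGraph

open LGraph

/-- The `n`-fold tensor `X₁ ⊗ ⋯ ⊗ Xₙ`. -/
def bigTensor : (n : ℕ) → (Fin n → LGraph) → LGraph
  | 0, _ => LGraph.empty
  | n + 1, F => (F 0).tensor (bigTensor n fun i => F i.succ)

/-- The `n`-fold par `X₁ ⅋ ⋯ ⅋ Xₙ`. -/
def bigPar : (n : ℕ) → (Fin n → LGraph) → LGraph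
  | 0, _ => LGraph.empty
  | n + 1, F => (F 0).par (bigPar n fun i => F i.succ)

/-- The inference rules of system GS (premise, conclusion). -/
inductive GSRule : LGraph → LGraph → Prop
  /-- ai↓ : premise `∅`, conclusion `ā ⅋ a`. -/
  | ai (a : Atom) : GSRule LGraph.empty ((single (dualAtom a)).par (single a))
  /-- ss↓ : premise `B[A]_S`, conclusion `B ⅋ A`, for `A ≠ ∅` and `S ≠ ∅`. -/
  | ss (A B : LGraph) (S : Set B.V) :
      Nonempty A.V → S ≠ ∅ → GSRule (B.plug S A) (B.par A)
  /-- p↓ : premise `(M₁ ⅋ N₁) ⊗ ⋯ ⊗ (Mₙ ⅋ Nₙ)`, conclusion `P̄⟨M₁,…,Mₙ⟩ ⅋ P⟨N₁,…,Nₙ⟩`,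
  for `P` prime with `n = |V(P)| ≥ 4` and all `Mᵢ ≠ ∅`. -/
  | p (n : ℕ) (P : LGraph) (e : P.V ≃ Fin n) (M N : Fin n → LGraph) :
      P.Prime → 4 ≤ n → (∀ i, Nonempty (M i).V) →
      GSRule (bigTensor n fun i => (M i).par (N i))
        ((P.dual.comp fun v => M (e v)).par (P.comp fun v => N (e v)))

/-- The "up" rules ai↑, ss↑, p↑ (premise, conclusion). -/
inductive UpRule : LGraph → LGraph → Prop
  /-- ai↑ : premise `a ⊗ ā`, conclusion `∅`. -/
  | ai (a : Atom) : UpRule ((single a).tensor (single (dualAtom a))) LGraph.empty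
  /-- ss↑ : premise `B ⊗ A`, conclusion `B[A]_S`, for `A ≠ ∅` and `S ≠ V(B)`. -/
  | ss (A B : LGraph) (S : Set B.V) :
      Nonempty A.V → S ≠ Set.univ → UpRule (B.tensor A) (B.plug S A)
  /-- p↑ : premise `P⟨M₁,…,Mₙ⟩ ⊗ P̄⟨N₁,…,Nₙ⟩`, conclusion `(M₁ ⊗ N₁) ⅋ ⋯ ⅋ (Mₙ ⊗ Nₙ)`,
  for `P` prime with `n = |V(P)| ≥ 4` and all `Mᵢ ≠ ∅`. -/
  | p (n : ℕ) (P : LGraph) (e : P.V ≃ Fin n) (M N : Fin n → LGraph) :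
      P.Prime → 4 ≤ n → (∀ i, Nonempty (M i).V) →
      UpRule ((P.comp fun v => M (e v)).tensor (P.dual.comp fun v => N (e v)))
        (bigPar n fun i => (M i).tensor (N i))

/-- The rules of system SGS : the rules of GS together with their duals. -/
def SGSRule (G H : LGraph) : Prop := GSRule G H ∨ UpRule G H

/-- A single inference step in a system: inside some context, replace a module
isomorphic to the premise of a rule by the corresponding conclusion. -/
def Step (Rules : LGraph → LGraph → Prop) (G H : LGraph) : Prop :=
  ∃ (C : LGraph) (R : Set C.V) (p c : LGraph),
    Rules p c ∧ G.iso (C.plug R p) ∧ H.iso (C.plug R c)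

/-- A derivation in a system from `G` to `H` : a finite sequence of inference steps
and isomorphisms leading from `G` to `H`. -/
def Deriv (Rules : LGraph → LGraph → Prop) (G H : LGraph) : Prop :=
  Relation.ReflTransGen (fun X Y => X.iso Y ∨ Step Rules X Y) G H

/-- A graph is provable in a system if there is a derivation from `∅` to it. -/
def Provable (Rules : LGraph → LGraph → Prop) (G : LGraph) : Prop :=
  Deriv Rules LGraph.empty G

/-- Formulas: unit, positive and negative atoms, par and tensor. -/
inductive Formula where
  | unit : Formula
  | pos (a : ℕ) : Formula
  | neg (a : ℕ) : Formula
  | par (φ ψ : Formula) : Formula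
  | tens (φ ψ : Formula) : Formula

/-- The graph `[φ]` of a formula `φ`. -/
def Formula.graph : Formula → LGraph
  | .unit => LGraph.empty
  | .pos a => single (a, true)
  | .neg a => single (a, false)
  | .par φ ψ => φ.graph.par ψ.graph
  | .tens φ ψ => φ.graph.tensor ψ.graph

/-- Structural equivalence of formulas: the smallest congruence making `⅋` and `⊗`
associative and commutative with unit `∘`. -/
inductive Formula.equiv : Formula → Formula → Prop
  | refl (φ) : Formula.equiv φ φ
  | symm {φ ψ} : Formula.equiv φ ψ → Formula.equiv ψ φ
  | trans {φ ψ χ} : Formula.equiv φ ψ → Formula.equiv ψ χ → Formula.equiv φ χ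
  | parComm (φ ψ) : Formula.equiv (.par φ ψ) (.par ψ φ)
  | parAssoc (φ ψ χ) : Formula.equiv (.par φ (.par ψ χ)) (.par (.par φ ψ) χ)
  | parUnit (φ) : Formula.equiv (.par φ .unit) φ
  | tensComm (φ ψ) : Formula.equiv (.tens φ ψ) (.tens ψ φ)
  | tensAssoc (φ ψ χ) : Formula.equiv (.tens φ (.tens ψ χ)) (.tens (.tens φ ψ) χ)
  | tensUnit (φ) : Formula.equiv (.tens φ .unit) φ
  | parCongr {φ φ' ψ ψ'} : Formula.equiv φ φ' → Formula.equiv ψ ψ' →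
      Formula.equiv (.par φ ψ) (.par φ' ψ')
  | tensCongr {φ φ' ψ ψ'} : Formula.equiv φ φ' → Formula.equiv ψ ψ' →
      Formula.equiv (.tens φ ψ) (.tens φ' ψ')

/-- A formula is unit-free if it contains no occurrence of the unit `∘`. -/
def Formula.UnitFree : Formula → Prop
  | .unit => False
  | .pos _ => True
  | .neg _ => True
  | .par φ ψ => φ.UnitFree ∧ ψ.UnitFree
  | .tens φ ψ => φ.UnitFree ∧ ψ.UnitFree

/-- The sequent calculus MLL° (multiplicative linear logic with mix) on multisets
of formulas. -/
inductive MLL : Multiset Formula → Prop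
  | ax (a : ℕ) : MLL {Formula.pos a, Formula.neg a}
  | tens {Γ Δ : Multiset Formula} (φ ψ : Formula) :
      MLL (φ ::ₘ Γ) → MLL (ψ ::ₘ Δ) → MLL (Formula.tens φ ψ ::ₘ (Γ + Δ))
  | par {Γ : Multiset Formula} (φ ψ : Formula) :
      MLL (φ ::ₘ ψ ::ₘ Γ) → MLL (Formula.par φ ψ ::ₘ Γ)
  | mix {Γ Δ : Multiset Formula} : MLL Γ → MLL Δ → MLL (Γ + Δ)

/-! ### An auxiliary shallow calculus on vertex sets -/

/-- A labelled graph structure on a fixed vertex type. -/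
structure PG (V : Type) where
  adj : V → V → Prop
  symm : ∀ {v w : V}, adj v w → adj w v
  irrefl : ∀ v : V, ¬ adj v v
  lab : V → Atom

theorem PG.comm {V : Type} (X : PG V) (x y : V) : X.adj x y ↔ X.adj y x :=
  ⟨X.symm, X.symm⟩

/-- Side conditions of the switch rule. -/
structure SwCond {V : Type} (X : PG V) (A B M R : Set V) : Prop where
  disj : ∀ x ∈ A, x ∉ B
  hM : ∀ x ∈ M, x ∈ A
  hR : ∀ x ∈ R, x ∈ B
  comp : ∀ x ∈ M, ∀ y ∈ A, y ∉ M → ¬ X.adj x y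
  cross : ∀ x ∈ A, ∀ y ∈ B, (X.adj x y ↔ x ∈ M ∧ y ∈ R)

/-- Fibred decomposition of a set of vertices with a left part, a right part, and a context. -/
structure FCond {V I : Type} (X : PG V) (s L R : Set V) (f : V → I) (J : Set I)
    (P : I → I → Prop) : Prop where
  hL : ∀ x ∈ L, x ∈ s
  hR : ∀ x ∈ R, x ∈ s
  disj : ∀ x ∈ L, x ∉ R
  hf : ∀ x ∈ s, f x ∈ J
  same : ∀ x ∈ s, ∀ y ∈ s, f x = f y → X.adj x y → ((x ∈ L ↔ y ∈ L) ∧ (x ∈ R ↔ y ∈ R))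
  cross : ∀ x ∈ s, ∀ y ∈ s, f x ≠ f y → (X.adj x y ↔
    ((x ∈ L ∧ y ∈ L ∧ ¬ P (f x) (f y)) ∨ (x ∈ R ∧ y ∈ R ∧ P (f x) (f y))))

/-- Primality of a relation on a set. -/
def PrimeOn {I : Type} (P : I → I → Prop) (J : Set I) : Prop :=
  ∀ U : Set I, (∀ x ∈ U, x ∈ J) →
    (∀ v ∈ J, v ∉ U → ∀ x ∈ U, ∀ y ∈ U, (P v x ↔ P v y)) →
    (∀ x ∈ U, ∀ y ∈ U, x = y) ∨ (∀ x ∈ J, x ∈ U)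

structure PCond {V I : Type} (L R : Set V) (f : V → I) (J : Set I)
    (P : I → I → Prop) : Prop where
  fin : J.Finite
  card : 4 ≤ J.ncard
  prime : PrimeOn P J
  neL : ∀ i ∈ J, ∃ x ∈ L, f x = i
  neR : ∀ i ∈ J, ∃ x ∈ R, f x = i

def Conn {V : Type} (X : PG V) (G : Set V) : Prop :=
  ∀ U : Set V, (∀ x ∈ U, x ∈ G) → (∃ x, x ∈ U) → (∃ x ∈ G, x ∉ U) →
    ∃ x ∈ U, ∃ y ∈ G, y ∉ U ∧ X.adj x y

def CoConn {V : Type} (X : PG V) (G : Set V) : Prop :=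
  ∀ U : Set V, (∀ x ∈ U, x ∈ G) → (∃ x, x ∈ U) → (∃ x ∈ G, x ∉ U) →
    ∃ x ∈ U, ∃ y ∈ G, y ∉ U ∧ ¬ X.adj x y

/-- The auxiliary calculus. -/
inductive T {V : Type} (X : PG V) : Set V → Prop
  | emp : T X ∅
  | ax (x y : V) : x ≠ y → X.lab y = dualAtom (X.lab x) → ¬ X.adj x y → T X {x, y}
  | sw (A B M R : Set V) : T X A → T X B → SwCond X A B M R → CoConn X M → T X (A ∪ B)
  | p (I : Type) (J : Set I) (f : V → I) (P : I → I → Prop) (s L R : Set V) :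
      (∀ i ∈ J, T X (s ∩ f ⁻¹' {i})) → FCond X s L R f J P → PCond L R f J P → T X s

theorem FCond.swap {V I : Type} {X : PG V} {s L R : Set V} {f : V → I} {J : Set I}
    {P : I → I → Prop} (h : FCond X s L R f J P) :
    FCond X s R L f J (fun i j => ¬ P i j) := by
  refine ⟨h.hR, h.hL, fun x hx hx' => h.disj x hx' hx, h.hf, ?_, ?_⟩
  · intro x hx y hy hxy ha
    exact (h.same x hx y hy hxy ha).symm
  · intro x hx y hy hxy
    rw [h.cross x hx y hy hxy]
    tauto

theorem PrimeOn.swap {I : Type} {P : I → I → Prop} {J : Set I} (h : PrimeOn P J) :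
    PrimeOn (fun i j => ¬ P i j) J := by
  intro U hU hm
  exact h U hU fun v hv hvU x hx y hy => not_iff_not.1 (hm v hv hvU x hx y hy)

theorem PCond.swap {V I : Type} {L R : Set V} {f : V → I} {J : Set I}
    {P : I → I → Prop} (h : PCond L R f J P) : PCond R L f J (fun i j => ¬ P i j) :=
  ⟨h.fin, h.card, h.prime.swap, h.neR, h.neL⟩

/-- Pulling back derivations along a map which is bijective on the relevant sets. -/
theorem T.comap {V W : Type} {X : PG V} {Y : PG W} (φ : V → W) {t : Set W} (h : T Y t) :
    ∀ s : Set V, Set.BijOn φ s t →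
      (∀ x ∈ s, Y.lab (φ x) = X.lab x) →
      (∀ x ∈ s, ∀ y ∈ s, (X.adj x y ↔ Y.adj (φ x) (φ y))) → T X s := by
  induction h with
  | emp =>
    intro s hs _ _
    have : s = ∅ := by
      ext x; constructor
      · intro hx; exact (hs.mapsTo hx)
      · intro hx; exact hx.elim
    rw [this]; exact T.emp
  | ax x y hne hl ha =>
    intro s hs hlab hadj
    obtain ⟨x', hx', rfl⟩ := hs.surjOn (show x ∈ ({x, y} : Set W) by simp)
    obtain ⟨y', hy', rfl⟩ := hs.surjOn (show y ∈ ({φ x', y} : Set W) by simp)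
    have : s = {x', y'} := by
      ext z; constructor
      · intro hz
        rcases hs.mapsTo hz with h | h
        · left; exact hs.injOn hz hx' h
        · right; exact hs.injOn hz hy' h
      · rintro (rfl | rfl) <;> assumption
    subst this
    refine T.ax x' y' (fun h => hne (by rw [h])) ?_ ?_
    · rw [← hlab _ hx', ← hlab _ hy', hl]
    · rw [hadj _ hx' _ hy']; exact ha
  | sw A B M R _ _ hc hcc ihA ihB =>
    intro s hs hlab hadj
    have hb : ∀ C : Set W, C ⊆ A ∪ B → Set.BijOn φ (s ∩ φ ⁻¹' C) C := by
      intro C hC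
      refine ⟨fun x hx => hx.2, hs.injOn.mono fun x hx => hx.1, ?_⟩
      intro y hy
      obtain ⟨x, hx, rfl⟩ := hs.surjOn (hC hy)
      exact ⟨x, ⟨hx, hy⟩, rfl⟩
    have hA := ihA _ (hb A Set.subset_union_left) (fun x hx => hlab x hx.1)
      (fun x hx y hy => hadj x hx.1 y hy.1)
    have hB := ihB _ (hb B Set.subset_union_right) (fun x hx => hlab x hx.1)
      (fun x hx y hy => hadj x hx.1 y hy.1)
    have e : s = (s ∩ φ ⁻¹' A) ∪ (s ∩ φ ⁻¹' B) := by
      ext x; constructor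
      · intro hx
        rcases hs.mapsTo hx with h | h
        · exact Or.inl ⟨hx, h⟩
        · exact Or.inr ⟨hx, h⟩
      · rintro (h | h) <;> exact h.1
    rw [e]
    refine T.sw _ _ (s ∩ φ ⁻¹' M) (s ∩ φ ⁻¹' R) hA hB ⟨?_, ?_, ?_, ?_, ?_⟩ ?_
    · intro x hx hx'; exact hc.disj _ hx.2 hx'.2
    · intro x hx; exact ⟨hx.1, hc.hM _ hx.2⟩
    · intro x hx; exact ⟨hx.1, hc.hR _ hx.2⟩
    · intro x hx y hy hyM
      rw [hadj x hx.1 y hy.1]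
      exact hc.comp _ hx.2 _ hy.2 fun h => hyM ⟨hy.1, h⟩
    · intro x hx y hy
      rw [hadj x hx.1 y hy.1, hc.cross _ hx.2 _ hy.2]
      exact ⟨fun h => ⟨⟨hx.1, h.1⟩, ⟨hy.1, h.2⟩⟩, fun h => ⟨h.1.2, h.2.2⟩⟩
    · intro U hU ⟨x, hx⟩ ⟨y, hy, hyU⟩
      have hUs : ∀ z ∈ s, φ z ∈ φ '' U → z ∈ U := by
        rintro z hz ⟨u, hu, he⟩
        rw [← hs.injOn (hU u hu).1 hz he]; exact hu
      obtain ⟨a, ⟨a', ha', rfl⟩, b, hb', hbU, hab⟩ := hcc (φ '' U)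
        (by rintro _ ⟨u, hu, rfl⟩; exact (hU u hu).2) ⟨φ x, x, hx, rfl⟩
        ⟨φ y, hy.2, fun h => hyU (hUs y hy.1 h)⟩
      obtain ⟨b', hbs, rfl⟩ := hs.surjOn (Or.inl (hc.hM _ hb') : b ∈ A ∪ B)
      refine ⟨a', ha', b', ⟨hbs, hb'⟩, fun h => hbU ⟨b', h, rfl⟩, ?_⟩
      rw [hadj a' (hU a' ha').1 b' hbs]; exact hab
  | p I J f P u L R _ hF hP ih =>
    intro s hs hlab hadj
    refine T.p I J (f ∘ φ) P s (s ∩ φ ⁻¹' L) (s ∩ φ ⁻¹' R) ?_ ⟨?_, ?_, ?_, ?_, ?_, ?_⟩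
      ⟨hP.fin, hP.card, hP.prime, ?_, ?_⟩
    · intro i hi
      refine ih i hi _ ⟨?_, ?_, ?_⟩ (fun x hx => hlab x hx.1)
        (fun x hx y hy => hadj x hx.1 y hy.1)
      · intro x hx; exact ⟨hs.mapsTo hx.1, hx.2⟩
      · exact hs.injOn.mono fun x hx => hx.1
      · intro y hy
        obtain ⟨x, hx, rfl⟩ := hs.surjOn hy.1
        exact ⟨x, ⟨hx, hy.2⟩, rfl⟩
    · intro x hx; exact hx.1
    · intro x hx; exact hx.1
    · intro x hx hx'; exact hF.disj _ hx.2 hx'.2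
    · intro x hx; exact hF.hf _ (hs.mapsTo hx)
    · intro x hx y hy hxy ha
      have := hF.same _ (hs.mapsTo hx) _ (hs.mapsTo hy) hxy ((hadj x hx y hy).1 ha)
      simp only [Set.mem_inter_iff, hx, hy, true_and, Set.mem_preimage]
      exact this
    · intro x hx y hy hxy
      rw [hadj x hx y hy, hF.cross _ (hs.mapsTo hx) _ (hs.mapsTo hy) hxy]
      simp only [Set.mem_inter_iff, hx, hy, true_and, Set.mem_preimage, Function.comp]
    · intro i hi
      obtain ⟨y, hy, rfl⟩ := hP.neL i hi
      obtain ⟨x, hx, rfl⟩ := hs.surjOn (hF.hL y hy)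
      exact ⟨x, ⟨hx, hy⟩, rfl⟩
    · intro i hi
      obtain ⟨y, hy, rfl⟩ := hP.neR i hi
      obtain ⟨x, hx, rfl⟩ := hs.surjOn (hF.hR y hy)
      exact ⟨x, ⟨hx, hy⟩, rfl⟩

def Agree {V : Type} (X Y : PG V) (s : Set V) : Prop :=
  (∀ x ∈ s, Y.lab x = X.lab x) ∧ ∀ x ∈ s, ∀ y ∈ s, (Y.adj x y ↔ X.adj x y)

theorem T.congr {V : Type} {X Y : PG V} {s : Set V} (h : T X s) (ha : Agree X Y s) : T Y s :=
  T.comap id h s (Set.bijOn_id s) (fun x hx => (ha.1 x hx).symm) (fun x hx y hy => ha.2 x hx y hy)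

/-- Fibration of a set over a relation. -/
structure Fib {V I : Type} (X : PG V) (G : Set V) (f : V → I) (J : Set I)
    (P : I → I → Prop) : Prop where
  hf : ∀ x ∈ G, f x ∈ J
  adj : ∀ x ∈ G, ∀ y ∈ G, f x ≠ f y → (X.adj x y ↔ P (f x) (f y))
  ne : ∀ i ∈ J, ∃ x ∈ G, f x = i

theorem FCond.fib {V I : Type} {X : PG V} {s L R : Set V} {f : V → I} {J : Set I}
    {P : I → I → Prop} (h : FCond X s L R f J P) (h' : PCond L R f J P) : Fib X R f J P := by
  refine ⟨fun x hx => h.hf x (h.hR x hx), ?_, h'.neR⟩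
  intro x hx y hy hxy
  rw [h.cross x (h.hR x hx) y (h.hR y hy) hxy]
  have := fun h2 => h.disj x h2 hx
  tauto

theorem exists_other {I : Type} {J : Set I} (_hfin : J.Finite) (F : Set I) (hF : F.Finite)
    (h : F.ncard < J.ncard) : ∃ k ∈ J, k ∉ F := by
  by_contra hc
  push Not at hc
  have := Set.ncard_le_ncard (s := J) (t := F) hc hF
  omega

theorem exists_ne2 {I : Type} {J : Set I} (hfin : J.Finite) (h : 3 ≤ J.ncard) (a b : I) :
    ∃ k ∈ J, k ≠ a ∧ k ≠ b := by
  obtain ⟨k, hk, hk'⟩ := exists_other hfin {a, b} (by simp)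
    (lt_of_le_of_lt (Set.ncard_insert_le a {b}) (by simp; omega))
  simp at hk'
  exact ⟨k, hk, hk'.1, hk'.2⟩

theorem exists_ne3 {I : Type} {J : Set I} (hfin : J.Finite) (h : 4 ≤ J.ncard) (a b c : I) :
    ∃ k ∈ J, k ≠ a ∧ k ≠ b ∧ k ≠ c := by
  have h1 := Set.ncard_insert_le a {b, c}
  have h2 := Set.ncard_insert_le b {c}
  have h3 := Set.ncard_singleton c
  obtain ⟨k, hk, hk'⟩ := exists_other hfin {a, b, c} (by simp) (by omega)
  simp at hk'
  exact ⟨k, hk, hk'.1, hk'.2.1, hk'.2.2⟩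

/-- A module of a graph with prime quotient is everything or contained in a fibre. -/
theorem Fib.module {V I : Type} {X : PG V} {G : Set V} {f : V → I} {J : Set I}
    {P : I → I → Prop} (h : Fib X G f J P) (hfin : J.Finite) (hcard : 4 ≤ J.ncard)
    (hp : PrimeOn P J) (U : Set V) (hU : ∀ x ∈ U, x ∈ G)
    (hm : ∀ v ∈ G, v ∉ U → ∀ x ∈ U, ∀ y ∈ U, (X.adj v x ↔ X.adj v y)) :
    (∀ x ∈ U, ∀ y ∈ U, f x = f y) ∨ (∀ x ∈ G, x ∈ U) := by
  have k1 : ∀ v ∈ J, v ∉ {i | ∃ z ∈ U, f z = i} → ∀ x ∈ {i | ∃ z ∈ U, f z = i},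
      ∀ y ∈ {i | ∃ z ∈ U, f z = i}, (P v x ↔ P v y) := by
    rintro v hv hvU _ ⟨a, ha, rfl⟩ _ ⟨b, hb, rfl⟩
    obtain ⟨w, hw, rfl⟩ := h.ne v hv
    have hwU : ∀ z ∈ U, f w ≠ f z := fun z hz he => hvU ⟨z, hz, he.symm⟩
    have hwU' : w ∉ U := fun hh => hwU w hh rfl
    rw [← h.adj w hw a (hU a ha) (hwU a ha), ← h.adj w hw b (hU b hb) (hwU b hb)]
    exact hm w hw hwU' a ha b hb
  rcases hp {i | ∃ z ∈ U, f z = i} (by rintro _ ⟨z, hz, rfl⟩; exact h.hf z (hU z hz)) k1 with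
    h1 | h1
  · left
    intro x hx y hy
    exact h1 _ ⟨x, hx, rfl⟩ _ ⟨y, hy, rfl⟩
  · right
    by_contra hc
    push Not at hc
    obtain ⟨w, hw, hwU⟩ := hc
    have k2 : ∀ v ∈ J, v ∉ {i | i ∈ J ∧ i ≠ f w} → ∀ x ∈ {i | i ∈ J ∧ i ≠ f w},
        ∀ y ∈ {i | i ∈ J ∧ i ≠ f w}, (P v x ↔ P v y) := by
      intro v hv hvU i hi j hj
      have hvw : v = f w := by
        by_contra hne; exact hvU ⟨hv, hne⟩
      subst hvw
      obtain ⟨a, ha, rfl⟩ := h1 i hi.1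
      obtain ⟨b, hb, rfl⟩ := h1 j hj.1
      rw [← h.adj w hw a (hU a ha) (Ne.symm hi.2), ← h.adj w hw b (hU b hb) (Ne.symm hj.2)]
      exact hm w hw hwU a ha b hb
    rcases hp {i | i ∈ J ∧ i ≠ f w} (fun x hx => hx.1) k2 with h2 | h2
    · obtain ⟨k, hk, hk1, _⟩ := exists_ne2 hfin (by omega) (f w) (f w)
      obtain ⟨l, hl, hl1, hl2⟩ := exists_ne2 hfin (by omega) (f w) k
      exact hl2 (h2 l ⟨hl, hl1⟩ k ⟨hk, hk1⟩)
    · exact (h2 _ (h.hf w hw)).2 rfl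

theorem Fib.coConn {V I : Type} {X : PG V} {G : Set V} {f : V → I} {J : Set I}
    {P : I → I → Prop} (h : Fib X G f J P) (hfin : J.Finite) (hcard : 4 ≤ J.ncard)
    (hp : PrimeOn P J) : CoConn X G := by
  intro U hU ⟨x, hx⟩ ⟨y, hy, hyU⟩
  by_contra hc
  push Not at hc
  have m1 := h.module hfin hcard hp U hU (fun v hv hvU a ha b hb =>
    ⟨fun _ => X.symm (hc b hb v hv hvU), fun _ => X.symm (hc a ha v hv hvU)⟩)
  have m2 := h.module hfin hcard hp (G \ U) (fun x hx => hx.1) (fun v hv hvU a ha b hb => by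
    have hv' : v ∈ U := by by_contra hh; exact hvU ⟨hv, hh⟩
    exact ⟨fun _ => (hc v hv' b hb.1 hb.2), fun _ => (hc v hv' a ha.1 ha.2)⟩)
  rcases m1 with m1 | m1
  · rcases m2 with m2 | m2
    · obtain ⟨k, hk, hk1, hk2⟩ := exists_ne2 hfin (by omega) (f x) (f y)
      obtain ⟨z, hz, rfl⟩ := h.ne k hk
      by_cases hzU : z ∈ U
      · exact hk1 (m1 z hzU x hx)
      · exact hk2 (m2 z ⟨hz, hzU⟩ y ⟨hy, hyU⟩)
    · exact (m2 x (hU x hx)).2 hx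
  · exact hyU (m1 y hy)

theorem Fib.conn {V I : Type} {X : PG V} {G : Set V} {f : V → I} {J : Set I}
    {P : I → I → Prop} (h : Fib X G f J P) (hfin : J.Finite) (hcard : 4 ≤ J.ncard)
    (hp : PrimeOn P J) : Conn X G := by
  intro U hU ⟨x, hx⟩ ⟨y, hy, hyU⟩
  by_contra hc
  push Not at hc
  have m1 := h.module hfin hcard hp U hU (fun v hv hvU a ha b hb =>
    ⟨fun hh => (hc a ha v hv hvU (X.symm hh)).elim, fun hh => (hc b hb v hv hvU (X.symm hh)).elim⟩)
  have m2 := h.module hfin hcard hp (G \ U) (fun x hx => hx.1) (fun v hv hvU a ha b hb => by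
    have hv' : v ∈ U := by by_contra hh; exact hvU ⟨hv, hh⟩
    exact ⟨fun hh => (hc v hv' a ha.1 ha.2 hh).elim, fun hh => (hc v hv' b hb.1 hb.2 hh).elim⟩)
  rcases m1 with m1 | m1
  · rcases m2 with m2 | m2
    · obtain ⟨k, hk, hk1, hk2⟩ := exists_ne2 hfin (by omega) (f x) (f y)
      obtain ⟨z, hz, rfl⟩ := h.ne k hk
      by_cases hzU : z ∈ U
      · exact hk1 (m1 z hzU x hx)
      · exact hk2 (m2 z ⟨hz, hzU⟩ y ⟨hy, hyU⟩)
    · exact (m2 x (hU x hx)).2 hx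
  · exact hyU (m1 y hy)

/-- `G` is the principal component in the last rule deriving `t`. -/
inductive Principal {V : Type} (X : PG V) (t G : Set V) : Prop
  | ax (x y : V) : t = {x, y} → x ≠ y → G = {x} → X.lab y = dualAtom (X.lab x) →
      Principal X t G
  | sw (A B R : Set V) : T X A → T X B → t = A ∪ B → SwCond X A B (G ∩ A) R →
      (∀ x ∈ R, x ∈ G) → (∃ x ∈ G, x ∈ A) → (∃ x ∈ G, x ∈ B) → Principal X t G
  | p (I : Type) (J : Set I) (f : V → I) (P : I → I → Prop) (K : Set V) :
      (∀ i ∈ J, T X (t ∩ f ⁻¹' {i})) → FCond X t K G f J P → PCond K G f J P →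
      Principal X t G

theorem dualAtom_dualAtom (a : Atom) : dualAtom (dualAtom a) = a := by
  simp [dualAtom]

theorem CoConn.congr {V : Type} {X Y : PG V} {M : Set V} (h : CoConn X M)
    (ha : ∀ x ∈ M, ∀ y ∈ M, (Y.adj x y ↔ X.adj x y)) : CoConn Y M := by
  intro U hU hne hp
  obtain ⟨x, hx, y, hy, hyU, hxy⟩ := h U hU hne hp
  exact ⟨x, hx, y, hy, hyU, by rw [ha x (hU x hx) y hy]; exact hxy⟩

theorem CoConn.empty {V : Type} (X : PG V) : CoConn X ∅ := by
  intro U hU ⟨x, hx⟩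
  exact (hU x hx).elim

/-- The splitting lemma for the auxiliary calculus. -/
theorem T.split {V : Type} {X : PG V} {s : Set V} (h : T X s) :
    ∀ G : Set V, (∀ x ∈ G, x ∈ s) → (∃ x, x ∈ G) → Conn X G →
      (∀ x ∈ G, ∀ y ∈ s, y ∉ G → ¬ X.adj x y) →
      ∃ t : Set V, (∀ x ∈ G, x ∈ t) ∧ (∀ x ∈ t, x ∈ s) ∧ Principal X t G ∧
        ∀ (Y : PG V) (Z : Set V), Agree X Y (s \ G) → (∀ x ∈ Z, x ∉ s \ G) →
          (∀ x ∈ Z, ∀ y ∈ s \ G, ¬ Y.adj x y) → T Y ((t \ G) ∪ Z) → T Y ((s \ G) ∪ Z) := by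
  induction h with
  | emp =>
    intro G hG ⟨x, hx⟩
    exact (hG x hx).elim
  | ax x y hne hl ha =>
    intro G hG ⟨z, hz⟩ hconn _
    refine ⟨{x, y}, hG, fun x hx => hx, ?_, fun Y Z _ _ _ h => h⟩
    by_cases hx : x ∈ G
    · have hy : y ∉ G := by
        intro hy
        obtain ⟨a, ha', b, hb, hbU, hab⟩ := hconn {x} (by simpa using hx) ⟨x, rfl⟩
          ⟨y, hy, fun h => hne h.symm⟩
        have hb' := hG b hb
        simp only [Set.mem_singleton_iff, Set.mem_insert_iff] at ha' hb' hbU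
        subst ha'
        rcases hb' with rfl | rfl
        · exact hbU rfl
        · exact ha hab
      refine Principal.ax x y rfl hne ?_ hl
      ext w
      constructor
      · intro hw
        rcases hG w hw with h | h
        · exact h
        · exact (hy (h ▸ hw)).elim
      · rintro rfl; exact hx
    · have hG' : G = {y} := by
        ext w
        constructor
        · intro hw
          rcases hG w hw with h | h
          · exact (hx (h ▸ hw)).elim
          · exact h
        · rintro rfl
          rcases hG z hz with h | h
          · exact (hx (h ▸ hz)).elim
          · exact h ▸ hz
      refine Principal.ax y x (Set.pair_comm x y) hne.symm hG' ?_
      rw [hl, dualAtom_dualAtom]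
  | sw A B M R hA hB hc hcc ihA ihB =>
    intro G hG hne hconn hiso
    have disj := hc.disj
    have hM := hc.hM
    have hR := hc.hR
    have hcomp := hc.comp
    have hcross := hc.cross
    by_cases h1 : ∀ x ∈ G, x ∈ A
    · obtain ⟨t, ht1, ht2, ht3, ht4⟩ := ihA G h1 hne hconn
        (fun x hx y hy hyG => hiso x hx y (Or.inl hy) hyG)
      refine ⟨t, ht1, fun x hx => Or.inl (ht2 x hx), ht3, ?_⟩
      intro Y Z hag hZ hZadj hT
      have hT' := ht4 Y Z ⟨fun x hx => hag.1 x ⟨Or.inl hx.1, hx.2⟩,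
        fun x hx y hy => hag.2 x ⟨Or.inl hx.1, hx.2⟩ y ⟨Or.inl hy.1, hy.2⟩⟩
        (fun x hx hx' => hZ x hx ⟨Or.inl hx'.1, hx'.2⟩)
        (fun x hx y hy => hZadj x hx y ⟨Or.inl hy.1, hy.2⟩) hT
      have hBs : ∀ x ∈ B, x ∈ (A ∪ B) \ G := fun x hx =>
        ⟨Or.inr hx, fun hxG => disj x (h1 x hxG) hx⟩
      have hBY : T Y B := hB.congr ⟨fun x hx => hag.1 x (hBs x hx),
        fun x hx y hy => hag.2 x (hBs x hx) y (hBs y hy)⟩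
      have e : ((A ∪ B) \ G) ∪ Z = ((A \ G) ∪ Z) ∪ B := by
        ext x
        have := hBs x
        simp only [Set.mem_union, Set.mem_sdiff] at *
        tauto
      rw [e]
      have hAs : ∀ x ∈ A, x ∉ G → x ∈ (A ∪ B) \ G := fun x hx hxG => ⟨Or.inl hx, hxG⟩
      by_cases h2 : ∃ x ∈ M, x ∈ G
      · obtain ⟨x0, hx0, hx0G⟩ := h2
        have hRe : ∀ y, y ∉ R := fun y hy =>
          hiso x0 hx0G y (Or.inr (hR y hy)) (hBs y (hR y hy)).2
            ((hcross x0 (hM x0 hx0) y (hR y hy)).2 ⟨hx0, hy⟩)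
        refine T.sw _ _ ∅ ∅ hT' hBY ⟨?_, ?_, ?_, ?_, ?_⟩ (CoConn.empty Y)
        · rintro x (hx | hx) hxB
          · exact disj x hx.1 hxB
          · exact hZ x hx (hBs x hxB)
        · intro x hx; exact hx.elim
        · intro x hx; exact hx.elim
        · intro x hx; exact hx.elim
        · rintro x (hx | hx) y hy
          · rw [hag.2 x (hAs x hx.1 hx.2) y (hBs y hy), hcross x hx.1 y hy]
            exact ⟨fun h => (hRe y h.2).elim, fun h => h.1.elim⟩
          · exact ⟨fun h => (hZadj x hx y (hBs y hy) h).elim, fun h => h.1.elim⟩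
      · push Not at h2
        have hMs : ∀ x ∈ M, x ∈ (A ∪ B) \ G := fun x hx => hAs x (hM x hx) (h2 x hx)
        refine T.sw _ _ M R hT' hBY ⟨?_, ?_, hR, ?_, ?_⟩
          (hcc.congr fun x hx y hy => hag.2 x (hMs x hx) y (hMs y hy))
        · rintro x (hx | hx) hxB
          · exact disj x hx.1 hxB
          · exact hZ x hx (hBs x hxB)
        · intro x hx; exact Or.inl ⟨hM x hx, h2 x hx⟩
        · rintro x hx y (hy | hy) hyM
          · rw [hag.2 x (hMs x hx) y (hAs y hy.1 hy.2)]
            exact hcomp x hx y hy.1 hyM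
          · intro h
            exact hZadj y hy x (hMs x hx) (Y.symm h)
        · rintro x (hx | hx) y hy
          · rw [hag.2 x (hAs x hx.1 hx.2) y (hBs y hy), hcross x hx.1 y hy]
          · exact ⟨fun h => (hZadj x hx y (hBs y hy) h).elim,
              fun h => (hZ x hx (hMs x h.1)).elim⟩
    by_cases h1' : ∀ x ∈ G, x ∈ B
    · obtain ⟨t, ht1, ht2, ht3, ht4⟩ := ihB G h1' hne hconn
        (fun x hx y hy hyG => hiso x hx y (Or.inr hy) hyG)
      refine ⟨t, ht1, fun x hx => Or.inr (ht2 x hx), ht3, ?_⟩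
      intro Y Z hag hZ hZadj hT
      have hT' := ht4 Y Z ⟨fun x hx => hag.1 x ⟨Or.inr hx.1, hx.2⟩,
        fun x hx y hy => hag.2 x ⟨Or.inr hx.1, hx.2⟩ y ⟨Or.inr hy.1, hy.2⟩⟩
        (fun x hx hx' => hZ x hx ⟨Or.inr hx'.1, hx'.2⟩)
        (fun x hx y hy => hZadj x hx y ⟨Or.inr hy.1, hy.2⟩) hT
      have hAs : ∀ x ∈ A, x ∈ (A ∪ B) \ G := fun x hx =>
        ⟨Or.inl hx, fun hxG => disj x hx (h1' x hxG)⟩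
      have hAY : T Y A := hA.congr ⟨fun x hx => hag.1 x (hAs x hx),
        fun x hx y hy => hag.2 x (hAs x hx) y (hAs y hy)⟩
      have e : ((A ∪ B) \ G) ∪ Z = A ∪ ((B \ G) ∪ Z) := by
        ext x
        have := hAs x
        simp only [Set.mem_union, Set.mem_sdiff] at *
        tauto
      rw [e]
      have hBs : ∀ x ∈ B, x ∉ G → x ∈ (A ∪ B) \ G := fun x hx hxG => ⟨Or.inr hx, hxG⟩
      have hdis : ∀ x ∈ A, x ∉ (B \ G) ∪ Z := by
        rintro x hx (hx' | hx')
        · exact disj x hx hx'.1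
        · exact hZ x hx' (hAs x hx)
      by_cases h2 : ∃ x ∈ R, x ∈ G
      · obtain ⟨x0, hx0, hx0G⟩ := h2
        have hMe : ∀ y, y ∉ M := fun y hy =>
          hiso x0 hx0G y (Or.inl (hM y hy)) (hAs y (hM y hy)).2
            (X.symm ((hcross y (hM y hy) x0 (hR x0 hx0)).2 ⟨hy, hx0⟩))
        refine T.sw _ _ ∅ ∅ hAY hT' ⟨hdis, ?_, ?_, ?_, ?_⟩ (CoConn.empty Y)
        · intro x hx; exact hx.elim
        · intro x hx; exact hx.elim
        · intro x hx; exact hx.elim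
        · rintro x hx y (hy | hy)
          · rw [hag.2 x (hAs x hx) y (hBs y hy.1 hy.2), hcross x hx y hy.1]
            exact ⟨fun h => (hMe x h.1).elim, fun h => h.1.elim⟩
          · exact ⟨fun h => (hZadj y hy x (hAs x hx) (Y.symm h)).elim, fun h => h.1.elim⟩
      · push Not at h2
        refine T.sw _ _ M R hAY hT' ⟨hdis, hM, ?_, ?_, ?_⟩
          (hcc.congr fun x hx y hy => hag.2 x (hAs x (hM x hx)) y (hAs y (hM y hy)))
        · intro x hx; exact Or.inl ⟨hR x hx, h2 x hx⟩
        · intro x hx y hy hyM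
          rw [hag.2 x (hAs x (hM x hx)) y (hAs y hy)]
          exact hcomp x hx y hy hyM
        · rintro x hx y (hy | hy)
          · rw [hag.2 x (hAs x hx) y (hBs y hy.1 hy.2), hcross x hx y hy.1]
          · exact ⟨fun h => (hZadj y hy x (hAs x hx) (Y.symm h)).elim,
              fun h => (hZ y hy (hBs y (hR y h.2) (h2 y h.2))).elim⟩
    push Not at h1 h1'
    obtain ⟨b0, hb0, hb0A⟩ := h1
    obtain ⟨a0, ha0, ha0B⟩ := h1'
    have ha0A : a0 ∈ A := (hG a0 ha0).resolve_right ha0B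
    have hb0B : b0 ∈ B := (hG b0 hb0).resolve_left hb0A
    obtain ⟨x, hx, y, hy, hyU, hxy⟩ := hconn (G ∩ A) (fun x hx => hx.1) ⟨a0, ha0, ha0A⟩
      ⟨b0, hb0, fun h => hb0A h.2⟩
    have hyB : y ∈ B := (hG y hy).resolve_left fun h => hyU ⟨hy, h⟩
    obtain ⟨hxM, hyR⟩ := (hcross x hx.2 y hyB).1 hxy
    have hMG : ∀ z ∈ M, z ∈ G := fun z hz => by
      by_contra hzG
      exact hiso y hy z (Or.inl (hM z hz)) hzG
        (X.symm ((hcross z (hM z hz) y hyB).2 ⟨hz, hyR⟩))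
    have hRG : ∀ z ∈ R, z ∈ G := fun z hz => by
      by_contra hzG
      exact hiso x hx.1 z (Or.inr (hR z hz)) hzG
        ((hcross x hx.2 z (hR z hz)).2 ⟨hxM, hz⟩)
    have hGA : G ∩ A = M := by
      ext z
      refine ⟨fun hz => ?_, fun hz => ⟨hMG z hz, hM z hz⟩⟩
      by_contra hzM
      obtain ⟨u, hu, v, hv, hvU, huv⟩ := hconn {z | z ∈ G ∧ z ∈ A ∧ z ∉ M} (fun x hx => hx.1)
        ⟨z, hz.1, hz.2, hzM⟩ ⟨b0, hb0, fun h => hb0A h.2.1⟩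
      rcases hG v hv with hvA | hvB
      · have hvM : v ∈ M := by
          by_contra hh; exact hvU ⟨hv, hvA, hh⟩
        exact hcomp v hvM u hu.2.1 hu.2.2 (X.symm huv)
      · exact hu.2.2 ((hcross u hu.2.1 v hvB).1 huv).1
    refine ⟨A ∪ B, hG, fun x hx => hx, ?_, fun Y Z _ _ _ h => h⟩
    refine Principal.sw A B R hA hB rfl ?_ hRG ⟨a0, ha0, ha0A⟩ ⟨b0, hb0, hb0B⟩
    rw [hGA]; exact hc
  | p I J f P s L R hT hF hP ih =>
    intro G hG hne hconn hiso
    have fibR := hF.fib hP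
    have fibL := hF.swap.fib hP.swap
    have connR := fibR.conn hP.fin hP.card hP.prime
    have connL := fibL.conn hP.fin hP.card hP.prime.swap
    by_cases h1 : ∃ i, ∀ x ∈ G, f x = i
    · obtain ⟨i, hi⟩ := h1
      have hiJ : i ∈ J := by
        obtain ⟨x, hx⟩ := hne
        rw [← hi x hx]; exact hF.hf x (hG x hx)
      have key : ∀ (W : Set V), (∀ x ∈ W, x ∈ s) → Conn X W → (∀ i ∈ J, ∃ x ∈ W, f x = i) →
          ∀ x ∈ G, x ∉ W := by
        intro W hW hWc hWn x hx hxW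
        obtain ⟨k, hk, hk1, _⟩ := exists_ne2 hP.fin (by have := hP.card; omega) i i
        obtain ⟨z, hz, hzk⟩ := hWn k hk
        have hzG : z ∉ G := fun h => hk1 (by rw [← hzk, hi z h])
        obtain ⟨a, ha, b, hb, hbU, hab⟩ := hWc (W ∩ G) (fun x hx => hx.1) ⟨x, hxW, hx⟩
          ⟨z, hz, fun h => hzG h.2⟩
        exact hiso a ha.2 b (hW b hb) (fun h => hbU ⟨hb, h⟩) hab
      have hGL := key L hF.hL connL hP.neL
      have hGR := key R hF.hR connR hP.neR
      obtain ⟨t, ht1, ht2, ht3, ht4⟩ := ih i hiJ G (fun x hx => ⟨hG x hx, hi x hx⟩) hne hconn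
        (fun x hx y hy hyG => hiso x hx y hy.1 hyG)
      refine ⟨t, ht1, fun x hx => (ht2 x hx).1, ht3, ?_⟩
      intro Y Z hag hZ hZadj hTY
      have hT' := ht4 Y Z ⟨fun x hx => hag.1 x ⟨hx.1.1, hx.2⟩,
        fun x hx y hy => hag.2 x ⟨hx.1.1, hx.2⟩ y ⟨hy.1.1, hy.2⟩⟩
        (fun x hx hx' => hZ x hx ⟨hx'.1.1, hx'.2⟩)
        (fun x hx y hy => hZadj x hx y ⟨hy.1.1, hy.2⟩) hTY
      classical
      let f' : V → I := fun x => if x ∈ Z then i else f x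
      have f'Z : ∀ x ∈ Z, f' x = i := fun x hx => if_pos hx
      have f's : ∀ x ∈ s, x ∉ G → f' x = f x := fun x hx hxG =>
        if_neg fun hxZ => hZ x hxZ ⟨hx, hxG⟩
      have hLs : ∀ x ∈ L, x ∈ s \ G := fun x hx => ⟨hF.hL x hx, fun h => hGL x h hx⟩
      have hRs : ∀ x ∈ R, x ∈ s \ G := fun x hx => ⟨hF.hR x hx, fun h => hGR x h hx⟩
      have ZL : ∀ x ∈ Z, x ∉ L := fun x hx h => hZ x hx (hLs x h)
      have ZR : ∀ x ∈ Z, x ∉ R := fun x hx h => hZ x hx (hRs x h)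
      refine T.p I J f' P _ L R ?_ ⟨?_, ?_, hF.disj, ?_, ?_, ?_⟩ ⟨hP.fin, hP.card, hP.prime, ?_, ?_⟩
      · intro j hj
        by_cases hji : j = i
        · subst hji
          convert hT' using 1
          ext x
          by_cases hxZ : x ∈ Z
          · simp [hxZ, f'Z]
          · have : f' x = f x := if_neg hxZ
            simp only [Set.mem_inter_iff, Set.mem_union, Set.mem_sdiff, hxZ, or_false,
              Set.mem_preimage, this, Set.mem_singleton_iff]
            tauto
        · have hsub : ∀ x ∈ s ∩ f ⁻¹' {j}, x ∈ s \ G := fun x hx =>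
            ⟨hx.1, fun h => hji (by rw [← hi x h]; exact hx.2.symm)⟩
          have := (hT j hj).congr (Y := Y) ⟨fun x hx => hag.1 x (hsub x hx),
            fun x hx y hy => hag.2 x (hsub x hx) y (hsub y hy)⟩
          convert this using 1
          ext x
          by_cases hxZ : x ∈ Z
          · have h3 : f' x = i := if_pos hxZ
            have h4 := hZ x hxZ
            have h5 := hsub x
            simp only [Set.mem_inter_iff, Set.mem_union, Set.mem_sdiff, hxZ, or_true,
              Set.mem_preimage, h3, Set.mem_singleton_iff, true_and] at *
            constructor
            · intro h; exact (hji h.symm).elim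
            · intro h; exact (h4 (h5 h)).elim
          · have h3 : f' x = f x := if_neg hxZ
            have h5 := hsub x
            simp only [Set.mem_inter_iff, Set.mem_union, Set.mem_sdiff, hxZ, or_false,
              Set.mem_preimage, h3, Set.mem_singleton_iff] at *
            tauto
      · intro x hx; exact Or.inl (hLs x hx)
      · intro x hx; exact Or.inl (hRs x hx)
      · rintro x (hx | hx)
        · rw [f's x hx.1 hx.2]; exact hF.hf x hx.1
        · rw [f'Z x hx]; exact hiJ
      · rintro x (hx | hx) y (hy | hy) hxy hadj
        · rw [f's x hx.1 hx.2, f's y hy.1 hy.2] at hxy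
          exact hF.same x hx.1 y hy.1 hxy ((hag.2 x hx y hy).1 hadj)
        · exact (hZadj y hy x hx (Y.symm hadj)).elim
        · exact (hZadj x hx y hy hadj).elim
        · have := ZL x hx; have := ZL y hy; have := ZR x hx; have := ZR y hy
          tauto
      · rintro x (hx | hx) y (hy | hy) hxy
        · rw [f's x hx.1 hx.2, f's y hy.1 hy.2] at *
          rw [hag.2 x hx y hy]
          exact hF.cross x hx.1 y hy.1 hxy
        · have := ZL y hy; have := ZR y hy
          have : ¬ Y.adj x y := fun h => hZadj y hy x hx (Y.symm h)
          tauto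
        · have := ZL x hx; have := ZR x hx
          have : ¬ Y.adj x y := fun h => hZadj x hx y hy h
          tauto
        · rw [f'Z x hx, f'Z y hy] at hxy
          exact (hxy rfl).elim
      · intro j hj
        obtain ⟨x, hx, hxj⟩ := hP.neL j hj
        exact ⟨x, hx, by rw [f's x (hLs x hx).1 (hLs x hx).2, hxj]⟩
      · intro j hj
        obtain ⟨x, hx, hxj⟩ := hP.neR j hj
        exact ⟨x, hx, by rw [f's x (hRs x hx).1 (hRs x hx).2, hxj]⟩
    · push Not at h1
      obtain ⟨x0, hx0⟩ := hne
      obtain ⟨y0, hy0, hy0x⟩ := h1 (f x0)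
      obtain ⟨x, hx, y, hy, hyU, hxy⟩ := hconn {z | z ∈ G ∧ f z = f x0} (fun x hx => hx.1)
        ⟨x0, hx0, rfl⟩ ⟨y0, hy0, fun h => hy0x h.2⟩
      have hfne : f x ≠ f y := fun h => hyU ⟨hy, by rw [← h, hx.2]⟩
      have sub1 : ∀ W : Set V, (∀ x ∈ W, x ∈ s) → Conn X W → x ∈ W → ∀ z ∈ W, z ∈ G := by
        intro W hW hWc hxW z hz
        by_contra hzG
        obtain ⟨a, ha, b, hb, hbU, hab⟩ := hWc (W ∩ G) (fun x hx => hx.1) ⟨x, hxW, hx.1⟩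
          ⟨z, hz, fun h => hzG h.2⟩
        exact hiso a ha.2 b (hW b hb) (fun h => hbU ⟨hb, h⟩) hab
      have sub2 : ∀ W : Set V, (∀ a ∈ W, ∀ b ∈ s, X.adj a b → b ∈ W) → x ∈ W →
          ∀ z ∈ G, z ∈ W := by
        intro W hW hxW z hz
        by_contra hzW
        obtain ⟨a, ha, b, hb, hbU, hab⟩ := hconn (W ∩ G) (fun x hx => hx.2) ⟨x, hxW, hx.1⟩
          ⟨z, hz, fun h => hzW h.1⟩
        exact hbU ⟨hW a ha.1 b (hG b hb) hab, hb⟩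
      refine ⟨s, hG, fun x hx => hx, ?_, fun Y Z _ _ _ h => h⟩
      have clL : ∀ a ∈ L, ∀ b ∈ s, X.adj a b → b ∈ L := by
        intro a ha b hb hab
        by_cases hf : f a = f b
        · exact (hF.same a (hF.hL a ha) b hb hf hab).1.1 ha
        · rcases (hF.cross a (hF.hL a ha) b hb hf).1 hab with h | h
          · exact h.2.1
          · exact (hF.disj a ha h.1).elim
      have clR : ∀ a ∈ R, ∀ b ∈ s, X.adj a b → b ∈ R := by
        intro a ha b hb hab
        by_cases hf : f a = f b
        · exact (hF.same a (hF.hR a ha) b hb hf hab).2.1 ha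
        · rcases (hF.cross a (hF.hR a ha) b hb hf).1 hab with h | h
          · exact (hF.disj a h.1 ha).elim
          · exact h.2.1
      rcases (hF.cross x (hG x hx.1) y (hG y hy) hfne).1 hxy with h | h
      · have : G = L := by
          ext z; exact ⟨sub2 L clL h.1 z, sub1 L hF.hL connL h.1 z⟩
        subst this
        exact Principal.p I J f _ R hT hF.swap hP.swap
      · have : G = R := by
          ext z; exact ⟨sub2 R clR h.1 z, sub1 R hF.hR connR h.1 z⟩
        subst this
        exact Principal.p I J f _ L hT hF hP

theorem conn_of_not_coConn {V : Type} {X : PG V} {G : Set V} (h : ¬ CoConn X G) : Conn X G := by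
  unfold CoConn at h
  push Not at h
  obtain ⟨U, hU, ⟨u, hu⟩, ⟨v, hv, hvU⟩, hadj⟩ := h
  intro W hW ⟨w, hw⟩ ⟨w', hw', hw'W⟩
  by_contra hc
  push Not at hc
  have h1 : ∀ a ∈ W, ∀ b ∈ G, b ∉ W → (a ∈ U ↔ b ∈ U) := by
    intro a ha b hb hbW
    by_contra hne
    by_cases haU : a ∈ U
    · exact hc a ha b hb hbW (hadj a haU b hb (by tauto))
    · exact hc a ha b hb hbW (X.symm (hadj b (by tauto) a (hW a ha) haU))
  have h2 := h1 w hw w' hw' hw'W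
  by_cases hwU : w ∈ U
  · by_cases hvW : v ∈ W
    · have := h1 v hvW w' hw' hw'W; tauto
    · have := h1 w hw v hv hvW; tauto
  · by_cases huW : u ∈ W
    · have := h1 u huW w' hw' hw'W; tauto
    · have := h1 w hw u (hU u hu) huW; tauto

/-- The unrestricted switch rule is admissible. -/
theorem T.swAdm {V : Type} [Finite V] {X : PG V} : ∀ (n : ℕ) (M A B R : Set V), M.ncard = n →
    T X A → T X B → SwCond X A B M R → T X (A ∪ B) := by
  intro n
  induction n using Nat.strong_induction_on with
  | _ n ih =>
    intro M A B R hn hA hB hc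
    by_cases hcc : CoConn X M
    · exact T.sw A B M R hA hB hc hcc
    have hconn := conn_of_not_coConn hcc
    have hne : ∃ x, x ∈ M := by
      by_contra h
      push Not at h
      apply hcc
      intro U hU ⟨x, hx⟩
      exact (h x (hU x hx)).elim
    obtain ⟨t, ht1, ht2, ht3, ht4⟩ := hA.split M hc.hM hne hconn hc.comp
    have key := ht4 X (M ∪ B) ⟨fun _ _ => rfl, fun _ _ _ _ => Iff.rfl⟩
      (by
        rintro x (hx | hx) hx'
        · exact hx'.2 hx
        · exact hc.disj x hx'.1 hx)
      (by
        rintro x (hx | hx) y hy hxy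
        · exact hc.comp x hx y hy.1 hy.2 hxy
        · exact hy.2 ((hc.cross y hy.1 x hx).1 (X.symm hxy)).1)
    have e1 : A \ M ∪ (M ∪ B) = A ∪ B := by
      ext x
      have := hc.hM x
      simp only [Set.mem_union, Set.mem_sdiff]
      tauto
    have e2 : t \ M ∪ (M ∪ B) = t ∪ B := by
      ext x
      have := ht1 x
      simp only [Set.mem_union, Set.mem_sdiff]
      tauto
    rw [e1, e2] at key
    apply key
    cases ht3 with
    | ax x y _ _ hM _ =>
      exfalso
      apply hcc
      rintro U hU ⟨u, hu⟩ ⟨v, hv, hvU⟩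
      have := hU u hu
      rw [hM] at this hv
      have h1 : u = x := this
      have h2 : v = x := hv
      subst h1; subst h2
      exact (hvU hu).elim
    | p I J f P K _ hF hP =>
      exact (hcc ((hF.fib hP).coConn hP.fin hP.card hP.prime)).elim
    | sw A1 A2 R1 hA1 hA2 e hc1 hR1 hn1 hn2 =>
      subst e
      obtain ⟨x1, hx1, hx1A⟩ := hn1
      obtain ⟨x2, hx2, hx2A⟩ := hn2
      have s1 : (M ∩ A1).ncard < n := by
        rw [← hn]
        apply Set.ncard_lt_ncard _ (Set.toFinite M)
        exact ⟨Set.inter_subset_left, fun h => hc1.disj x2 (h hx2).2 hx2A⟩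
      have s2 : (M ∩ A2).ncard < n := by
        rw [← hn]
        apply Set.ncard_lt_ncard _ (Set.toFinite M)
        exact ⟨Set.inter_subset_left, fun h => hc1.disj x1 hx1A (h hx1).2⟩
      have step1 : T X (A2 ∪ B) := by
        refine ih _ s2 (M ∩ A2) A2 B R rfl hA2 hB ⟨?_, ?_, hc.hR, ?_, ?_⟩
        · intro x hx; exact hc.disj x (ht2 x (Or.inr hx))
        · intro x hx; exact hx.2
        · intro x hx y hy hyM
          exact hc.comp x hx.1 y (ht2 y (Or.inr hy)) fun h => hyM ⟨h, hy⟩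
        · intro x hx y hy
          rw [hc.cross x (ht2 x (Or.inr hx)) y hy]
          simp [hx]
      rw [Set.union_assoc]
      refine ih _ s1 (M ∩ A1) A1 (A2 ∪ B) (R1 ∪ R) rfl hA1 step1 ⟨?_, ?_, ?_, ?_, ?_⟩
      · rintro x hx (hx' | hx')
        · exact hc1.disj x hx hx'
        · exact hc.disj x (ht2 x (Or.inl hx)) hx'
      · intro x hx; exact hx.2
      · rintro x (hx | hx)
        · exact Or.inl (hc1.hR x hx)
        · exact Or.inr (hc.hR x hx)
      · exact hc1.comp
      · rintro x hx y (hy | hy)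
        · rw [hc1.cross x hx y hy]
          have : y ∉ R := fun h => hc.disj y (ht2 y (Or.inr hy)) (hc.hR y h)
          simp [this]
        · rw [hc.cross x (ht2 x (Or.inl hx)) y hy]
          have : y ∉ R1 := fun h => hc.disj y (ht2 y (Or.inr (hc1.hR y h))) hy
          simp [this, hx]

theorem FCond.restrict {V I : Type} {X : PG V} {s L R : Set V} {f : V → I} {J : Set I}
    {P : I → I → Prop} (h : FCond X s L R f J P) (K : Set I) :
    FCond X (s ∩ f ⁻¹' K) (L ∩ f ⁻¹' K) (R ∩ f ⁻¹' K) f (J ∩ K) P := by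
  refine ⟨fun x hx => ⟨h.hL x hx.1, hx.2⟩, fun x hx => ⟨h.hR x hx.1, hx.2⟩,
    fun x hx hx' => h.disj x hx.1 hx'.1, fun x hx => ⟨h.hf x hx.1, hx.2⟩, ?_, ?_⟩
  · intro x hx y hy hxy ha
    have := h.same x hx.1 y hy.1 hxy ha
    have h1 := hx.2
    have h2 := hy.2
    simp only [Set.mem_inter_iff]
    tauto
  · intro x hx y hy hxy
    rw [h.cross x hx.1 y hy.1 hxy]
    have h1 := hx.2
    have h2 := hy.2
    simp only [Set.mem_inter_iff]
    tauto

theorem FCond.collapse {V I : Type} {X : PG V} {s L R : Set V} {f : V → I} {J : Set I}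
    {Q : I → I → Prop} (h : FCond X s L R f J Q) (hs : ∀ i ∈ J, ∀ j ∈ J, Q i j → Q j i)
    (U : Set I) (hU : ∀ x ∈ U, x ∈ J)
    (hm : ∀ v ∈ J, v ∉ U → ∀ x ∈ U, ∀ y ∈ U, (Q v x ↔ Q v y)) (u : I) (hu : u ∈ U)
    (f' : V → I) (hf1 : ∀ x, f x ∈ U → f' x = u) (hf2 : ∀ x, f x ∉ U → f' x = f x) :
    FCond X s L R f' ((J \ U) ∪ {u}) Q := by
  refine ⟨h.hL, h.hR, h.disj, ?_, ?_, ?_⟩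
  · intro x hx
    by_cases hxU : f x ∈ U
    · rw [hf1 x hxU]; right; rfl
    · rw [hf2 x hxU]; left; exact ⟨h.hf x hx, hxU⟩
  · intro x hx y hy hxy ha
    by_cases he : f x = f y
    · exact h.same x hx y hy he ha
    · have := (h.cross x hx y hy he).1 ha
      have d1 := h.disj x
      have d2 := h.disj y
      tauto
  · intro x hx y hy hxy
    by_cases hxU : f x ∈ U
    · have hyU : f y ∉ U := fun hyU => hxy (by rw [hf1 x hxU, hf1 y hyU])
      have hne : f x ≠ f y := fun hh => hyU (hh ▸ hxU)
      rw [h.cross x hx y hy hne, hf1 x hxU, hf2 y hyU]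
      have e1 := hm (f y) (h.hf y hy) hyU (f x) hxU u hu
      have e2 := hs (f y) (h.hf y hy) (f x) (h.hf x hx)
      have e3 := hs (f x) (h.hf x hx) (f y) (h.hf y hy)
      have e4 := hs (f y) (h.hf y hy) u (hU u hu)
      have e5 := hs u (hU u hu) (f y) (h.hf y hy)
      have e : Q (f x) (f y) ↔ Q u (f y) := by tauto
      rw [e]
    · by_cases hyU : f y ∈ U
      · have hne : f x ≠ f y := fun hh => hxU (hh ▸ hyU)
        rw [h.cross x hx y hy hne, hf1 y hyU, hf2 x hxU, hm (f x) (h.hf x hx) hxU (f y) hyU u hu]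
      · rw [hf2 x hxU, hf2 y hyU] at hxy ⊢
        exact h.cross x hx y hy hxy

theorem FCond.one {V I : Type} [Finite V] {X : PG V} {s L R : Set V} {f : V → I} {J : Set I}
    {Q : I → I → Prop} (h : FCond X s L R f J Q) (i : I)
    (hno : ∀ x ∈ L, f x = i → ∀ y ∈ L, f y ≠ i → Q (f x) (f y))
    (h1 : T X (s ∩ f ⁻¹' {i})) (h2 : T X (s ∩ f ⁻¹' {i}ᶜ)) : T X s := by
  have e : s = (s ∩ f ⁻¹' {i}) ∪ (s ∩ f ⁻¹' {i}ᶜ) := by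
    ext x
    simp only [Set.mem_union, Set.mem_inter_iff, Set.mem_preimage, Set.mem_compl_iff]
    tauto
  rw [e]
  refine T.swAdm _ (R ∩ f ⁻¹' {i}) _ _ {y | y ∈ R ∧ f y ≠ i ∧ Q i (f y)} rfl h1 h2
    ⟨?_, ?_, ?_, ?_, ?_⟩
  · intro x hx hx'; exact hx'.2 hx.2
  · intro x hx; exact ⟨h.hR x hx.1, hx.2⟩
  · intro x hx; exact ⟨h.hR x hx.1, hx.2.1⟩
  · intro x hx y hy hyM ha
    have hxi : f x = i := hx.2
    have hyi : f y = i := hy.2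
    have := (h.same x (h.hR x hx.1) y hy.1 (by rw [hxi, hyi]) ha).2
    exact hyM ⟨this.1 hx.1, hy.2⟩
  · intro x hx y hy
    have hxi : f x = i := hx.2
    have hyi : f y ≠ i := hy.2
    rw [h.cross x hx.1 y hy.1 (by rw [hxi]; exact hyi.symm)]
    have := fun hh => hno x hh hxi y
    have hxi' : x ∈ f ⁻¹' {i} := hx.2
    simp only [Set.mem_inter_iff, Set.mem_ofPred_eq]
    rw [hxi] at this ⊢
    tauto

/-- Functoriality: fibrewise derivations can be combined. -/
theorem T.func {V I : Type} [Finite V] {X : PG V} : ∀ (n : ℕ) (J : Set I), J.Finite →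
    J.ncard = n → ∀ (f : V → I) (Q : I → I → Prop) (s L R : Set V), FCond X s L R f J Q →
    (∀ i ∈ J, ∀ j ∈ J, Q i j → Q j i) → (∀ i ∈ J, T X (s ∩ f ⁻¹' {i})) → T X s := by
  intro n
  induction n using Nat.strong_induction_on with
  | _ n ih =>
  intro J hfin hn f Q s L R h hs hT
  classical
  -- removing one index
  have rest : ∀ i ∈ J, T X (s ∩ f ⁻¹' {i}ᶜ) := by
    intro i hi
    have hsub : J ∩ {i}ᶜ ⊆ J := Set.inter_subset_left
    refine ih (J ∩ {i}ᶜ).ncard ?_ (J ∩ {i}ᶜ) (hfin.subset hsub) rfl f Q _ _ _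
      (h.restrict {i}ᶜ) (fun a ha b hb => hs a ha.1 b hb.1) ?_
    · rw [← hn]
      exact Set.ncard_lt_ncard ⟨hsub, fun hh => (hh hi).2 rfl⟩ hfin
    · intro j hj
      have e : s ∩ f ⁻¹' {i}ᶜ ∩ f ⁻¹' {j} = s ∩ f ⁻¹' {j} := by
        ext x
        simp only [Set.mem_inter_iff, Set.mem_preimage, Set.mem_compl_iff, Set.mem_singleton_iff]
        constructor
        · tauto
        · rintro ⟨h1, h2⟩
          exact ⟨⟨h1, fun h3 => hj.2 (h2 ▸ h3)⟩, h2⟩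
      rw [e]; exact hT j hj.1
  by_cases neL : ∀ i ∈ J, ∃ x ∈ L, f x = i
  swap
  · push Not at neL
    obtain ⟨i, hi, hne⟩ := neL
    exact h.one i (fun x hx hxi => (hne x hx hxi).elim) (hT i hi) (rest i hi)
  by_cases neR : ∀ i ∈ J, ∃ x ∈ R, f x = i
  swap
  · push Not at neR
    obtain ⟨i, hi, hne⟩ := neR
    exact h.swap.one i (fun x hx hxi => (hne x hx hxi).elim) (hT i hi) (rest i hi)
  by_cases hp : PrimeOn Q J
  · by_cases h4 : 4 ≤ J.ncard
    · exact T.p I J f Q s L R hT h ⟨hfin, h4, hp, neL, neR⟩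
    have hcases : J.ncard = 0 ∨ J.ncard = 1 ∨ J.ncard = 2 ∨ J.ncard = 3 := by omega
    rcases hcases with hc | hc | hc | hc
    · have hJ : J = ∅ := (Set.ncard_eq_zero hfin).1 hc
      have : s = ∅ := by
        ext x
        constructor
        · intro hx
          have := h.hf x hx
          rw [hJ] at this
          exact this.elim
        · intro hx; exact hx.elim
      rw [this]; exact T.emp
    · obtain ⟨i, rfl⟩ := Set.ncard_eq_one.1 hc
      have : s = s ∩ f ⁻¹' {i} := by
        ext x
        exact ⟨fun hx => ⟨hx, h.hf x hx⟩, fun hx => hx.1⟩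
      rw [this]; exact hT i rfl
    · obtain ⟨a, b, hab, rfl⟩ := Set.ncard_eq_two.1 hc
      have hb : ∀ y ∈ s, f y ≠ a → f y = b := by
        intro y hy hya
        rcases h.hf y hy with h1 | h1
        · exact (hya h1).elim
        · exact h1
      by_cases hQ : Q a b
      · refine h.one a ?_ (hT a (by simp)) (rest a (by simp))
        intro x hx hxa y hy hya
        rw [hxa, hb y (h.hL y hy) hya]; exact hQ
      · refine h.swap.one a ?_ (hT a (by simp)) (rest a (by simp))
        intro x hx hxa y hy hya
        rw [hxa, hb y (h.hR y hy) hya]; exact hQ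
    · exfalso
      obtain ⟨a, b, c, hab, hac, hbc, rfl⟩ := Set.ncard_eq_three.1 hc
      have key : ∀ x y z : I, x ∈ ({a, b, c} : Set I) → y ∈ ({a, b, c} : Set I) →
          z ∈ ({a, b, c} : Set I) → x ≠ y → x ≠ z → y ≠ z →
          (∀ w ∈ ({a, b, c} : Set I), w = x ∨ w = y ∨ w = z) → ¬ (Q z x ↔ Q z y) := by
        intro x y z hx hy hz hxy hxz hyz hall hQ
        rcases hp {x, y} (by rintro w (rfl | rfl) <;> assumption) (by
          intro v hv hvU p hp' q hq
          simp only [Set.mem_insert_iff, Set.mem_singleton_iff, not_or] at hvU hp' hq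
          have hvz : v = z := by
            have := hall v hv; tauto
          subst hvz
          rcases hp' with rfl | rfl <;> rcases hq with rfl | rfl <;> tauto) with h1 | h1
        · exact hxy (h1 x (by simp) y (by simp))
        · have := h1 z hz
          simp only [Set.mem_insert_iff, Set.mem_singleton_iff] at this
          rcases this with h2 | h2
          · exact hxz h2.symm
          · exact hyz h2.symm
      have ha : a ∈ ({a, b, c} : Set I) := by simp
      have hb : b ∈ ({a, b, c} : Set I) := by simp
      have hc' : c ∈ ({a, b, c} : Set I) := by simp
      have k1 := key a b c ha hb hc' hab hac hbc (by
        intro w hw; simp only [Set.mem_insert_iff, Set.mem_singleton_iff] at hw; tauto)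
      have k2 := key a c b ha hc' hb hac hab hbc.symm (by
        intro w hw; simp only [Set.mem_insert_iff, Set.mem_singleton_iff] at hw; tauto)
      have k3 := key b c a hb hc' ha hbc hab.symm hac.symm (by
        intro w hw; simp only [Set.mem_insert_iff, Set.mem_singleton_iff] at hw; tauto)
      have s1 := hs a ha b hb
      have s2 := hs b hb a ha
      have s3 := hs a ha c hc'
      have s4 := hs c hc' a ha
      have s5 := hs b hb c hc'
      have s6 := hs c hc' b hb
      have e1 : Q b a ↔ Q a b := ⟨s2, s1⟩
      have e2 : Q c a ↔ Q a c := ⟨s4, s3⟩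
      have e3 : Q c b ↔ Q b c := ⟨s6, s5⟩
      rw [e2, e3] at k1
      rw [e1] at k2
      clear s1 s2 s3 s4 s5 s6 e1 e2 e3 key ih hs hT rest neL neR hp
      by_cases q1 : Q a b <;> by_cases q2 : Q a c <;> by_cases q3 : Q b c <;> simp_all
  · unfold PrimeOn at hp
    push Not at hp
    obtain ⟨U, hU, hm, ⟨u, hu, w, hw, huw⟩, z, hz, hzU⟩ := hp
    have hUfin : U.Finite := hfin.subset hU
    have hTU : T X (s ∩ f ⁻¹' U) := by
      have hsub : J ∩ U ⊆ J := Set.inter_subset_left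
      refine ih (J ∩ U).ncard ?_ (J ∩ U) (hfin.subset hsub) rfl f Q _ _ _
        (h.restrict U) (fun a ha b hb => hs a ha.1 b hb.1) ?_
      · rw [← hn]
        exact Set.ncard_lt_ncard ⟨hsub, fun hh => hzU (hh hz).2⟩ hfin
      · intro j hj
        have e : s ∩ f ⁻¹' U ∩ f ⁻¹' {j} = s ∩ f ⁻¹' {j} := by
          ext x
          simp only [Set.mem_inter_iff, Set.mem_preimage, Set.mem_singleton_iff]
          constructor
          · tauto
          · rintro ⟨h1, h2⟩
            exact ⟨⟨h1, h2 ▸ hj.2⟩, h2⟩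
        rw [e]; exact hT j hj.1
    have hf1 : ∀ x, f x ∈ U → (fun x => if f x ∈ U then u else f x) x = u := by
      intro x hx; simp [hx]
    have hf2 : ∀ x, f x ∉ U → (fun x => if f x ∈ U then u else f x) x = f x := by
      intro x hx; simp [hx]
    have hsub : (J \ U) ∪ {u} ⊆ J := by
      rintro x (hx | rfl)
      · exact hx.1
      · exact hU _ hu
    refine ih _ ?_ ((J \ U) ∪ {u}) (hfin.subset hsub) rfl _ Q s L R
      (h.collapse hs U hU hm u hu _ hf1 hf2) (fun a ha b hb => hs a (hsub ha) b (hsub hb)) ?_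
    · rw [← hn]
      refine Set.ncard_lt_ncard ⟨hsub, fun hh => ?_⟩ hfin
      rcases hh (hU w hw) with h1 | h1
      · exact h1.2 hw
      · exact huw h1.symm
    · rintro j (hj | rfl)
      · have e : s ∩ (fun x => if f x ∈ U then u else f x) ⁻¹' {j} = s ∩ f ⁻¹' {j} := by
          ext x
          simp only [Set.mem_inter_iff, Set.mem_preimage, Set.mem_singleton_iff]
          by_cases hx : f x ∈ U
          · simp only [hx, if_true]
            constructor
            · rintro ⟨_, rfl⟩; exact (hj.2 hu).elim
            · rintro ⟨_, rfl⟩; exact (hj.2 hx).elim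
          · simp only [hx, if_false]
        rw [e]; exact hT j hj.1
      · have e : s ∩ (fun x => if f x ∈ U then j else f x) ⁻¹' {j} = s ∩ f ⁻¹' U := by
          ext x
          simp only [Set.mem_inter_iff, Set.mem_preimage, Set.mem_singleton_iff]
          by_cases hx : f x ∈ U
          · simp only [hx, if_true]
          · simp only [hx, if_false]
            constructor
            · rintro ⟨_, rfl⟩; exact (hx hu).elim
            · rintro ⟨_, hh⟩; exact hh.elim
        rw [e]; exact hTU

theorem Fib.shrink {V I : Type} {X : PG V} {G : Set V} {f : V → I} {J : Set I}
    {P : I → I → Prop} (h : Fib X G f J P) (hfin : J.Finite) (hcard : 4 ≤ J.ncard)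
    (hp : PrimeOn P J) (M : Set V)
    (hm : ∀ v ∈ G, v ∉ M → ∀ x ∈ G, x ∈ M → ∀ y ∈ G, y ∈ M → (X.adj v x ↔ X.adj v y)) :
    ∃ G' : Set V, (∀ x ∈ G', x ∈ G) ∧
      (∀ x ∈ G, ∀ y ∈ G, f x ≠ f y → ((x ∈ M ↔ y ∈ M) ↔ x ∈ G' ∧ y ∈ G')) ∧
      (∀ x y, (x ∈ G ↔ y ∈ G) → (x ∈ M ↔ y ∈ M) → (x ∈ G' ↔ y ∈ G')) := by
  rcases h.module hfin hcard hp (G ∩ M) (fun x hx => hx.1) (by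
    intro v hv hvU x hx y hy
    exact hm v hv (fun hh => hvU ⟨hv, hh⟩) x hx.1 hx.2 y hy.1 hy.2) with h1 | h1
  · refine ⟨G \ M, fun x hx => hx.1, ?_, ?_⟩
    · intro x hx y hy hxy
      have : ¬ (x ∈ M ∧ y ∈ M) := fun hh => hxy (h1 x ⟨hx, hh.1⟩ y ⟨hy, hh.2⟩)
      simp only [Set.mem_sdiff]
      tauto
    · intro x y h2 h3
      simp only [Set.mem_sdiff]
      rw [h2, h3]
  · refine ⟨G, fun x hx => hx, ?_, fun x y h2 _ => h2⟩
    intro x hx y hy _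
    have := (h1 x hx).2
    have := (h1 y hy).2
    tauto

theorem FCond.psymm {V I : Type} {X : PG V} {s L R : Set V} {f : V → I} {J : Set I}
    {P : I → I → Prop} (h : FCond X s L R f J P) (h' : PCond L R f J P) :
    ∀ i ∈ J, ∀ j ∈ J, P i j → P j i := by
  intro i hi j hj hP
  by_cases hij : i = j
  · subst hij; exact hP
  · have fb := h.fib h'
    obtain ⟨x, hx, rfl⟩ := fb.ne i hi
    obtain ⟨y, hy, rfl⟩ := fb.ne j hj
    exact (fb.adj y hy x hx (Ne.symm hij)).1 (X.symm ((fb.adj x hx y hy hij).2 hP))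

/-- Admissibility of removing the edges around a module. -/
theorem T.ssAdm {V : Type} [Finite V] {X Y : PG V} {s : Set V} (h : T X s) (M : Set V) :
    (∀ v ∈ s, v ∉ M → ∀ x ∈ s, x ∈ M → ∀ y ∈ s, y ∈ M → (X.adj v x ↔ X.adj v y)) →
    (∀ x ∈ s, Y.lab x = X.lab x) →
    (∀ x ∈ s, ∀ y ∈ s, (Y.adj x y ↔ X.adj x y ∧ (x ∈ M ↔ y ∈ M))) → T Y s := by
  induction h with
  | emp => intro _ _ _; exact T.emp
  | ax x y hne hl ha =>
    intro _ hlab hadj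
    refine T.ax x y hne ?_ ?_
    · rw [hlab x (by simp), hlab y (by simp), hl]
    · rw [hadj x (by simp) y (by simp)]
      exact fun hh => ha hh.1
  | sw A B M' R hA hB hc hcc ihA ihB =>
    intro hm hlab hadj
    have TA := ihA (fun v hv hvM x hx hxM y hy hyM =>
      hm v (Or.inl hv) hvM x (Or.inl hx) hxM y (Or.inl hy) hyM) (fun x hx => hlab x (Or.inl hx))
      (fun x hx y hy => hadj x (Or.inl hx) y (Or.inl hy))
    have TB := ihB (fun v hv hvM x hx hxM y hy hyM =>
      hm v (Or.inr hv) hvM x (Or.inr hx) hxM y (Or.inr hy) hyM) (fun x hx => hlab x (Or.inr hx))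
      (fun x hx y hy => hadj x (Or.inr hx) y (Or.inr hy))
    by_cases p2 : ∃ x ∈ M', x ∉ M ∧ ∃ y ∈ R, y ∉ M
    · have p1 : ¬ ∃ x ∈ M', x ∈ M ∧ ∃ y ∈ R, y ∈ M := by
        rintro ⟨x1, hx1, hx1M, y1, hy1, hy1M⟩
        obtain ⟨x2, hx2, hx2M, y2, hy2, hy2M⟩ := p2
        obtain ⟨u, hu, v, hv, hvU, huv⟩ := hcc (M' ∩ M) (fun x hx => hx.1) ⟨x1, hx1, hx1M⟩
          ⟨x2, hx2, fun hh => hx2M hh.2⟩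
        have hvM : v ∉ M := fun hh => hvU ⟨hv, hh⟩
        apply huv
        apply X.symm
        rw [hm v (Or.inl (hc.hM v hv)) hvM u (Or.inl (hc.hM u hu.1)) hu.2 y1
          (Or.inr (hc.hR y1 hy1)) hy1M]
        exact (hc.cross v (hc.hM v hv) y1 (hc.hR y1 hy1)).2 ⟨hv, hy1⟩
      refine T.swAdm _ (M' \ M) A B (R \ M) rfl TA TB ⟨hc.disj, fun x hx => hc.hM x hx.1,
        fun x hx => hc.hR x hx.1, ?_, ?_⟩
      · intro x hx y hy hyM ha
        rw [hadj x (Or.inl (hc.hM x hx.1)) y (Or.inl hy)] at ha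
        exact hc.comp x hx.1 y hy (fun hh => hyM ⟨hh, fun h2 => hx.2 (ha.2.2 h2)⟩) ha.1
      · intro x hx y hy
        rw [hadj x (Or.inl hx) y (Or.inr hy), hc.cross x hx y hy]
        have := fun a b c d => p1 ⟨x, a, b, y, c, d⟩
        simp only [Set.mem_sdiff]
        clear hm hlab hadj TA TB ihA ihB p2 hc hcc
        by_cases q1 : x ∈ M <;> by_cases q2 : y ∈ M <;> by_cases q3 : x ∈ M' <;>
          by_cases q4 : y ∈ R <;> simp_all
    · refine T.swAdm _ (M' ∩ M) A B (R ∩ M) rfl TA TB ⟨hc.disj, fun x hx => hc.hM x hx.1,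
        fun x hx => hc.hR x hx.1, ?_, ?_⟩
      · intro x hx y hy hyM ha
        rw [hadj x (Or.inl (hc.hM x hx.1)) y (Or.inl hy)] at ha
        exact hc.comp x hx.1 y hy (fun hh => hyM ⟨hh, ha.2.1 hx.2⟩) ha.1
      · intro x hx y hy
        rw [hadj x (Or.inl hx) y (Or.inr hy), hc.cross x hx y hy]
        have := fun a b c d => p2 ⟨x, a, b, y, c, d⟩
        simp only [Set.mem_inter_iff]
        clear hm hlab hadj TA TB ihA ihB p2 hc hcc
        by_cases q1 : x ∈ M <;> by_cases q2 : y ∈ M <;> by_cases q3 : x ∈ M' <;>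
          by_cases q4 : y ∈ R <;> simp_all
  | p I J f P s L R hT h h' ih =>
    intro hm hlab hadj
    obtain ⟨L', hL1, hL2, hL3⟩ := (h.swap.fib h'.swap).shrink h'.fin h'.card h'.prime.swap M
      (fun v hv hvM x hx hxM y hy hyM =>
        hm v (h.hL v hv) hvM x (h.hL x hx) hxM y (h.hL y hy) hyM)
    obtain ⟨R', hR1, hR2, hR3⟩ := (h.fib h').shrink h'.fin h'.card h'.prime M
      (fun v hv hvM x hx hxM y hy hyM =>
        hm v (h.hR v hv) hvM x (h.hR x hx) hxM y (h.hR y hy) hyM)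
    refine T.func J.ncard J h'.fin rfl f P s L' R' ⟨fun x hx => h.hL x (hL1 x hx),
      fun x hx => h.hR x (hR1 x hx), fun x hx hx' => h.disj x (hL1 x hx) (hR1 x hx'), h.hf,
      ?_, ?_⟩ (h.psymm h') ?_
    · intro x hx y hy hxy ha
      rw [hadj x hx y hy] at ha
      have := h.same x hx y hy hxy ha.1
      exact ⟨hL3 x y this.1 ha.2, hR3 x y this.2 ha.2⟩
    · intro x hx y hy hxy
      rw [hadj x hx y hy, h.cross x hx y hy hxy]
      constructor
      · rintro ⟨⟨h1, h2, h3⟩ | ⟨h1, h2, h3⟩, h4⟩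
        · have := (hL2 x h1 y h2 hxy).1 h4
          exact Or.inl ⟨this.1, this.2, h3⟩
        · have := (hR2 x h1 y h2 hxy).1 h4
          exact Or.inr ⟨this.1, this.2, h3⟩
      · rintro (⟨h1, h2, h3⟩ | ⟨h1, h2, h3⟩)
        · exact ⟨Or.inl ⟨hL1 x h1, hL1 y h2, h3⟩, (hL2 x (hL1 x h1) y (hL1 y h2) hxy).2 ⟨h1, h2⟩⟩
        · exact ⟨Or.inr ⟨hR1 x h1, hR1 y h2, h3⟩, (hR2 x (hR1 x h1) y (hR1 y h2) hxy).2 ⟨h1, h2⟩⟩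
    · intro i hi
      exact ih i hi (fun v hv hvM x hx hxM y hy hyM =>
        hm v hv.1 hvM x hx.1 hxM y hy.1 hyM) (fun x hx => hlab x hx.1)
        (fun x hx y hy => hadj x hx.1 y hy.1)

/-- The configuration of a cut on `G` between `Γ, G` and `Ḡ, Δ`. -/
structure CutC {V : Type} (X1 X2 X3 : PG V) (Γ G Δ : Set V) : Prop where
  d1 : ∀ x ∈ Γ, x ∉ G
  d2 : ∀ x ∈ Δ, x ∉ G
  d3 : ∀ x ∈ Γ, x ∉ Δ
  a1 : Agree X1 X3 Γ
  a2 : Agree X2 X3 Δ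
  lab : ∀ x ∈ G, X2.lab x = dualAtom (X1.lab x)
  dual : ∀ x ∈ G, ∀ y ∈ G, (X2.adj x y ↔ x ≠ y ∧ ¬ X1.adj x y)
  n1 : ∀ x ∈ Γ, ∀ y ∈ G, ¬ X1.adj x y
  n2 : ∀ x ∈ Δ, ∀ y ∈ G, ¬ X2.adj x y
  n3 : ∀ x ∈ Γ, ∀ y ∈ Δ, ¬ X3.adj x y

theorem CutC.swap {V : Type} {X1 X2 X3 : PG V} {Γ G Δ : Set V} (h : CutC X1 X2 X3 Γ G Δ) :
    CutC X2 X1 X3 Δ G Γ := by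
  refine ⟨h.d2, h.d1, fun x hx hx' => h.d3 x hx' hx, h.a2, h.a1, ?_, ?_, h.n2, h.n1, ?_⟩
  · intro x hx; rw [h.lab x hx, dualAtom_dualAtom]
  · intro x hx y hy
    rw [h.dual x hx y hy]
    have : X1.adj x y → x ≠ y := by rintro ha rfl; exact X1.irrefl _ ha
    tauto
  · intro x hx y hy ha; exact h.n3 y hy x hx (X3.symm ha)

theorem CutC.mono {V : Type} {X1 X2 X3 : PG V} {Γ G Δ Γ' G' Δ' : Set V}
    (h : CutC X1 X2 X3 Γ G Δ) (hΓ : ∀ x ∈ Γ', x ∈ Γ) (hG : ∀ x ∈ G', x ∈ G)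
    (hΔ : ∀ x ∈ Δ', x ∈ Δ) : CutC X1 X2 X3 Γ' G' Δ' :=
  ⟨fun x hx hx' => h.d1 x (hΓ x hx) (hG x hx'), fun x hx hx' => h.d2 x (hΔ x hx) (hG x hx'),
    fun x hx hx' => h.d3 x (hΓ x hx) (hΔ x hx'),
    ⟨fun x hx => h.a1.1 x (hΓ x hx), fun x hx y hy => h.a1.2 x (hΓ x hx) y (hΓ y hy)⟩,
    ⟨fun x hx => h.a2.1 x (hΔ x hx), fun x hx y hy => h.a2.2 x (hΔ x hx) y (hΔ y hy)⟩,
    fun x hx => h.lab x (hG x hx), fun x hx y hy => h.dual x (hG x hx) y (hG y hy),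
    fun x hx y hy => h.n1 x (hΓ x hx) y (hG y hy), fun x hx y hy => h.n2 x (hΔ x hx) y (hG y hy),
    fun x hx y hy => h.n3 x (hΓ x hx) y (hΔ y hy)⟩

/-- Cut elimination statement for cut formulas with `n` vertices. -/
def CutP (V : Type) (n : ℕ) : Prop :=
  ∀ (X1 X2 X3 : PG V) (Γ G Δ : Set V), CutC X1 X2 X3 Γ G Δ → G.ncard = n →
    T X1 (Γ ∪ G) → T X2 (Δ ∪ G) → T X3 (Γ ∪ Δ)

theorem CutC.split {V : Type} {X1 X2 X3 : PG V} {Γ G Δ : Set V}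
    (h : CutC X1 X2 X3 Γ G Δ) (hT : T X1 (Γ ∪ G)) (hne : ∃ x, x ∈ G) (hc : Conn X1 G) :
    ∃ Γ' : Set V, (∀ x ∈ Γ', x ∈ Γ) ∧ Principal X1 (Γ' ∪ G) G ∧
      (T X3 (Γ' ∪ Δ) → T X3 (Γ ∪ Δ)) := by
  obtain ⟨t, ht1, ht2, ht3, ht4⟩ := hT.split G (fun x hx => Or.inr hx) hne hc (by
    rintro x hx y (hy | hy) hyG
    · exact fun ha => h.n1 y hy x hx (X1.symm ha)
    · exact (hyG hy).elim)
  have e1 : (Γ ∪ G) \ G = Γ := by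
    ext x
    have := h.d1 x
    simp only [Set.mem_sdiff, Set.mem_union]; tauto
  have e2 : (t \ G) ∪ G = t := by
    ext x
    have := ht1 x
    simp only [Set.mem_sdiff, Set.mem_union]; tauto
  have := ht4 X3 Δ
  rw [e1] at this
  refine ⟨t \ G, ?_, by rw [e2]; exact ht3, this h.a1 (fun x hx hx' => h.d3 x hx' hx)
    (fun x hx y hy ha => h.n3 y hy x hx (X3.symm ha))⟩
  intro x hx
  rcases ht2 x hx.1 with h1 | h1
  · exact h1
  · exact (hx.2 h1).elim

theorem CutC.ax {V : Type} {X1 X2 X3 : PG V} {Γ G Δ : Set V}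
    (h : CutC X1 X2 X3 Γ G Δ) (x y : V) (ht : Γ ∪ G = {x, y}) (hne : x ≠ y) (hG : G = {x})
    (hl : X1.lab y = dualAtom (X1.lab x)) (h2 : T X2 (Δ ∪ G)) : T X3 (Γ ∪ Δ) := by
  classical
  subst hG
  have hΓ : Γ = {y} := by
    ext z
    have h1 := Set.ext_iff.1 ht z
    have h2 := h.d1 z
    simp only [Set.mem_union, Set.mem_singleton_iff, Set.mem_insert_iff] at h1 h2 ⊢
    constructor
    · tauto
    · rintro rfl
      have := hne.symm
      tauto
  subst hΓ
  have hyΔ : y ∉ Δ := h.d3 y rfl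
  have hxΔ : x ∉ Δ := fun hh => h.d2 x hh rfl
  have hφ : ∀ z ∈ Δ, (if z = y then x else z) = z := by
    intro z hz
    rw [if_neg]
    rintro rfl; exact hyΔ hz
  refine T.comap (fun z => if z = y then x else z) h2 _ ⟨?_, ?_, ?_⟩ ?_ ?_
  · rintro z (rfl | hz)
    · right; simp
    · left; simp only [hφ z hz]; exact hz
  · rintro z (rfl | hz) w (rfl | hw) hzw
    · rfl
    · simp only [if_true, hφ w hw] at hzw
      subst hzw; exact (hxΔ hw).elim
    · simp only [if_true, hφ z hz] at hzw
      subst hzw; exact (hxΔ hz).elim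
    · simp only [hφ z hz, hφ w hw] at hzw; exact hzw
  · rintro z (hz | rfl)
    · exact ⟨z, Or.inr hz, hφ z hz⟩
    · exact ⟨y, Or.inl rfl, by simp⟩
  · rintro z (rfl | hz)
    · simp only [if_true]
      rw [h.lab x rfl, h.a1.1 z rfl, hl]
    · simp only [hφ z hz]
      exact (h.a2.1 z hz).symm
  · rintro z (rfl | hz) w (rfl | hw)
    · simp only [if_true]
      exact ⟨fun ha => (X3.irrefl _ ha).elim, fun ha => (X2.irrefl _ ha).elim⟩
    · simp only [if_true, hφ w hw]
      exact ⟨fun ha => (h.n3 z rfl w hw ha).elim, fun ha => (h.n2 w hw x rfl (X2.symm ha)).elim⟩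
    · simp only [if_true, hφ z hz]
      exact ⟨fun ha => (h.n3 w rfl z hz (X3.symm ha)).elim, fun ha => (h.n2 z hz x rfl ha).elim⟩
    · simp only [hφ z hz, hφ w hw]
      exact h.a2.2 z hz w hw

theorem CutC.sw {V : Type} [Finite V] {X1 X2 X3 : PG V} {Γ G Δ : Set V} {n : ℕ}
    (ih : ∀ m < n, CutP V m) (hn : G.ncard = n)
    (h : CutC X1 X2 X3 Γ G Δ) (A B R : Set V) (hA : T X1 A) (hB : T X1 B)
    (ht : Γ ∪ G = A ∪ B) (hc : SwCond X1 A B (G ∩ A) R) (hR : ∀ x ∈ R, x ∈ G)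
    (neA : ∃ x ∈ G, x ∈ A) (neB : ∃ x ∈ G, x ∈ B) (h2 : T X2 (Δ ∪ G)) : T X3 (Γ ∪ Δ) := by
  classical
  have hAB : ∀ x ∈ G, x ∉ A → x ∈ B := by
    intro x hx hxA
    have : x ∈ A ∪ B := ht ▸ Or.inr hx
    rcases this with h1 | h1
    · exact (hxA h1).elim
    · exact h1
  have memΓ : ∀ x, (x ∈ A ∨ x ∈ B) → x ∉ G → x ∈ Γ := by
    intro x hx hxG
    have : x ∈ Γ ∪ G := ht ▸ hx
    rcases this with h1 | h1
    · exact h1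
    · exact (hxG h1).elim
  have memAB : ∀ x ∈ Γ, x ∈ A ∨ x ∈ B := by
    intro x hx
    have : x ∈ A ∪ B := ht ▸ Or.inl hx
    exact this
  -- detach the module `G ∩ A` in the second derivation
  let X2' : PG V := ⟨fun x y => X2.adj x y ∧ (x ∈ G ∩ A ↔ y ∈ G ∩ A),
    fun hh => ⟨X2.symm hh.1, hh.2.symm⟩, fun v hh => X2.irrefl v hh.1, X2.lab⟩
  have h2' : T X2' (Δ ∪ G) := by
    refine h2.ssAdm (G ∩ A) ?_ (fun _ _ => rfl) (fun _ _ _ _ => Iff.rfl)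
    rintro v (hv | hv) hvM x hx hxM y hy hyM
    · exact ⟨fun ha => (h.n2 v hv x hxM.1 ha).elim, fun ha => (h.n2 v hv y hyM.1 ha).elim⟩
    · have hvA : v ∉ A := fun hh => hvM ⟨hv, hh⟩
      have hvB := hAB v hv hvA
      rw [h.dual v hv x hxM.1, h.dual v hv y hyM.1, X1.comm v x, X1.comm v y,
        hc.cross x hxM.2 v hvB, hc.cross y hyM.2 v hvB]
      have n1 : v ≠ x := by rintro rfl; exact hvM hxM
      have n2 : v ≠ y := by rintro rfl; exact hvM hyM
      tauto
  let X4 : PG V := ⟨fun x y => (x ∈ G ∩ B ∧ y ∈ G ∩ B ∧ X2.adj x y) ∨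
      (x ∉ G ∩ B ∧ y ∉ G ∩ B ∧ X3.adj x y),
    fun hh => hh.elim (fun h1 => Or.inl ⟨h1.2.1, h1.1, X2.symm h1.2.2⟩)
      (fun h1 => Or.inr ⟨h1.2.1, h1.1, X3.symm h1.2.2⟩),
    fun v hh => hh.elim (fun h1 => X2.irrefl v h1.2.2) (fun h1 => X3.irrefl v h1.2.2),
    fun x => if x ∈ G ∩ B then X2.lab x else X3.lab x⟩
  have lab1 : ∀ x, x ∈ G ∩ B → X4.lab x = X2.lab x := fun x hx => if_pos hx
  have lab2 : ∀ x, x ∉ G ∩ B → X4.lab x = X3.lab x := fun x hx => if_neg hx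
  have adj1 : ∀ x ∈ G ∩ B, ∀ y ∈ G ∩ B, (X4.adj x y ↔ X2.adj x y) := by
    intro x hx y hy
    constructor
    · rintro (hh | hh)
      · exact hh.2.2
      · exact (hh.1 hx).elim
    · intro hh; exact Or.inl ⟨hx, hy, hh⟩
  have adj2 : ∀ x ∉ G ∩ B, ∀ y ∉ G ∩ B, (X4.adj x y ↔ X3.adj x y) := by
    intro x hx y hy
    constructor
    · rintro (hh | hh)
      · exact (hx hh.1).elim
      · exact hh.2.2
    · intro hh; exact Or.inr ⟨hx, hy, hh⟩
  have adj3 : ∀ x ∉ G ∩ B, ∀ y ∈ G ∩ B, ¬ X4.adj x y := by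
    rintro x hx y hy (hh | hh)
    · exact hx hh.1
    · exact hh.2.1 hy
  have nΓ : ∀ x ∈ Γ, x ∉ G ∩ B := fun x hx hh => h.d1 x hx hh.1
  have nΔ : ∀ x ∈ Δ, x ∉ G ∩ B := fun x hx hh => h.d2 x hx hh.1
  have step1 : T X4 ((Γ ∩ A) ∪ ((G ∩ B) ∪ Δ)) := by
    refine ih (G ∩ A).ncard ?_ X1 X2' X4 (Γ ∩ A) (G ∩ A) ((G ∩ B) ∪ Δ)
      ⟨?_, ?_, ?_, ⟨?_, ?_⟩, ⟨?_, ?_⟩, ?_, ?_, ?_, ?_, ?_⟩ rfl ?_ ?_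
    · rw [← hn]
      refine Set.ncard_lt_ncard ⟨Set.inter_subset_left, fun hh => ?_⟩ (Set.toFinite G)
      obtain ⟨x, hx, hxB⟩ := neB
      exact hc.disj x (hh hx).2 hxB
    · intro x hx hx'; exact h.d1 x hx.1 hx'.1
    · rintro x (hx | hx) hx'
      · exact hc.disj x hx'.2 hx.2
      · exact h.d2 x hx hx'.1
    · rintro x hx (hx' | hx')
      · exact h.d1 x hx.1 hx'.1
      · exact h.d3 x hx.1 hx'
    · intro x hx; rw [lab2 x (nΓ x hx.1)]; exact h.a1.1 x hx.1
    · intro x hx y hy; rw [adj2 x (nΓ x hx.1) y (nΓ y hy.1)]; exact h.a1.2 x hx.1 y hy.1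
    · rintro x (hx | hx)
      · exact lab1 x hx
      · rw [lab2 x (nΔ x hx)]; exact h.a2.1 x hx
    · have nA : ∀ x, x ∈ (G ∩ B) ∪ Δ → x ∉ G ∩ A := by
        rintro x (hx | hx) hx'
        · exact hc.disj x hx'.2 hx.2
        · exact h.d2 x hx hx'.1
      have e : ∀ x ∈ (G ∩ B) ∪ Δ, ∀ y ∈ (G ∩ B) ∪ Δ, (X2'.adj x y ↔ X2.adj x y) := by
        intro x hx y hy
        have := nA x hx
        have := nA y hy
        constructor
        · exact fun hh => hh.1
        · exact fun hh => ⟨hh, by tauto⟩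
      intro x hx y hy
      rw [e x hx y hy]
      rcases hx with hx | hx <;> rcases hy with hy | hy
      · exact adj1 x hx y hy
      · have a := adj3 y (nΔ y hy) x hx
        have b := h.n2 y hy x hx.1
        rw [X4.comm, X2.comm]
        tauto
      · have a := adj3 x (nΔ x hx) y hy
        have b := h.n2 x hx y hy.1
        tauto
      · rw [adj2 x (nΔ x hx) y (nΔ y hy)]; exact h.a2.2 x hx y hy
    · intro x hx; exact h.lab x hx.1
    · intro x hx y hy
      rw [← h.dual x hx.1 y hy.1]
      exact ⟨fun hh => hh.1, fun hh => ⟨hh, by tauto⟩⟩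
    · intro x hx y hy; exact h.n1 x hx.1 y hy.1
    · rintro x (hx | hx) y hy ha
      · exact hc.disj x (ha.2.2 hy).2 hx.2
      · exact h.n2 x hx y hy.1 ha.1
    · rintro x hx y (hy | hy)
      · exact adj3 x (nΓ x hx.1) y hy
      · rw [adj2 x (nΓ x hx.1) y (nΔ y hy)]; exact h.n3 x hx.1 y hy
    · have e : (Γ ∩ A) ∪ (G ∩ A) = A := by
        ext x
        have := memΓ x
        simp only [Set.mem_union, Set.mem_inter_iff]; tauto
      rw [e]; exact hA
    · have e : (G ∩ B) ∪ Δ ∪ (G ∩ A) = Δ ∪ G := by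
        ext x
        have := hAB x
        simp only [Set.mem_union, Set.mem_inter_iff]; tauto
      rw [e]; exact h2'
  have step2 : T X3 ((Γ ∩ B) ∪ ((Γ ∩ A) ∪ Δ)) := by
    have nAΔ : ∀ x ∈ (Γ ∩ A) ∪ Δ, x ∉ G ∩ B := by
      rintro x (hx | hx)
      · exact nΓ x hx.1
      · exact nΔ x hx
    refine ih (G ∩ B).ncard ?_ X1 X4 X3 (Γ ∩ B) (G ∩ B) ((Γ ∩ A) ∪ Δ)
      ⟨?_, nAΔ, ?_, ⟨?_, ?_⟩, ⟨?_, ?_⟩, ?_, ?_, ?_, ?_, ?_⟩ rfl ?_ ?_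
    · rw [← hn]
      refine Set.ncard_lt_ncard ⟨Set.inter_subset_left, fun hh => ?_⟩ (Set.toFinite G)
      obtain ⟨x, hx, hxA⟩ := neA
      exact hc.disj x hxA (hh hx).2
    · intro x hx hx'; exact h.d1 x hx.1 hx'.1
    · rintro x hx (hx' | hx')
      · exact hc.disj x hx'.2 hx.2
      · exact h.d3 x hx.1 hx'
    · intro x hx; exact h.a1.1 x hx.1
    · intro x hx y hy; exact h.a1.2 x hx.1 y hy.1
    · intro x hx; exact (lab2 x (nAΔ x hx)).symm
    · intro x hx y hy; exact (adj2 x (nAΔ x hx) y (nAΔ y hy)).symm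
    · intro x hx; rw [lab1 x hx]; exact h.lab x hx.1
    · intro x hx y hy; rw [adj1 x hx y hy]; exact h.dual x hx.1 y hy.1
    · intro x hx y hy; exact h.n1 x hx.1 y hy.1
    · intro x hx y hy; exact adj3 x (nAΔ x hx) y hy
    · rintro x hx y (hy | hy)
      · rw [h.a1.2 x hx.1 y hy.1, X1.comm, hc.cross y hy.2 x hx.2]
        exact fun hh => h.d1 y hy.1 hh.1.1
      · exact h.n3 x hx.1 y hy
    · have e : (Γ ∩ B) ∪ (G ∩ B) = B := by
        ext x
        have := memΓ x
        simp only [Set.mem_union, Set.mem_inter_iff]; tauto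
      rw [e]; exact hB
    · have e : (Γ ∩ A) ∪ Δ ∪ (G ∩ B) = (Γ ∩ A) ∪ ((G ∩ B) ∪ Δ) := by
        ext x
        simp only [Set.mem_union, Set.mem_inter_iff]; tauto
      rw [e]; exact step1
  have e : (Γ ∩ B) ∪ ((Γ ∩ A) ∪ Δ) = Γ ∪ Δ := by
    ext x
    have := memAB x
    simp only [Set.mem_union, Set.mem_inter_iff]; tauto
  rw [← e]; exact step2

/-- Fibres of one prime fibration are contained in fibres of the dual one. -/
theorem fibres_le {V I I2 : Type} {X1 X2 : PG V} {G : Set V}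
    (hd : ∀ x ∈ G, ∀ y ∈ G, (X2.adj x y ↔ x ≠ y ∧ ¬ X1.adj x y))
    {f : V → I} {J : Set I} {P : I → I → Prop} (h : Fib X1 G f J P) (hfin : J.Finite)
    (hcard : 4 ≤ J.ncard)
    {f2 : V → I2} {J2 : Set I2} {P2 : I2 → I2 → Prop} (h2 : Fib X2 G f2 J2 P2)
    (hfin2 : J2.Finite) (hcard2 : 4 ≤ J2.ncard) (hp2 : PrimeOn P2 J2) :
    ∀ x ∈ G, ∀ y ∈ G, f x = f y → f2 x = f2 y := by
  intro x hx y hy hxy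
  rcases h2.module hfin2 hcard2 hp2 (G ∩ f ⁻¹' {f x}) (fun z hz => hz.1) (by
    intro v hv hvU a ha b hb
    have e1 : f a = f x := ha.2
    have e2 : f b = f x := hb.2
    have n : f v ≠ f x := fun hh => hvU ⟨hv, hh⟩
    have n1 : v ≠ a := by rintro rfl; exact n e1
    have n2 : v ≠ b := by rintro rfl; exact n e2
    rw [hd v hv a ha.1, hd v hv b hb.1, h.adj v hv a ha.1 (by rw [e1]; exact n),
      h.adj v hv b hb.1 (by rw [e2]; exact n), e1, e2]
    tauto) with h1 | h1
  · exact h1 x ⟨hx, rfl⟩ y ⟨hy, hxy.symm⟩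
  · exfalso
    obtain ⟨k, hk, hk1, _⟩ := exists_ne2 hfin (by omega) (f x) (f x)
    obtain ⟨z, hz, rfl⟩ := h.ne k hk
    exact hk1 (h1 z hz).2

theorem CutC.pp {V I I2 : Type} [Finite V] {X1 X2 X3 : PG V} {Γ G Δ : Set V} {n : ℕ}
    (ih : ∀ m < n, CutP V m) (hn : G.ncard = n) (h : CutC X1 X2 X3 Γ G Δ)
    {J : Set I} {f : V → I} {P : I → I → Prop} {K : Set V}
    (hT : ∀ i ∈ J, T X1 ((Γ ∪ G) ∩ f ⁻¹' {i})) (hF : FCond X1 (Γ ∪ G) K G f J P)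
    (hP : PCond K G f J P)
    {J2 : Set I2} {f2 : V → I2} {P2 : I2 → I2 → Prop} {K2 : Set V}
    (hT2 : ∀ i ∈ J2, T X2 ((Δ ∪ G) ∩ f2 ⁻¹' {i})) (hF2 : FCond X2 (Δ ∪ G) K2 G f2 J2 P2)
    (hP2 : PCond K2 G f2 J2 P2) : T X3 (Γ ∪ Δ) := by
  classical
  have fb1 := hF.fib hP
  have fb2 := hF2.fib hP2
  have le1 := fibres_le h.dual fb1 hP.fin hP.card fb2 hP2.fin hP2.card hP2.prime
  have le2 := fibres_le h.swap.dual fb2 hP2.fin hP2.card fb1 hP.fin hP.card hP.prime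
  have hPP : ∀ x ∈ G, ∀ y ∈ G, f x ≠ f y → (P2 (f2 x) (f2 y) ↔ ¬ P (f x) (f y)) := by
    intro x hx y hy hxy
    rw [← fb1.adj x hx y hy hxy, ← fb2.adj x hx y hy (fun hh => hxy (le2 x hx y hy hh)),
      h.dual x hx y hy]
    have : x ≠ y := by rintro rfl; exact hxy rfl
    tauto
  have hg : ∀ x : V, ∃ g : V, x ∈ Δ → g ∈ G ∧ f2 g = f2 x := by
    intro x
    by_cases hx : x ∈ Δ
    · obtain ⟨g, hg, hg'⟩ := fb2.ne (f2 x) (hF2.hf x (Or.inl hx))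
      exact ⟨g, fun _ => ⟨hg, hg'⟩⟩
    · exact ⟨x, fun hh => (hx hh).elim⟩
  choose g hg using hg
  have kΓ : ∀ x ∈ K, x ∈ Γ := by
    intro x hx
    rcases hF.hL x hx with h1 | h1
    · exact h1
    · exact (hF.disj x hx h1).elim
  have kΔ : ∀ x ∈ K2, x ∈ Δ := by
    intro x hx
    rcases hF2.hL x hx with h1 | h1
    · exact h1
    · exact (hF2.disj x hx h1).elim
  let f' : V → I := fun x => if x ∈ Δ then f (g x) else f x
  have f'1 : ∀ x ∈ Γ, f' x = f x := fun x hx => if_neg (h.d3 x hx)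
  have f'2 : ∀ x ∈ Δ, f' x = f (g x) := fun x hx => if_pos hx
  have fe : ∀ x ∈ Δ, ∀ y ∈ G, (f' x = f y ↔ f2 x = f2 y) := by
    intro x hx y hy
    rw [f'2 x hx, ← (hg x hx).2]
    exact ⟨le1 _ (hg x hx).1 _ hy, le2 _ (hg x hx).1 _ hy⟩
  have fe' : ∀ x ∈ Δ, ∀ y ∈ Δ, (f' x = f' y ↔ f2 x = f2 y) := by
    intro x hx y hy
    rw [f'2 y hy, fe x hx _ (hg y hy).1, (hg y hy).2]
  refine T.p I J f' P (Γ ∪ Δ) K K2 ?_ ⟨fun x hx => Or.inl (kΓ x hx), fun x hx => Or.inr (kΔ x hx),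
    fun x hx hx' => h.d3 x (kΓ x hx) (kΔ x hx'), ?_, ?_, ?_⟩ ⟨hP.fin, hP.card, hP.prime, ?_, ?_⟩
  · intro i hi
    obtain ⟨g0, hg0, rfl⟩ := fb1.ne i hi
    have e : (Γ ∪ Δ) ∩ f' ⁻¹' {f g0} = (Γ ∩ f ⁻¹' {f g0}) ∪ (Δ ∩ f2 ⁻¹' {f2 g0}) := by
      ext x
      have h1 := f'1 x
      have h2 := fun hx => fe x hx g0 hg0
      simp only [Set.mem_inter_iff, Set.mem_union, Set.mem_preimage, Set.mem_singleton_iff]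
      constructor
      · rintro ⟨hx | hx, hh⟩
        · left; exact ⟨hx, by rw [← h1 hx]; exact hh⟩
        · right; exact ⟨hx, (h2 hx).1 hh⟩
      · rintro (⟨hx, hh⟩ | ⟨hx, hh⟩)
        · exact ⟨Or.inl hx, by rw [h1 hx]; exact hh⟩
        · exact ⟨Or.inr hx, (h2 hx).2 hh⟩
    rw [e]
    refine ih (G ∩ f ⁻¹' {f g0}).ncard ?_ X1 X2 X3 _ (G ∩ f ⁻¹' {f g0}) _
      (h.mono (fun x hx => hx.1) (fun x hx => hx.1) (fun x hx => hx.1)) rfl ?_ ?_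
    · rw [← hn]
      refine Set.ncard_lt_ncard ⟨Set.inter_subset_left, fun hh => ?_⟩ (Set.toFinite G)
      obtain ⟨k, hk, hk1, _⟩ := exists_ne2 hP.fin (by have := hP.card; omega) (f g0) (f g0)
      obtain ⟨z, hz, rfl⟩ := fb1.ne k hk
      exact hk1 (hh hz).2
    · rw [← Set.union_inter_distrib_right]
      exact hT _ hi
    · have e : (G ∩ f ⁻¹' {f g0}) = (G ∩ f2 ⁻¹' {f2 g0}) := by
        ext x
        exact ⟨fun hx => ⟨hx.1, le1 x hx.1 g0 hg0 hx.2⟩, fun hx => ⟨hx.1, le2 x hx.1 g0 hg0 hx.2⟩⟩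
      rw [e, ← Set.union_inter_distrib_right]
      exact hT2 _ (fb2.hf g0 hg0)
  · rintro x (hx | hx)
    · rw [f'1 x hx]; exact hF.hf x (Or.inl hx)
    · rw [f'2 x hx]; exact fb1.hf _ (hg x hx).1
  · rintro x (hx | hx) y (hy | hy) hxy ha
    · rw [f'1 x hx, f'1 y hy] at hxy
      rw [h.a1.2 x hx y hy] at ha
      refine ⟨(hF.same x (Or.inl hx) y (Or.inl hy) hxy ha).1, ?_⟩
      exact ⟨fun hh => (h.d3 x hx (kΔ x hh)).elim, fun hh => (h.d3 y hy (kΔ y hh)).elim⟩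
    · exact (h.n3 x hx y hy ha).elim
    · exact (h.n3 y hy x hx (X3.symm ha)).elim
    · rw [fe' x hx y hy] at hxy
      rw [h.a2.2 x hx y hy] at ha
      refine ⟨?_, (hF2.same x (Or.inl hx) y (Or.inl hy) hxy ha).1⟩
      exact ⟨fun hh => (h.d3 x (kΓ x hh) hx).elim, fun hh => (h.d3 y (kΓ y hh) hy).elim⟩
  · rintro x (hx | hx) y (hy | hy) hxy
    · rw [f'1 x hx, f'1 y hy] at hxy ⊢
      rw [h.a1.2 x hx y hy, hF.cross x (Or.inl hx) y (Or.inl hy) hxy]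
      have a1 := h.d1 x hx
      have a2 : x ∉ K2 := fun hh => h.d3 x hx (kΔ x hh)
      tauto
    · have a1 := h.n3 x hx y hy
      have a2 : x ∉ K2 := fun hh => h.d3 x hx (kΔ x hh)
      have a3 : y ∉ K := fun hh => h.d3 y (kΓ y hh) hy
      tauto
    · have a1 : ¬ X3.adj x y := fun ha => h.n3 y hy x hx (X3.symm ha)
      have a2 : y ∉ K2 := fun hh => h.d3 y hy (kΔ y hh)
      have a3 : x ∉ K := fun hh => h.d3 x (kΓ x hh) hx
      tauto
    · have hxy2 : f2 x ≠ f2 y := fun hh => hxy ((fe' x hx y hy).2 hh)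
      rw [h.a2.2 x hx y hy, hF2.cross x (Or.inl hx) y (Or.inl hy) hxy2]
      have a1 := h.d2 x hx
      have a2 : x ∉ K := fun hh => h.d3 x (kΓ x hh) hx
      rw [f'2 x hx, f'2 y hy] at hxy ⊢
      have := hPP _ (hg x hx).1 _ (hg y hy).1 hxy
      rw [(hg x hx).2, (hg y hy).2] at this
      rw [this]
      tauto
  · intro i hi
    obtain ⟨x, hx, rfl⟩ := hP.neL i hi
    exact ⟨x, hx, f'1 x (kΓ x hx)⟩
  · intro i hi
    obtain ⟨g0, hg0, rfl⟩ := fb1.ne i hi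
    obtain ⟨z, hz, hz'⟩ := hP2.neL (f2 g0) (fb2.hf g0 hg0)
    exact ⟨z, hz, (fe z (kΔ z hz) g0 hg0).2 hz'⟩

theorem CutC.conn2 {V : Type} {X1 X2 X3 : PG V} {Γ G Δ : Set V}
    (h : CutC X1 X2 X3 Γ G Δ) (hc : CoConn X1 G) : Conn X2 G := by
  intro U hU hne hpr
  obtain ⟨x, hx, y, hy, hyU, hxy⟩ := hc U hU hne hpr
  refine ⟨x, hx, y, hy, hyU, ?_⟩
  rw [h.dual x (hU x hx) y hy]
  exact ⟨by rintro rfl; exact hyU hx, hxy⟩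

theorem CutC.main {V : Type} [Finite V] {X1 X2 X3 : PG V} {Γ G Δ : Set V} {n : ℕ}
    (ih : ∀ m < n, CutP V m) (hn : G.ncard = n) (h : CutC X1 X2 X3 Γ G Δ)
    (hne : ∃ x, x ∈ G) (hc : Conn X1 G) (h1 : T X1 (Γ ∪ G)) (h2 : T X2 (Δ ∪ G)) :
    T X3 (Γ ∪ Δ) := by
  obtain ⟨Γ', hΓ', hpr, hcl⟩ := h.split h1 hne hc
  apply hcl
  have h' := h.mono hΓ' (fun x hx => hx) (fun x hx => hx)
  cases hpr with
  | ax x y ht hxy hG hl => exact h'.ax x y ht hxy hG hl h2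
  | sw A B R hA hB ht hsc hR neA neB => exact h'.sw ih hn A B R hA hB ht hsc hR neA neB h2
  | p I J f P K hT hF hP =>
    have hc2 : Conn X2 G := h'.conn2 ((hF.fib hP).coConn hP.fin hP.card hP.prime)
    obtain ⟨Δ', hΔ', hpr2, hcl2⟩ := h'.swap.split h2 hne hc2
    rw [Set.union_comm]
    apply hcl2
    have h'' := h'.mono (fun x hx => hx) (fun x hx => hx) hΔ'
    have h1' : T X1 (Γ' ∪ G) := T.p I J f P _ K G hT hF hP
    cases hpr2 with
    | ax x y ht hxy hG hl => exact h''.swap.ax x y ht hxy hG hl h1'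
    | sw A B R hA hB ht hsc hR neA neB =>
      exact h''.swap.sw ih hn A B R hA hB ht hsc hR neA neB h1'
    | p I2 J2 f2 P2 K2 hT2 hF2 hP2 =>
      rw [Set.union_comm]
      exact h''.pp ih hn hT hF hP hT2 hF2 hP2

/-- Cut elimination for the auxiliary calculus. -/
theorem cut {V : Type} [Finite V] : ∀ n, CutP V n := by
  intro n
  induction n using Nat.strong_induction_on with
  | _ n ih =>
  intro X1 X2 X3 Γ G Δ h hn h1 h2
  by_cases hne : ∃ x, x ∈ G
  · by_cases hc : CoConn X1 G
    · rw [Set.union_comm]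
      exact h.swap.main ih hn hne (h.conn2 hc) h2 h1
    · exact h.main ih hn hne (conn_of_not_coConn hc) h1 h2
  · have hG : G = ∅ := by
      ext x; exact ⟨fun hx => (hne ⟨x, hx⟩).elim, fun hx => hx.elim⟩
    subst hG
    rw [Set.union_empty] at h1 h2
    refine T.sw _ _ ∅ ∅ (h1.congr h.a1) (h2.congr h.a2) ⟨h.d3, ?_, ?_, ?_, ?_⟩ (CoConn.empty _)
    · intro x hx; exact hx.elim
    · intro x hx; exact hx.elim
    · intro x hx; exact hx.elim
    · intro x hx y hy
      exact ⟨fun ha => (h.n3 x hx y hy ha).elim, fun ha => ha.1.elim⟩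

/-! ### The auxiliary calculus on labelled graphs -/

def pgOf (G : LGraph) : PG G.V := ⟨G.adj, G.symm, G.irrefl, G.label⟩

/-- Derivability of a graph in the auxiliary calculus. -/
def TG (G : LGraph) : Prop := T (pgOf G) Set.univ

/-- Derivability of an implication. -/
def Imp (G H : LGraph) : Prop := TG (G.dual.par H)

theorem iso_refl (G : LGraph) : G.iso G := ⟨⟨Equiv.refl _, fun _ _ => Iff.rfl, fun _ => rfl⟩⟩

theorem iso_symm {G H : LGraph} (h : G.iso H) : H.iso G := by
  obtain ⟨⟨e, h1, h2⟩⟩ := h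
  refine ⟨⟨e.symm, ?_, ?_⟩⟩
  · intro v w; rw [h1]; simp
  · intro v; rw [← h2]; simp

theorem iso_trans {G H K : LGraph} (h : G.iso H) (h' : H.iso K) : G.iso K := by
  obtain ⟨⟨e, h1, h2⟩⟩ := h
  obtain ⟨⟨e', h1', h2'⟩⟩ := h'
  refine ⟨⟨e.trans e', ?_, ?_⟩⟩
  · intro v w; rw [h1, h1']; rfl
  · intro v; rw [← h2, ← h2']; rfl

theorem TG.of_iso {G H : LGraph} (h : G.iso H) (hT : TG H) : TG G := by
  obtain ⟨⟨e, h1, h2⟩⟩ := h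
  refine T.comap e hT _ ?_ (fun x _ => h2 x) (fun x _ y _ => h1 x y)
  exact e.bijective.bijOn_univ

theorem T.push {V W : Type} {X : PG V} {Y : PG W} (φ : W → V) {t : Set W} (h : T Y t)
    (hi : Set.InjOn φ t) (hl : ∀ x ∈ t, X.lab (φ x) = Y.lab x)
    (ha : ∀ x ∈ t, ∀ y ∈ t, (X.adj (φ x) (φ y) ↔ Y.adj x y)) (s : Set V) (hs : s = φ '' t) :
    T X s := by
  subst hs
  rcases isEmpty_or_nonempty W with hW | hW
  · have : φ '' t = ∅ := by
      ext x
      exact ⟨fun ⟨w, _⟩ => isEmptyElim w, fun hx => hx.elim⟩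
    rw [this]; exact T.emp
  · have inv : ∀ x ∈ t, Function.invFunOn φ t (φ x) = x := fun x hx =>
      hi.leftInvOn_invFunOn hx
    refine T.comap (Function.invFunOn φ t) h _ ⟨?_, ?_, ?_⟩ ?_ ?_
    · rintro _ ⟨x, hx, rfl⟩; rw [inv x hx]; exact hx
    · rintro _ ⟨x, hx, rfl⟩ _ ⟨y, hy, rfl⟩ hxy
      rw [inv x hx, inv y hy] at hxy; rw [hxy]
    · intro x hx; exact ⟨φ x, ⟨x, hx, rfl⟩, inv x hx⟩
    · rintro _ ⟨x, hx, rfl⟩; rw [inv x hx, hl x hx]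
    · rintro _ ⟨x, hx, rfl⟩ _ ⟨y, hy, rfl⟩
      rw [inv x hx, inv y hy, ha x hx y hy]

/-! Graph operations on plain types. -/

def PG.par {V W : Type} (X : PG V) (Y : PG W) : PG (V ⊕ W) where
  adj
    | .inl a, .inl b => X.adj a b
    | .inr a, .inr b => Y.adj a b
    | _, _ => False
  symm := by
    rintro (a | a) (b | b) h
    · exact X.symm h
    · exact h.elim
    · exact h.elim
    · exact Y.symm h
  irrefl := by
    rintro (a | a) h
    · exact X.irrefl a h
    · exact Y.irrefl a h
  lab := Sum.elim X.lab Y.lab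

def PG.plug {V W : Type} (X : PG V) (S : Set V) (Y : PG W) : PG (V ⊕ W) where
  adj
    | .inl a, .inl b => X.adj a b
    | .inr a, .inr b => Y.adj a b
    | .inl a, .inr _ => a ∈ S
    | .inr _, .inl b => b ∈ S
  symm := by
    rintro (a | a) (b | b) h
    · exact X.symm h
    · exact h
    · exact h
    · exact Y.symm h
  irrefl := by
    rintro (a | a) h
    · exact X.irrefl a h
    · exact Y.irrefl a h
  lab := Sum.elim X.lab Y.lab

def PG.dual {V : Type} (X : PG V) : PG V where
  adj v w := v ≠ w ∧ ¬ X.adj v w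
  symm h := ⟨fun e => h.1 e.symm, fun h' => h.2 (X.symm h')⟩
  irrefl _ h := h.1 rfl
  lab v := dualAtom (X.lab v)

def PG.comp {V : Type} {W : V → Type} (X : PG V) (Y : ∀ v, PG (W v)) : PG (Σ v, W v) where
  adj x y := (∃ (v : V) (a b : W v), x = ⟨v, a⟩ ∧ y = ⟨v, b⟩ ∧ (Y v).adj a b) ∨
    (x.1 ≠ y.1 ∧ X.adj x.1 y.1)
  symm := by
    rintro x y (⟨v, a, b, hx, hy, hab⟩ | ⟨hne, hadj⟩)
    · exact Or.inl ⟨v, b, a, hy, hx, (Y v).symm hab⟩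
    · exact Or.inr ⟨hne.symm, X.symm hadj⟩
  irrefl := by
    rintro ⟨v, a⟩ (⟨w, x, y, hx, hy, hxy⟩ | ⟨hne, _⟩)
    · have h := hx.symm.trans hy
      obtain rfl : x = y := by simpa using h
      exact (Y w).irrefl x hxy
    · exact hne rfl
  lab x := (Y x.1).lab x.2

section ops
variable {V W : Type} (X : PG V) (Y : PG W) (S : Set V)

@[simp] theorem PG.par_ll (a b : V) : (X.par Y).adj (.inl a) (.inl b) ↔ X.adj a b := Iff.rfl
@[simp] theorem PG.par_rr (a b : W) : (X.par Y).adj (.inr a) (.inr b) ↔ Y.adj a b := Iff.rfl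
@[simp] theorem PG.par_lr (a : V) (b : W) : (X.par Y).adj (.inl a) (.inr b) ↔ False := Iff.rfl
@[simp] theorem PG.par_rl (a : W) (b : V) : (X.par Y).adj (.inr a) (.inl b) ↔ False := Iff.rfl
@[simp] theorem PG.plug_ll (a b : V) : (X.plug S Y).adj (.inl a) (.inl b) ↔ X.adj a b := Iff.rfl
@[simp] theorem PG.plug_rr (a b : W) : (X.plug S Y).adj (.inr a) (.inr b) ↔ Y.adj a b := Iff.rfl
@[simp] theorem PG.plug_lr (a : V) (b : W) : (X.plug S Y).adj (.inl a) (.inr b) ↔ a ∈ S := Iff.rfl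
@[simp] theorem PG.plug_rl (a : W) (b : V) : (X.plug S Y).adj (.inr a) (.inl b) ↔ b ∈ S := Iff.rfl
@[simp] theorem PG.dual_adj (a b : V) : X.dual.adj a b ↔ a ≠ b ∧ ¬ X.adj a b := Iff.rfl
@[simp] theorem PG.par_labl (a : V) : (X.par Y).lab (.inl a) = X.lab a := rfl
@[simp] theorem PG.par_labr (a : W) : (X.par Y).lab (.inr a) = Y.lab a := rfl
@[simp] theorem PG.plug_labl (a : V) : (X.plug S Y).lab (.inl a) = X.lab a := rfl
@[simp] theorem PG.plug_labr (a : W) : (X.plug S Y).lab (.inr a) = Y.lab a := rfl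
@[simp] theorem PG.dual_lab (a : V) : X.dual.lab a = dualAtom (X.lab a) := rfl

end ops

@[simp] theorem PG.comp_same {V : Type} {W : V → Type} (X : PG V) (Y : ∀ v, PG (W v)) (v : V)
    (a b : W v) : (X.comp Y).adj ⟨v, a⟩ ⟨v, b⟩ ↔ (Y v).adj a b := by
  constructor
  · rintro (⟨w, a', b', h1, h2, h3⟩ | ⟨h1, _⟩)
    · cases h1; cases h2; exact h3
    · exact (h1 rfl).elim
  · intro h; exact Or.inl ⟨v, a, b, rfl, rfl, h⟩

theorem PG.comp_diff {V : Type} {W : V → Type} (X : PG V) (Y : ∀ v, PG (W v)) (v w : V)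
    (a : W v) (b : W w) (hne : v ≠ w) : (X.comp Y).adj ⟨v, a⟩ ⟨w, b⟩ ↔ X.adj v w := by
  constructor
  · rintro (⟨w, a', b', h1, h2, h3⟩ | ⟨_, h1⟩)
    · cases h1; cases h2; exact (hne rfl).elim
    · exact h1
  · intro h; exact Or.inr ⟨hne, h⟩

theorem pgOf_par (G H : LGraph) : pgOf (G.par H) = (pgOf G).par (pgOf H) := by
  unfold PG.par pgOf
  congr 1
  funext x y
  rcases x with x | x <;> rcases y with y | y <;> rfl

theorem pgOf_plug (G : LGraph) (S : Set G.V) (H : LGraph) :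
    pgOf (G.plug S H) = (pgOf G).plug S (pgOf H) := by
  unfold PG.plug pgOf
  congr 1
  funext x y
  rcases x with x | x <;> rcases y with y | y <;> rfl

theorem pgOf_tensor (G H : LGraph) :
    pgOf (G.tensor H) = (pgOf G).plug Set.univ (pgOf H) := by
  unfold PG.plug pgOf
  congr 1
  funext x y
  rcases x with x | x <;> rcases y with y | y <;> rfl

theorem pgOf_dual (G : LGraph) : pgOf G.dual = (pgOf G).dual := rfl

theorem pgOf_comp (G : LGraph) (H : G.V → LGraph) :
    pgOf (G.comp H) = (pgOf G).comp (fun v => pgOf (H v)) := rfl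

/-- Derivability of an implication. -/
def PImp {V W : Type} (X : PG V) (Y : PG W) : Prop := T (X.dual.par Y) Set.univ

theorem Imp_def (G H : LGraph) : Imp G H ↔ PImp (pgOf G) (pgOf H) := by
  unfold Imp TG
  rw [pgOf_par]
  exact Iff.rfl

theorem PImp.of_iso {V W V' W' : Type} {X : PG V} {Y : PG W} {X' : PG V'} {Y' : PG W'}
    (h : PImp X Y) (e : V' ≃ V) (e' : W' ≃ W)
    (h1 : ∀ v w, X'.adj v w ↔ X.adj (e v) (e w)) (h2 : ∀ v, X.lab (e v) = X'.lab v)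
    (h1' : ∀ v w, Y'.adj v w ↔ Y.adj (e' v) (e' w)) (h2' : ∀ v, Y.lab (e' v) = Y'.lab v) :
    PImp X' Y' := by
  refine T.comap (Equiv.sumCongr e e') h _ (Equiv.sumCongr e e').bijective.bijOn_univ ?_ ?_
  · rintro (v | v) _ <;> simp [h2, h2']
  · rintro (v | v) _ (w | w) _ <;> simp [h1, h1']

theorem Imp.of_iso {G H G' H' : LGraph} (hG : G'.iso G) (hH : H'.iso H) (h : Imp G H) :
    Imp G' H' := by
  obtain ⟨⟨e, h1, h2⟩⟩ := hG
  obtain ⟨⟨e', h1', h2'⟩⟩ := hH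
  rw [Imp_def] at h ⊢
  exact h.of_iso e e' h1 h2 h1' h2'

theorem PImp.trans {U V W : Type} [Finite U] [Finite V] [Finite W] {G : PG U} {H : PG V}
    {K : PG W} (h1 : PImp G H) (h2 : PImp H K) : PImp G K := by
  have key : T (G.dual.par (H.par K))
      (Set.range Sum.inl ∪ Set.range (fun k => Sum.inr (Sum.inr k))) := by
    refine cut _ (G.dual.par (H.par K)) (G.dual.par (H.dual.par K)) _
      (Set.range Sum.inl) (Set.range (fun k => Sum.inr (Sum.inl k)))
      (Set.range (fun k => Sum.inr (Sum.inr k)))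
      ⟨?_, ?_, ?_, ⟨?_, ?_⟩, ⟨?_, ?_⟩, ?_, ?_, ?_, ?_, ?_⟩ rfl ?_ ?_
    · rintro _ ⟨a, rfl⟩ ⟨b, hb⟩; cases hb
    · rintro _ ⟨a, rfl⟩ ⟨b, hb⟩; cases hb
    · rintro _ ⟨a, rfl⟩ ⟨b, hb⟩; cases hb
    · intro x _; rfl
    · intro x _ y _; exact Iff.rfl
    · rintro _ ⟨a, rfl⟩; rfl
    · rintro _ ⟨a, rfl⟩ _ ⟨b, rfl⟩; exact Iff.rfl
    · rintro _ ⟨a, rfl⟩; rfl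
    · rintro _ ⟨a, rfl⟩ _ ⟨b, rfl⟩
      simp
    · rintro _ ⟨a, rfl⟩ _ ⟨b, rfl⟩; simp
    · rintro _ ⟨a, rfl⟩ _ ⟨b, rfl⟩; simp
    · rintro _ ⟨a, rfl⟩ _ ⟨b, rfl⟩; simp
    · refine T.push (Sum.elim Sum.inl (fun k => Sum.inr (Sum.inl k))) h1 ?_ ?_ ?_ _ ?_
      · rintro (a | a) _ (b | b) _ hab <;> simp_all
      · rintro (a | a) _ <;> rfl
      · rintro (a | a) _ (b | b) _ <;> exact Iff.rfl
      · ext x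
        constructor
        · rintro (⟨a, rfl⟩ | ⟨a, rfl⟩)
          · exact ⟨Sum.inl a, trivial, rfl⟩
          · exact ⟨Sum.inr a, trivial, rfl⟩
        · rintro ⟨a | a, _, rfl⟩
          · exact Or.inl ⟨a, rfl⟩
          · exact Or.inr ⟨a, rfl⟩
    · refine T.push (Sum.inr) h2 ?_ ?_ ?_ _ ?_
      · intro a _ b _ hab; exact Sum.inr_injective hab
      · rintro (a | a) _ <;> rfl
      · rintro (a | a) _ (b | b) _ <;> exact Iff.rfl
      · ext x
        constructor
        · rintro (⟨a, rfl⟩ | ⟨a, rfl⟩)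
          · exact ⟨Sum.inr a, trivial, rfl⟩
          · exact ⟨Sum.inl a, trivial, rfl⟩
        · rintro ⟨a | a, _, rfl⟩
          · exact Or.inr ⟨a, rfl⟩
          · exact Or.inl ⟨a, rfl⟩
  refine T.comap (Sum.elim Sum.inl (fun k => Sum.inr (Sum.inr k))) key _ ⟨?_, ?_, ?_⟩ ?_ ?_
  · rintro (a | a) _
    · exact Or.inl ⟨a, rfl⟩
    · exact Or.inr ⟨a, rfl⟩
  · rintro (a | a) _ (b | b) _ hab <;> simp_all
  · rintro _ (⟨a, rfl⟩ | ⟨a, rfl⟩)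
    · exact ⟨Sum.inl a, trivial, rfl⟩
    · exact ⟨Sum.inr a, trivial, rfl⟩
  · rintro (a | a) _ <;> rfl
  · rintro (a | a) _ (b | b) _ <;> exact Iff.rfl

/-- The quotient graph of a context. -/
def ctxRel {V : Type} (C : PG V) (R : Set V) : Option V → Option V → Prop
  | some a, some b => C.adj a b
  | some a, none => a ∈ R
  | none, some b => b ∈ R
  | none, none => False

theorem PImp.ctx {U V W : Type} [Finite U] [Finite V] [Finite W] {p : PG U} {c : PG V}
    (C : PG W) (R : Set W) (h : PImp p c) : PImp (C.plug R p) (C.plug R c) := by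
  have hfin : (Set.univ : Set (Option W)).Finite := Set.toFinite _
  refine T.func _ Set.univ hfin rfl
    (Sum.elim (Sum.elim some (fun _ => none)) (Sum.elim some (fun _ => none)))
    (ctxRel C R) Set.univ (Set.range Sum.inl) (Set.range Sum.inr)
    ⟨fun _ _ => trivial, fun _ _ => trivial, ?_, fun _ _ => trivial, ?_, ?_⟩ ?_ ?_
  · rintro _ ⟨a, rfl⟩ ⟨b, hb⟩; cases hb
  · rintro (a | a) _ (b | b) _ _ hab
    · simp
    · exact hab.elim
    · exact hab.elim
    · simp
  · rintro ((a | a) | (a | a)) _ ((b | b) | (b | b)) _ hab <;>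
      simp [ctxRel] at hab ⊢ <;> (try exact Iff.rfl)
    exact fun _ => hab
  · rintro (_ | a) _ (_ | b) _ hab
    · exact hab
    · exact hab
    · exact hab
    · exact C.symm hab
  · rintro (_ | v) _
    · refine T.push (Sum.map Sum.inr Sum.inr) h ?_ ?_ ?_ _ ?_
      · rintro (a | a) _ (b | b) _ hab <;> simp_all
      · rintro (a | a) _ <;> rfl
      · rintro (a | a) _ (b | b) _
        · simp
        · simp
        · simp
        · simp
      · ext x
        constructor
        · rcases x with (a | a) | (a | a)
          · rintro ⟨_, hx⟩; simp at hx
          · rintro ⟨_, hx⟩; exact ⟨Sum.inl a, trivial, rfl⟩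
          · rintro ⟨_, hx⟩; simp at hx
          · rintro ⟨_, hx⟩; exact ⟨Sum.inr a, trivial, rfl⟩
        · rintro ⟨a | a, _, rfl⟩
          · exact ⟨trivial, rfl⟩
          · exact ⟨trivial, rfl⟩
    · have := T.ax (X := (C.plug R p).dual.par (C.plug R c)) (Sum.inl (Sum.inl v))
        (Sum.inr (Sum.inl v)) (by simp) (by
          change C.lab v = dualAtom (dualAtom (C.lab v))
          rw [dualAtom_dualAtom]) (by simp)
      convert this using 1
      ext x
      rcases x with (a | a) | (a | a) <;> simp

def PG.empty : PG Empty := ⟨fun _ _ => False, fun h => h.elim, fun v => v.elim, fun v => v.elim⟩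

theorem PImp.id {V : Type} [Finite V] (C : PG V) : PImp C C := by
  have h : PImp PG.empty PG.empty := by
    have : (Set.univ : Set (Empty ⊕ Empty)) = ∅ := by
      ext x; rcases x with x | x <;> exact x.elim
    unfold PImp
    rw [this]; exact T.emp
  exact (h.ctx C ∅).of_iso (Equiv.sumEmpty V Empty).symm (Equiv.sumEmpty V Empty).symm
    (fun _ _ => Iff.rfl) (fun _ => rfl) (fun _ _ => Iff.rfl) (fun _ => rfl)

/-! ### Soundness of the rules for the auxiliary calculus -/

/-- Complete (or edgeless) graphs. -/
def PG.kn (b : Prop) (V : Type) : PG V where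
  adj x y := x ≠ y ∧ b
  symm h := ⟨h.1.symm, h.2⟩
  irrefl _ h := h.1 rfl
  lab _ := (0, true)

@[simp] theorem PG.kn_adj (b : Prop) {V : Type} (x y : V) : (PG.kn b V).adj x y ↔ x ≠ y ∧ b :=
  Iff.rfl

@[simp] theorem PG.comp_lab {V : Type} {W : V → Type} (X : PG V) (Y : ∀ v, PG (W v))
    (x : Σ v, W v) : (X.comp Y).lab x = (Y x.1).lab x.2 := rfl

noncomputable def sigmaSucc (n : ℕ) (W : Fin (n + 1) → Type) :
    W 0 ⊕ (Σ i : Fin n, W i.succ) ≃ Σ i, W i :=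
  Equiv.ofBijective (Sum.elim (fun a => ⟨0, a⟩) (fun x => ⟨x.1.succ, x.2⟩)) (by
    constructor
    · rintro (a | ⟨i, a⟩) (b | ⟨j, b⟩) hab
      · simpa using hab
      · have := congrArg Sigma.fst hab
        simp at this
        exact (Fin.succ_ne_zero _ this.symm).elim
      · have := congrArg Sigma.fst hab
        simp at this
      · have := congrArg Sigma.fst hab
        simp at this
        subst this
        simpa using hab
    · rintro ⟨i, a⟩
      refine Fin.cases (motive := fun i => ∀ a : W i, ∃ x, Sum.elim _ _ x = Sigma.mk i a) ?_ ?_ i a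
      · intro a; exact ⟨Sum.inl a, rfl⟩
      · intro i a; exact ⟨Sum.inr ⟨i, a⟩, rfl⟩)

@[simp] theorem sigmaSucc_inl (n : ℕ) (W : Fin (n + 1) → Type) (a : W 0) :
    sigmaSucc n W (Sum.inl a) = ⟨0, a⟩ := rfl
@[simp] theorem sigmaSucc_inr (n : ℕ) (W : Fin (n + 1) → Type) (i : Fin n) (a : W i.succ) :
    sigmaSucc n W (Sum.inr ⟨i, a⟩) = ⟨i.succ, a⟩ := rfl

theorem kn_comp_succ (b : Prop) (n : ℕ) (W : Fin (n + 1) → Type) (Y : ∀ i, PG (W i))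
    (x y : W 0 ⊕ (Σ i : Fin n, W i.succ)) :
    ((PG.kn b _).comp Y).adj (sigmaSucc n W x) (sigmaSucc n W y) ↔
    ((Y 0).plug {_x | b} ((PG.kn b (Fin n)).comp fun i : Fin n => Y i.succ)).adj x y := by
  rcases x with x | ⟨i, x⟩ <;> rcases y with y | ⟨j, y⟩
  · simp
  · rw [sigmaSucc_inl, sigmaSucc_inr, PG.comp_diff _ _ _ _ _ _ (Fin.succ_ne_zero j).symm]
    simp [(Fin.succ_ne_zero j).symm]
  · rw [sigmaSucc_inl, sigmaSucc_inr, PG.comp_diff _ _ _ _ _ _ (Fin.succ_ne_zero i)]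
    simp
  · rw [sigmaSucc_inr, sigmaSucc_inr, PG.plug_rr]
    by_cases h : i = j
    · subst h; rw [PG.comp_same, PG.comp_same]
    · rw [PG.comp_diff _ _ _ _ _ _ h,
        PG.comp_diff _ _ _ _ _ _ (fun h' => h (Fin.succ_injective _ h'))]
      simp

theorem bigTensor_sigma (n : ℕ) : ∀ (F : Fin n → LGraph),
    ∃ E : (bigTensor n F).V ≃ (Σ i, (F i).V),
      (∀ x y, (bigTensor n F).adj x y ↔
        ((PG.kn True (Fin n)).comp (fun i => pgOf (F i))).adj (E x) (E y)) ∧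
      ∀ x, (F (E x).1).label (E x).2 = (bigTensor n F).label x := by
  induction n with
  | zero =>
    intro F
    exact ⟨⟨fun x => Empty.elim x, fun x => x.1.elim0, fun x => Empty.elim x, fun x => x.1.elim0⟩,
      fun x => Empty.elim x, fun x => Empty.elim x⟩
  | succ n ih =>
    intro F
    obtain ⟨E, h1, h2⟩ := ih (fun i => F i.succ)
    refine ⟨(Equiv.sumCongr (Equiv.refl _) E).trans (sigmaSucc n (fun i => (F i).V)), ?_, ?_⟩
    · rintro (x | x) (y | y)
      · exact (kn_comp_succ True n _ (fun i => pgOf (F i)) (.inl x) (.inl y)).symm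
      · exact Iff.trans (by exact Iff.rfl)
          (kn_comp_succ True n _ (fun i => pgOf (F i)) (.inl x) (.inr (E y))).symm
      · exact Iff.trans (by exact Iff.rfl)
          (kn_comp_succ True n _ (fun i => pgOf (F i)) (.inr (E x)) (.inl y)).symm
      · exact (h1 x y).trans
          (kn_comp_succ True n _ (fun i => pgOf (F i)) (.inr (E x)) (.inr (E y))).symm
    · rintro (x | x)
      · rfl
      · exact h2 x

theorem bigPar_sigma (n : ℕ) : ∀ (F : Fin n → LGraph),
    ∃ E : (bigPar n F).V ≃ (Σ i, (F i).V),
      (∀ x y, (bigPar n F).adj x y ↔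
        ((PG.kn False (Fin n)).comp (fun i => pgOf (F i))).adj (E x) (E y)) ∧
      ∀ x, (F (E x).1).label (E x).2 = (bigPar n F).label x := by
  induction n with
  | zero =>
    intro F
    exact ⟨⟨fun x => Empty.elim x, fun x => x.1.elim0, fun x => Empty.elim x, fun x => x.1.elim0⟩,
      fun x => Empty.elim x, fun x => Empty.elim x⟩
  | succ n ih =>
    intro F
    obtain ⟨E, h1, h2⟩ := ih (fun i => F i.succ)
    refine ⟨(Equiv.sumCongr (Equiv.refl _) E).trans (sigmaSucc n (fun i => (F i).V)), ?_, ?_⟩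
    · rintro (x | x) (y | y)
      · exact (kn_comp_succ False n _ (fun i => pgOf (F i)) (.inl x) (.inl y)).symm
      · exact Iff.trans (by exact Iff.rfl)
          (kn_comp_succ False n _ (fun i => pgOf (F i)) (.inl x) (.inr (E y))).symm
      · exact Iff.trans (by exact Iff.rfl)
          (kn_comp_succ False n _ (fun i => pgOf (F i)) (.inr (E x)) (.inl y)).symm
      · exact (h1 x y).trans
          (kn_comp_succ False n _ (fun i => pgOf (F i)) (.inr (E x)) (.inr (E y))).symm
    · rintro (x | x)
      · rfl
      · exact h2 x

theorem kn_reindex {U U' : Type} (b : Prop) (W : U' → Type) (Y : ∀ i, PG (W i)) (e : U ≃ U')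
    (x y : Σ v, W (e v)) :
    ((PG.kn b U).comp (fun v => Y (e v))).adj x y ↔
    ((PG.kn b U').comp Y).adj ((Equiv.sigmaCongrLeft e : (Σ v, W (e v)) ≃ _) x)
      ((Equiv.sigmaCongrLeft e : (Σ v, W (e v)) ≃ _) y) := by
  obtain ⟨v, x⟩ := x
  obtain ⟨w, y⟩ := y
  change _ ↔ ((PG.kn b U').comp Y).adj ⟨e v, x⟩ ⟨e w, y⟩
  by_cases h : v = w
  · subst h; rw [PG.comp_same, PG.comp_same]
  · rw [PG.comp_diff _ _ _ _ _ _ h,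
      PG.comp_diff _ _ _ _ _ _ (fun h' => h (e.injective h'))]
    simp

theorem bigTensor_equiv {U : Type} (n : ℕ) (F : Fin n → LGraph) (e : U ≃ Fin n) :
    ∃ E : (Σ v, (F (e v)).V) ≃ (bigTensor n F).V,
      (∀ x y, ((PG.kn True U).comp (fun v => pgOf (F (e v)))).adj x y ↔
        (bigTensor n F).adj (E x) (E y)) ∧
      ∀ x, (bigTensor n F).label (E x) = (F (e x.1)).label x.2 := by
  obtain ⟨E, h1, h2⟩ := bigTensor_sigma n F
  refine ⟨(Equiv.sigmaCongrLeft (β := fun i => (F i).V) e).trans E.symm, ?_, ?_⟩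
  · intro x y
    rw [h1, kn_reindex True (fun i => (F i).V) (fun i => pgOf (F i)) e]
    simp
  · intro x
    have key : ∀ z : (Σ i, (F i).V), (bigTensor n F).label (E.symm z) = (F z.1).label z.2 := by
      intro z
      have := h2 (E.symm z)
      rw [Equiv.apply_symm_apply] at this
      exact this.symm
    exact key _

theorem bigPar_equiv {U : Type} (n : ℕ) (F : Fin n → LGraph) (e : U ≃ Fin n) :
    ∃ E : (Σ v, (F (e v)).V) ≃ (bigPar n F).V,
      (∀ x y, ((PG.kn False U).comp (fun v => pgOf (F (e v)))).adj x y ↔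
        (bigPar n F).adj (E x) (E y)) ∧
      ∀ x, (bigPar n F).label (E x) = (F (e x.1)).label x.2 := by
  obtain ⟨E, h1, h2⟩ := bigPar_sigma n F
  refine ⟨(Equiv.sigmaCongrLeft (β := fun i => (F i).V) e).trans E.symm, ?_, ?_⟩
  · intro x y
    rw [h1, kn_reindex False (fun i => (F i).V) (fun i => pgOf (F i)) e]
    simp
  · intro x
    have key : ∀ z : (Σ i, (F i).V), (bigPar n F).label (E.symm z) = (F z.1).label z.2 := by
      intro z
      have := h2 (E.symm z)
      rw [Equiv.apply_symm_apply] at this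
      exact this.symm
    exact key _

theorem PImp.ssDown {V W : Type} [Finite V] [Finite W] (B : PG V) (S : Set V) (A : PG W) :
    PImp (B.plug S A) (B.par A) := by
  refine T.ssAdm (PImp.id (B.plug S A)) (Set.range (fun a => Sum.inr (Sum.inr a))) ?_ ?_ ?_
  · rintro ((v | v) | (v | v)) _ hv _ _ ⟨x, rfl⟩ _ _ ⟨y, rfl⟩ <;> simp at hv ⊢
  · rintro ((v | v) | (v | v)) _ <;> rfl
  · rintro ((v | v) | (v | v)) _ ((w | w) | (w | w)) _ <;> simp

theorem PImp.ssUp {V W : Type} [Finite V] [Finite W] (B : PG V) (S : Set V) (A : PG W) :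
    PImp (B.plug Set.univ A) (B.plug S A) := by
  refine T.ssAdm (PImp.id (B.plug S A)) (Set.range (fun a => Sum.inl (Sum.inr a))) ?_ ?_ ?_
  · rintro ((v | v) | (v | v)) _ hv _ _ ⟨x, rfl⟩ _ _ ⟨y, rfl⟩ <;> simp at hv ⊢
  · rintro ((v | v) | (v | v)) _ <;> rfl
  · rintro ((v | v) | (v | v)) _ ((w | w) | (w | w)) _ <;> simp

theorem PImp.pDown {U : Type} [Finite U] {A B : U → Type} [∀ v, Finite (A v)] [∀ v, Finite (B v)]
    (P : PG U) (M : ∀ v, PG (A v)) (N : ∀ v, PG (B v)) :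
    PImp ((PG.kn True U).comp fun v => (M v).par (N v)) ((P.dual.comp M).par (P.comp N)) := by
  refine T.func _ Set.univ (Set.toFinite _) rfl
    (Sum.elim Sigma.fst (Sum.elim Sigma.fst Sigma.fst)) P.adj Set.univ
    (Set.range (fun x => Sum.inr (Sum.inl x))) (Set.range (fun x => Sum.inr (Sum.inr x)))
    ⟨fun _ _ => trivial, fun _ _ => trivial, ?_, fun _ _ => trivial, ?_, ?_⟩
    (fun _ _ _ _ h => P.symm h) ?_
  · rintro _ ⟨a, rfl⟩ ⟨b, hb⟩; cases hb
  · rintro (a | (a | a)) _ (b | (b | b)) _ _ hab <;> first | exact hab.elim | simp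
  · rintro (⟨v, a⟩ | (⟨v, a⟩ | ⟨v, a⟩)) _ (⟨w, b⟩ | (⟨w, b⟩ | ⟨w, b⟩)) _ hab
    all_goals (change v ≠ w at hab)
    all_goals simp [PG.comp_diff _ _ _ _ _ _ hab, hab]
  · intro v _
    refine T.push (Sum.map (Sigma.mk v) (Sum.map (Sigma.mk v) (Sigma.mk v)))
      (show T (((M v).par (N v)).dual.par ((M v).par (N v))) Set.univ from PImp.id _) ?_ ?_ ?_ _ ?_
    · rintro (a | (a | a)) _ (b | (b | b)) _ hab <;> simp_all
    · rintro (a | (a | a)) _ <;> rfl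
    · rintro (a | (a | a)) _ (b | (b | b)) _ <;> simp
    · ext x
      constructor
      · rcases x with ⟨w, a⟩ | (⟨w, a⟩ | ⟨w, a⟩) <;> rintro ⟨_, hx⟩ <;>
          (change w = v at hx; subst hx)
        · exact ⟨.inl a, trivial, rfl⟩
        · exact ⟨.inr (.inl a), trivial, rfl⟩
        · exact ⟨.inr (.inr a), trivial, rfl⟩
      · rintro ⟨a | (a | a), _, rfl⟩ <;> exact ⟨trivial, rfl⟩

theorem PImp.pUp {U : Type} [Finite U] {A B : U → Type} [∀ v, Finite (A v)] [∀ v, Finite (B v)]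
    (P : PG U) (M : ∀ v, PG (A v)) (N : ∀ v, PG (B v)) :
    PImp ((P.comp M).plug Set.univ (P.dual.comp N))
      ((PG.kn False U).comp fun v => (M v).plug Set.univ (N v)) := by
  refine T.func _ Set.univ (Set.toFinite _) rfl
    (Sum.elim (Sum.elim Sigma.fst Sigma.fst) Sigma.fst) P.adj Set.univ
    (Set.range (fun x => Sum.inl (Sum.inl x))) (Set.range (fun x => Sum.inl (Sum.inr x)))
    ⟨fun _ _ => trivial, fun _ _ => trivial, ?_, fun _ _ => trivial, ?_, ?_⟩
    (fun _ _ _ _ h => P.symm h) ?_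
  · rintro _ ⟨a, rfl⟩ ⟨b, hb⟩; cases hb
  · rintro ((a | a) | a) _ ((b | b) | b) _ _ hab <;> first | exact hab.elim | simp at hab ⊢
  · rintro ((⟨v, a⟩ | ⟨v, a⟩) | ⟨v, a⟩) _ ((⟨w, b⟩ | ⟨w, b⟩) | ⟨w, b⟩) _ hab
    all_goals (change v ≠ w at hab)
    all_goals simp [PG.comp_diff _ _ _ _ _ _ hab, hab]
  · intro v _
    refine T.push (Sum.map (Sum.map (Sigma.mk v) (Sigma.mk v)) (Sigma.mk v))
      (show T (((M v).plug Set.univ (N v)).dual.par ((M v).plug Set.univ (N v))) Set.univ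
        from PImp.id _) ?_ ?_ ?_ _ ?_
    · rintro ((a | a) | a) _ ((b | b) | b) _ hab <;> simp_all
    · rintro ((a | a) | a) _ <;> rfl
    · rintro ((a | a) | a) _ ((b | b) | b) _ <;> simp
    · ext x
      constructor
      · rcases x with (⟨w, a⟩ | ⟨w, a⟩) | ⟨w, a⟩ <;> rintro ⟨_, hx⟩ <;>
          (change w = v at hx; subst hx)
        · exact ⟨.inl (.inl a), trivial, rfl⟩
        · exact ⟨.inl (.inr a), trivial, rfl⟩
        · exact ⟨.inr a, trivial, rfl⟩
      · rintro ⟨(a | a) | a, _, rfl⟩ <;> exact ⟨trivial, rfl⟩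

theorem bigTensor_left {U W : Type} {Y : PG W} (n : ℕ) (F : Fin n → LGraph) (e : U ≃ Fin n)
    (h : PImp ((PG.kn True U).comp fun v => pgOf (F (e v))) Y) : PImp (pgOf (bigTensor n F)) Y := by
  obtain ⟨E, h1, h2⟩ := bigTensor_equiv n F e
  refine h.of_iso E.symm (Equiv.refl _) ?_ ?_ (fun _ _ => Iff.rfl) (fun _ => rfl)
  · intro v w
    rw [h1, Equiv.apply_symm_apply, Equiv.apply_symm_apply]
    exact Iff.rfl
  · intro v
    refine (h2 _).symm.trans ?_
    rw [Equiv.apply_symm_apply]; rfl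

theorem bigPar_right {U W : Type} {Y : PG W} (n : ℕ) (F : Fin n → LGraph) (e : U ≃ Fin n)
    (h : PImp Y ((PG.kn False U).comp fun v => pgOf (F (e v)))) : PImp Y (pgOf (bigPar n F)) := by
  obtain ⟨E, h1, h2⟩ := bigPar_equiv n F e
  refine h.of_iso (Equiv.refl _) E.symm (fun _ _ => Iff.rfl) (fun _ => rfl) ?_ ?_
  · intro v w
    rw [h1, Equiv.apply_symm_apply, Equiv.apply_symm_apply]
    exact Iff.rfl
  · intro v
    refine (h2 _).symm.trans ?_
    rw [Equiv.apply_symm_apply]; rfl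

theorem Imp.rule {p c : LGraph} (h : SGSRule p c) : Imp p c := by
  rcases h with h | h
  · cases h with
    | ai a =>
      have h := T.ax (X := pgOf (LGraph.empty.dual.par ((single (dualAtom a)).par (single a))))
        (Sum.inr (Sum.inl ())) (Sum.inr (Sum.inr ())) (fun h => by cases h)
        (by change a = dualAtom (dualAtom a); rw [dualAtom_dualAtom]) (fun h => h)
      unfold Imp TG
      convert h using 1
      ext x
      rcases x with x | (⟨⟩ | ⟨⟩)
      · exact Empty.elim x
      · exact ⟨fun _ => Or.inl rfl, fun _ => trivial⟩
      · exact ⟨fun _ => Or.inr rfl, fun _ => trivial⟩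
    | ss A B S _ _ =>
      rw [Imp_def, pgOf_plug, pgOf_par]
      exact PImp.ssDown _ _ _
    | p n P e M N _ _ _ =>
      rw [Imp_def, pgOf_par, pgOf_comp, pgOf_comp, pgOf_dual]
      have h := PImp.pDown (pgOf P) (fun v => pgOf (M (e v))) (fun v => pgOf (N (e v)))
      have e1 : (fun v => (pgOf (M (e v))).par (pgOf (N (e v)))) =
          fun v => pgOf ((M (e v)).par (N (e v))) := by
        funext v; rw [pgOf_par]
      rw [e1] at h
      exact bigTensor_left n (fun i => (M i).par (N i)) e h
  · cases h with
    | ai a =>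
      have h := T.ax (X := pgOf (((single a).tensor (single (dualAtom a))).dual.par LGraph.empty))
        (Sum.inl (Sum.inl ())) (Sum.inl (Sum.inr ())) (fun h => by cases h)
        (by rfl) (fun h => h.2 trivial)
      unfold Imp TG
      convert h using 1
      ext x
      rcases x with (⟨⟩ | ⟨⟩) | x
      · exact ⟨fun _ => Or.inl rfl, fun _ => trivial⟩
      · exact ⟨fun _ => Or.inr rfl, fun _ => trivial⟩
      · exact Empty.elim x
    | ss A B S _ _ =>
      rw [Imp_def, pgOf_plug, pgOf_tensor]
      exact PImp.ssUp _ _ _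
    | p n P e M N _ _ _ =>
      rw [Imp_def, pgOf_tensor, pgOf_comp, pgOf_comp, pgOf_dual]
      have h := PImp.pUp (pgOf P) (fun v => pgOf (M (e v))) (fun v => pgOf (N (e v)))
      have e1 : (fun v => (pgOf (M (e v))).plug Set.univ (pgOf (N (e v)))) =
          fun v => pgOf ((M (e v)).tensor (N (e v))) := by
        funext v; rw [pgOf_tensor]
      rw [e1] at h
      exact bigPar_right n (fun i => (M i).tensor (N i)) e h

theorem Imp.of_deriv {G H : LGraph} (h : Deriv SGSRule G H) : Imp G H := by
  induction h with
  | refl => rw [Imp_def]; exact PImp.id _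
  | tail _ hs ih =>
    rename_i X Y _
    have hXY : Imp X Y := by
      rcases hs with hs | ⟨C, R, p, c, hr, h1, h2⟩
      · exact Imp.of_iso (iso_refl _) (iso_symm hs) ((Imp_def _ _).2 (PImp.id _))
      · refine Imp.of_iso h1 h2 ?_
        have := Imp.rule hr
        rw [Imp_def] at this ⊢
        rw [pgOf_plug, pgOf_plug]
        exact this.ctx _ _
    rw [Imp_def] at ih hXY ⊢
    exact ih.trans hXY

theorem empty_dual_par_iso (X : LGraph) : X.iso (LGraph.empty.dual.par X) :=
  ⟨⟨⟨Sum.inr, Sum.elim (fun x => Empty.elim x) id, fun _ => rfl, by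
    rintro (x | x)
    · exact Empty.elim x
    · rfl⟩, fun _ _ => Iff.rfl, fun _ => rfl⟩⟩

theorem TG.of_provable {X : LGraph} (h : Provable SGSRule X) : TG X :=
  TG.of_iso (empty_dual_par_iso X) (Imp.of_deriv h)

/-! ### From the auxiliary calculus to GS -/

theorem Deriv.of_iso {Rules : LGraph → LGraph → Prop} {G H : LGraph} (h : G.iso H) :
    Deriv Rules G H := Relation.ReflTransGen.single (Or.inl h)

theorem Deriv.trans' {Rules : LGraph → LGraph → Prop} {G H K : LGraph} (h : Deriv Rules G H)
    (h' : Deriv Rules H K) : Deriv Rules G K := Relation.ReflTransGen.trans h h'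

theorem Deriv.mono {R1 R2 : LGraph → LGraph → Prop} (h12 : ∀ p c, R1 p c → R2 p c)
    {G H : LGraph} (h : Deriv R1 G H) : Deriv R2 G H := by
  refine Relation.ReflTransGen.mono ?_ _ _ h
  rintro X Y (h | ⟨C, R, p, c, hr, h1, h2⟩)
  · exact Or.inl h
  · exact Or.inr ⟨C, R, p, c, h12 _ _ hr, h1, h2⟩

theorem plug_congr (C : LGraph) (R : Set C.V) {G H : LGraph} (h : G.iso H) :
    (C.plug R G).iso (C.plug R H) := by
  obtain ⟨⟨e, h1, h2⟩⟩ := h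
  refine ⟨⟨Equiv.sumCongr (Equiv.refl _) e, ?_, ?_⟩⟩
  · rintro (v | v) (w | w)
    · exact Iff.rfl
    · exact Iff.rfl
    · exact Iff.rfl
    · exact h1 v w
  · rintro (v | v)
    · rfl
    · exact h2 v

/-- The neighbourhood of the hole in a composed context. -/
def nbr {V W : Type} (R : Set V) (S : Set W) : Set (V ⊕ W) := {x | Sum.elim (· ∈ R) (· ∈ S) x}

theorem plug_assoc (C : LGraph) (R : Set C.V) (D : LGraph) (S : Set D.V) (G : LGraph) :
    (C.plug R (D.plug S G)).iso ((C.plug R D).plug (nbr R S) G) := by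
  refine ⟨⟨(Equiv.sumAssoc _ _ _).symm, ?_, ?_⟩⟩
  · rintro (v | (v | v)) (w | (w | w)) <;> exact Iff.rfl
  · rintro (v | (v | v)) <;> rfl

theorem Deriv.plug {Rules : LGraph → LGraph → Prop} {G H : LGraph} (C : LGraph) (R : Set C.V)
    (h : Deriv Rules G H) : Deriv Rules (C.plug R G) (C.plug R H) := by
  induction h with
  | refl => exact Relation.ReflTransGen.refl
  | tail _ hs ih =>
    refine ih.tail ?_
    rcases hs with hs | ⟨D, S, p, c, hr, h1, h2⟩
    · exact Or.inl (plug_congr C R hs)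
    · exact Or.inr ⟨C.plug R D, nbr R S, p, c, hr,
        iso_trans (plug_congr C R h1) (plug_assoc C R D S p),
        iso_trans (plug_congr C R h2) (plug_assoc C R D S c)⟩

theorem plug_empty (C : LGraph) (R : Set C.V) : C.iso (C.plug R LGraph.empty) := by
  refine ⟨⟨(Equiv.sumEmpty C.V Empty).symm, fun _ _ => Iff.rfl, fun _ => rfl⟩⟩

theorem empty_plug (S : Set LGraph.empty.V) (C : LGraph) : C.iso (LGraph.empty.plug S C) := by
  refine ⟨⟨(Equiv.emptySum Empty C.V).symm, fun _ _ => Iff.rfl, fun _ => rfl⟩⟩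

theorem Deriv.rule {Rules : LGraph → LGraph → Prop} {p c : LGraph} (h : Rules p c) :
    Deriv Rules p c :=
  Relation.ReflTransGen.single (Or.inr ⟨LGraph.empty, ∅, p, c, h, empty_plug _ _, empty_plug _ _⟩)

theorem Provable.plug {Rules : LGraph → LGraph → Prop} {C G : LGraph} (R : Set C.V)
    (hC : Provable Rules C) (hG : Provable Rules G) : Provable Rules (C.plug R G) :=
  (Deriv.trans' hC (Deriv.of_iso (plug_empty C R))).trans' (Deriv.plug C R hG)

theorem tensor_iso_plug (G H : LGraph) : (G.tensor H).iso (G.plug Set.univ H) := by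
  refine ⟨⟨Equiv.refl _, ?_, fun _ => rfl⟩⟩
  rintro (v | v) (w | w) <;> exact Iff.rfl

theorem par_iso_plug (G H : LGraph) : (G.par H).iso (G.plug ∅ H) := by
  refine ⟨⟨Equiv.refl _, ?_, fun _ => rfl⟩⟩
  rintro (v | v) (w | w) <;> exact Iff.rfl

theorem Provable.of_iso {Rules : LGraph → LGraph → Prop} {G H : LGraph} (h : G.iso H)
    (hG : Provable Rules G) : Provable Rules H := Deriv.trans' hG (Deriv.of_iso h)

theorem Provable.bigTensor {Rules : LGraph → LGraph → Prop} (n : ℕ) : ∀ (F : Fin n → LGraph),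
    (∀ i, Provable Rules (F i)) → Provable Rules (bigTensor n F) := by
  induction n with
  | zero => intro F _; exact Relation.ReflTransGen.refl
  | succ n ih =>
    intro F hF
    exact Provable.of_iso (iso_symm (tensor_iso_plug _ _))
      (Provable.plug Set.univ (hF 0) (ih _ fun i => hF i.succ))

/-- The labelled graph of a graph structure. -/
noncomputable def toLG {V : Type} [Finite V] (X : PG V) : LGraph :=
  { V := V, fintype := Fintype.ofFinite V, adj := X.adj, symm := X.symm, irrefl := X.irrefl,
    label := X.lab }

theorem iso_toLG (G : LGraph) : G.iso (toLG (pgOf G)) :=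
  ⟨⟨Equiv.refl _, fun _ _ => Iff.rfl, fun _ => rfl⟩⟩

theorem toLG_iso {V W : Type} [Finite V] [Finite W] (X : PG V) (Y : PG W) (e : V ≃ W)
    (h : ∀ x y, X.adj x y ↔ Y.adj (e x) (e y)) (hl : ∀ x, Y.lab (e x) = X.lab x) :
    (toLG X).iso (toLG Y) := ⟨⟨e, h, hl⟩⟩

theorem toLG_plug {V W : Type} [Finite V] [Finite W] (X : PG V) (S : Set V) (Y : PG W) :
    ((toLG X).plug S (toLG Y)).iso (toLG (X.plug S Y)) := by
  refine ⟨⟨Equiv.refl _, ?_, fun _ => rfl⟩⟩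
  rintro (v | v) (w | w) <;> exact Iff.rfl

theorem toLG_par {V W : Type} [Finite V] [Finite W] (X : PG V) (Y : PG W) :
    ((toLG X).par (toLG Y)).iso (toLG (X.par Y)) := by
  refine ⟨⟨Equiv.refl _, ?_, fun _ => rfl⟩⟩
  rintro (v | v) (w | w) <;> exact Iff.rfl

/-- Pulling back a graph structure along a map. -/
def PG.pull {V W : Type} (X : PG V) (φ : W → V) : PG W where
  adj a b := X.adj (φ a) (φ b)
  symm h := X.symm h
  irrefl a := X.irrefl (φ a)
  lab a := X.lab (φ a)

@[simp] theorem PG.pull_adj {V W : Type} (X : PG V) (φ : W → V) (a b : W) :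
    (X.pull φ).adj a b ↔ X.adj (φ a) (φ b) := Iff.rfl
@[simp] theorem PG.pull_lab {V W : Type} (X : PG V) (φ : W → V) (a : W) :
    (X.pull φ).lab a = X.lab (φ a) := rfl

/-- Restriction to a set of vertices. -/
def PG.res {V : Type} (X : PG V) (s : Set V) : PG s := X.pull Subtype.val

theorem pull_iso_res {V W : Type} [Finite V] [Finite W] (X : PG V) (φ : W → V)
    (hi : Function.Injective φ) (s : Set V) (hs : Set.range φ = s) :
    (toLG (X.pull φ)).iso (toLG (X.res s)) := by
  subst hs
  exact toLG_iso _ _ (Equiv.ofInjective φ hi) (fun _ _ => Iff.rfl) (fun _ => rfl)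

theorem ss_step {V : Type} [Finite V] (X Y : PG V) (M : Set V)
    (hM : ∀ v, v ∉ M → ∀ x, x ∈ M → ∀ y, y ∈ M → (X.adj v x ↔ X.adj v y))
    (hl : ∀ x, Y.lab x = X.lab x)
    (ha : ∀ x y, Y.adj x y ↔ X.adj x y ∧ (x ∈ M ↔ y ∈ M)) :
    Deriv GSRule (toLG X) (toLG Y) := by
  classical
  let B := X.res Mᶜ
  let A := X.res M
  let S : Set (Mᶜ : Set V) := {v | ∃ x ∈ M, X.adj v x}
  let e : (Mᶜ : Set V) ⊕ M ≃ V := (Equiv.sumComm _ _).trans (Equiv.Set.sumCompl M)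
  have el : ∀ v, e (.inl v) = v.1 := fun v => rfl
  have er : ∀ v, e (.inr v) = v.1 := fun v => rfl
  have i1 : (toLG (B.plug S A)).iso (toLG X) := by
    refine toLG_iso _ _ e ?_ ?_
    · rintro (v | v) (w | w)
      · exact Iff.rfl
      · rw [el, er, PG.plug_lr]
        constructor
        · rintro ⟨x, hx, h⟩; exact (hM _ v.2 _ hx _ w.2).1 h
        · intro h; exact ⟨_, w.2, h⟩
      · rw [el, er, PG.plug_rl, X.comm]
        constructor
        · rintro ⟨x, hx, h⟩; exact (hM _ w.2 _ hx _ v.2).1 h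
        · intro h; exact ⟨_, v.2, h⟩
      · exact Iff.rfl
    · rintro (v | v) <;> rfl
  have i2 : (toLG (B.par A)).iso (toLG Y) := by
    refine toLG_iso _ _ e ?_ ?_
    · rintro (v | v) (w | w)
      · rw [el, el, PG.par_ll, ha]
        have h1 : v.1 ∉ M := v.2
        have h2 : w.1 ∉ M := w.2
        simp only [h1, h2, iff_self, and_true]; exact Iff.rfl
      · rw [el, er, PG.par_lr, ha]
        have h1 : v.1 ∉ M := v.2
        simp [h1]
      · rw [el, er, PG.par_rl, ha]
        have h1 : w.1 ∉ M := w.2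
        simp [h1]
      · rw [er, er, PG.par_rr, ha]
        simp only [v.2, w.2, iff_self, and_true]; exact Iff.rfl
    · rintro (v | v) <;> exact hl _
  by_cases hS : S = ∅
  · refine Deriv.of_iso (toLG_iso _ _ (Equiv.refl _) ?_ hl)
    intro x y
    have key : ∀ x y, x ∉ M → y ∈ M → ¬ X.adj x y := by
      intro x y hx hy h
      have : (⟨x, hx⟩ : (Mᶜ : Set V)) ∈ S := ⟨y, hy, h⟩
      rw [hS] at this; exact this
    simp only [Equiv.refl_apply]
    rw [ha]
    constructor
    · intro h
      refine ⟨h, ?_⟩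
      by_cases hx : x ∈ M <;> by_cases hy : y ∈ M
      · simp [hx, hy]
      · exact (key _ _ hy hx (X.symm h)).elim
      · exact (key _ _ hx hy h).elim
      · simp [hx, hy]
    · exact fun h => h.1
  · have hA : Nonempty M := by
      obtain ⟨v, x, hx, _⟩ := Set.nonempty_iff_ne_empty.2 hS
      exact ⟨⟨x, hx⟩⟩
    have h := Deriv.rule (GSRule.ss (toLG A) (toLG B) S hA hS)
    exact ((Deriv.of_iso (iso_symm (iso_trans (toLG_plug B S A) i1))).trans' h).trans'
      (Deriv.of_iso (iso_trans (toLG_par B A) i2))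

theorem ss_multi {V U : Type} [Finite V] [Finite U] (Z Y : PG V) (g : V → Option U)
    (hM : ∀ i v x y, g v ≠ some i → g x = some i → g y = some i → (Z.adj v x ↔ Z.adj v y))
    (hl : ∀ x, Y.lab x = Z.lab x)
    (ha : ∀ x y, Y.adj x y ↔ Z.adj x y ∧ g x = g y) :
    Deriv GSRule (toLG Z) (toLG Y) := by
  classical
  have := Fintype.ofFinite U
  let ZK : Finset U → PG V := fun K =>
    { adj := fun x y => Z.adj x y ∧ ∀ i ∈ K, (g x = some i ↔ g y = some i)
      symm := fun h => ⟨Z.symm h.1, fun i hi => (h.2 i hi).symm⟩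
      irrefl := fun v h => Z.irrefl v h.1
      lab := Z.lab }
  have main : ∀ K : Finset U, Deriv GSRule (toLG Z) (toLG (ZK K)) := by
    intro K
    induction K using Finset.induction_on with
    | empty =>
      refine Deriv.of_iso (toLG_iso _ _ (Equiv.refl _) ?_ fun _ => rfl)
      intro x y
      simp [ZK]
    | insert i K hi ih =>
      refine ih.trans' (ss_step _ _ {x | g x = some i} ?_ (fun _ => rfl) ?_)
      · intro v hv x hx y hy
        simp only [Set.mem_ofPred_eq] at hv hx hy
        simp only [ZK]
        rw [hM i v x y hv hx hy, hx, hy]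
      · intro x y
        simp only [ZK, Set.mem_ofPred_eq, Finset.forall_mem_insert]
        tauto
  refine (main Finset.univ).trans' (Deriv.of_iso (toLG_iso _ _ (Equiv.refl _) ?_ hl))
  intro x y
  simp only [Equiv.refl_apply]
  rw [ha]
  simp only [ZK, Finset.mem_univ, true_implies]
  refine and_congr_right fun _ => ⟨fun h => ?_, fun h => by rw [h]; simp⟩
  rcases hx : g x with _ | i
  · rcases hy : g y with _ | j
    · rfl
    · have := (h j).2 hy; rw [hx] at this; cases this
  · rw [(h i).1 hx]

theorem prov_p {n : ℕ} {A B : Fin n → Type} [∀ i, Finite (A i)] [∀ i, Finite (B i)]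
    (P : PG (Fin n)) (M : ∀ i, PG (A i)) (N : ∀ i, PG (B i)) (hP : (toLG P).Prime) (hn : 4 ≤ n)
    (hne : ∀ i, Nonempty (A i)) (h : ∀ i, Provable GSRule (toLG ((M i).par (N i)))) :
    Provable GSRule (toLG ((P.dual.comp M).par (P.comp N))) := by
  have h1 : Provable GSRule (bigTensor n fun i => (toLG (M i)).par (toLG (N i))) :=
    Provable.bigTensor n _ fun i => Provable.of_iso (iso_symm (toLG_par _ _)) (h i)
  have h2 := GSRule.p n (toLG P) (Equiv.refl _) (fun i => toLG (M i)) (fun i => toLG (N i)) hP hn hne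
  refine (Deriv.trans' h1 (Deriv.rule h2)).trans' (Deriv.of_iso ?_)
  refine ⟨⟨Equiv.refl _, ?_, fun _ => rfl⟩⟩
  rintro (v | v) (w | w) <;> exact Iff.rfl

theorem T.toGS {V : Type} [Finite V] {X : PG V} {s : Set V} (h : T X s) :
    Provable GSRule (toLG (X.res s)) := by
  classical
  induction h with
  | emp =>
    refine Deriv.of_iso ⟨⟨Equiv.equivOfIsEmpty Empty (∅ : Set V), ?_, ?_⟩⟩
    · intro v; exact Empty.elim v
    · intro v; exact Empty.elim v
  | ax x y hne hl ha =>
    have h := Deriv.rule (GSRule.ai (X.lab y))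
    refine Deriv.trans' h (Deriv.of_iso ?_)
    have i1 : ((single (dualAtom (X.lab y))).par (single (X.lab y))).iso
        (toLG (X.pull (Sum.elim (fun _ : Unit => x) (fun _ : Unit => y)))) := by
      refine ⟨⟨Equiv.refl _, ?_, ?_⟩⟩
      · rintro (⟨⟩ | ⟨⟩) (⟨⟩ | ⟨⟩)
        · exact ⟨fun h => h.elim, fun h => X.irrefl x h⟩
        · exact ⟨fun h => h.elim, fun h => ha h⟩
        · exact ⟨fun h => h.elim, fun h => ha (X.symm h)⟩
        · exact ⟨fun h => h.elim, fun h => X.irrefl y h⟩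
      · rintro (⟨⟩ | ⟨⟩)
        · change X.lab x = dualAtom (X.lab y)
          rw [hl, dualAtom_dualAtom]
        · rfl
    refine iso_trans i1 (pull_iso_res _ _ ?_ _ ?_)
    · rintro (⟨⟩ | ⟨⟩) (⟨⟩ | ⟨⟩) h
      · rfl
      · exact (hne h).elim
      · exact (hne h.symm).elim
      · rfl
    · ext z
      constructor
      · rintro ⟨⟨⟩ | ⟨⟩, rfl⟩
        · exact Or.inl rfl
        · exact Or.inr rfl
      · rintro (rfl | rfl)
        · exact ⟨.inl (), rfl⟩
        · exact ⟨.inr (), rfl⟩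
  | sw A B M R _ _ hc _ ihA ihB =>
    have h1 : Provable GSRule (toLG ((X.res B).plug {b | b.1 ∈ R} (X.res A))) :=
      Provable.of_iso (toLG_plug _ _ _) (Provable.plug _ ihB ihA)
    have h2 : Deriv GSRule (toLG ((X.res B).plug {b | b.1 ∈ R} (X.res A)))
        (toLG (X.pull (Sum.elim (Subtype.val : B → V) (Subtype.val : A → V)))) := by
      refine ss_step _ _ {x | Sum.elim (fun _ : B => False) (fun a : A => a.1 ∉ M) x} ?_ ?_ ?_
      · rintro (v | v) hv (x | x) hx (y | y) hy
        · exact hx.elim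
        · exact hx.elim
        · exact hy.elim
        · simp
        · exact hx.elim
        · exact hx.elim
        · exact hy.elim
        · change v.1 ∉ {x | x ∉ M} at hv
          change x.1 ∉ M at hx
          change y.1 ∉ M at hy
          simp only [Set.mem_ofPred_eq, not_not] at hv
          have e1 : ¬ X.adj v.1 x.1 := hc.comp _ hv _ x.2 hx
          have e2 : ¬ X.adj v.1 y.1 := hc.comp _ hv _ y.2 hy
          exact ⟨fun h => (e1 h).elim, fun h => (e2 h).elim⟩
      · rintro (x | x) <;> rfl
      · rintro (x | x) (y | y)
        · simp [PG.res]
        · have := hc.cross _ y.2 _ x.2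
          simp [PG.res, X.comm x.1 y.1, this]
          tauto
        · have := hc.cross _ x.2 _ y.2
          simp [PG.res, this]
          tauto
        · simp only [PG.pull_adj, Sum.elim_inr, PG.plug_rr, PG.res, Set.mem_ofPred_eq]
          constructor
          · intro h
            refine ⟨h, ?_⟩
            by_cases hx : x.1 ∈ M <;> by_cases hy : y.1 ∈ M
            · simp [hx, hy]
            · exact (hc.comp _ hx _ y.2 hy h).elim
            · exact (hc.comp _ hy _ x.2 hx (X.symm h)).elim
            · simp [hx, hy]
          · exact fun h => h.1
    refine (Deriv.trans' h1 h2).trans' (Deriv.of_iso (pull_iso_res _ _ ?_ _ ?_))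
    · rintro (x | x) (y | y) h
      · exact congrArg _ (Subtype.ext h)
      · change x.1 = y.1 at h
        exact (hc.disj _ y.2 (h ▸ x.2)).elim
      · change x.1 = y.1 at h
        exact (hc.disj _ x.2 (h ▸ y.2)).elim
      · exact congrArg _ (Subtype.ext h)
    · rw [Set.Sum.elim_range, Subtype.range_coe, Subtype.range_coe, Set.union_comm]
  | p I J f Q s L R _ hF hP ih =>
    have := hP.fin.to_subtype
    obtain ⟨ε⟩ : Nonempty (Fin J.ncard ≃ J) := by
      refine ⟨(Finite.equivFinOfCardEq ?_).symm⟩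
      exact Nat.card_coe_set_eq J
    set n := J.ncard with hn
    have hQ : ∀ i ∈ J, ∀ j ∈ J, i ≠ j → Q i j → Q j i := by
      intro i hi j hj hij h
      obtain ⟨x, hx, rfl⟩ := hP.neR i hi
      obtain ⟨y, hy, rfl⟩ := hP.neR j hj
      have h1 := (hF.cross x (hF.hR x hx) y (hF.hR y hy) hij).2 (Or.inr ⟨hx, hy, h⟩)
      rcases (hF.cross y (hF.hR y hy) x (hF.hR x hx) hij.symm).1 (X.symm h1) with h2 | h2
      · exact (hF.disj _ h2.1 hy).elim
      · exact h2.2.2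
    let P : PG (Fin n) :=
      { adj := fun i j => i ≠ j ∧ Q (ε i) (ε j)
        symm := fun {i j} h => ⟨h.1.symm, hQ _ (ε i).2 _ (ε j).2
          (fun h' => h.1 (ε.injective (Subtype.ext h'))) h.2⟩
        irrefl := fun i h => h.1 rfl
        lab := fun _ => (0, true) }
    have hprime : (toLG P).Prime := by
      refine ⟨?_, ?_⟩
      · rw [← Nat.card_eq_fintype_card]
        change 2 ≤ Nat.card (Fin n)
        rw [Nat.card_eq_fintype_card, Fintype.card_fin]
        have := hP.card
        omega
      · intro M hM
        have hp := hP.prime ((fun i => (ε i).1) '' M)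
          (by rintro _ ⟨i, _, rfl⟩; exact (ε i).2) (by
            rintro v hv hvM _ ⟨x, hx, rfl⟩ _ ⟨y, hy, rfl⟩
            obtain ⟨w, hw⟩ := ε.surjective ⟨v, hv⟩
            have hw' : (ε w).1 = v := by rw [hw]
            subst hw'
            have hwM : w ∉ M := fun h => hvM ⟨w, h, rfl⟩
            have key := hM w hwM x hx y hy
            have n1 : w ≠ x := fun h => hwM (h ▸ hx)
            have n2 : w ≠ y := fun h => hwM (h ▸ hy)
            change (w ≠ x ∧ Q (ε w) (ε x)) ↔ (w ≠ y ∧ Q (ε w) (ε y)) at key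
            simpa [n1, n2] using key)
        rcases hp with h | h
        · rcases Set.eq_empty_or_nonempty M with h0 | ⟨v, hv⟩
          · exact Or.inl h0
          · refine Or.inr (Or.inl ⟨v, ?_⟩)
            ext w
            constructor
            · intro hw
              exact ε.injective (Subtype.ext (h _ ⟨w, hw, rfl⟩ _ ⟨v, hv, rfl⟩))
            · rintro rfl; exact hv
        · refine Or.inr (Or.inr ?_)
          ext w
          refine ⟨fun _ => trivial, fun _ => ?_⟩
          obtain ⟨v, hv, hvw⟩ := h _ (ε w).2
          have : v = w := ε.injective (Subtype.ext hvw)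
          exact this ▸ hv
    let SA : Fin n → Set V := fun i => {x | x ∈ s ∧ f x = ε i ∧ x ∉ R}
    let SB : Fin n → Set V := fun i => {x | x ∈ s ∧ f x = ε i ∧ x ∈ R}
    have hfib : ∀ i, Provable GSRule (toLG ((X.res (SA i)).par (X.res (SB i)))) := by
      intro i
      refine Provable.of_iso ?_ (ih (ε i) (ε i).2)
      refine iso_symm ?_
      have i1 : (toLG ((X.res (SA i)).par (X.res (SB i)))).iso
          (toLG (X.pull (Sum.elim (Subtype.val : SA i → V) (Subtype.val : SB i → V)))) := by
        refine toLG_iso _ _ (Equiv.refl _) ?_ ?_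
        · have key : ∀ (x : SA i) (y : SB i), ¬ X.adj x.1 y.1 := by
            intro x y h
            have := (hF.same _ x.2.1 _ y.2.1 (x.2.2.1.trans y.2.2.1.symm) h).2
            exact x.2.2.2 (this.2 y.2.2.2)
          rintro (x | x) (y | y)
          · exact Iff.rfl
          · exact ⟨fun h => h.elim, fun h => key _ _ h⟩
          · exact ⟨fun h => h.elim, fun h => key _ _ (X.symm h)⟩
          · exact Iff.rfl
        · rintro (x | x) <;> rfl
      refine iso_trans i1 (pull_iso_res _ _ ?_ _ ?_)
      · rintro (x | x) (y | y) h
        · exact congrArg _ (Subtype.ext h)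
        · change x.1 = y.1 at h
          exact (x.2.2.2 (h ▸ y.2.2.2)).elim
        · change x.1 = y.1 at h
          exact (y.2.2.2 (h ▸ x.2.2.2)).elim
        · exact congrArg _ (Subtype.ext h)
      · rw [Set.Sum.elim_range, Subtype.range_coe, Subtype.range_coe]
        ext x
        simp only [SA, SB, Set.mem_union, Set.mem_ofPred_eq, Set.mem_inter_iff, Set.mem_preimage,
          Set.mem_singleton_iff]
        tauto
    have hne : ∀ i, Nonempty (SA i) := by
      intro i
      obtain ⟨x, hx, hxi⟩ := hP.neL _ (ε i).2
      exact ⟨⟨x, hF.hL _ hx, hxi, hF.disj _ hx⟩⟩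
    have h1 := prov_p P (fun i => X.res (SA i)) (fun i => X.res (SB i)) hprime hP.card hne hfib
    have h2 : Deriv GSRule
        (toLG ((P.dual.comp fun i => X.res (SA i)).par (P.comp fun i => X.res (SB i))))
        (toLG (X.pull (Sum.elim (fun x : Σ i, SA i => x.2.1) (fun x : Σ i, SB i => x.2.1)))) := by
      refine ss_multi _ _ (Sum.elim (fun x : Σ i, SA i => if x.2.1 ∈ L then none else some x.1)
        (fun _ : Σ i, SB i => none)) ?_ ?_ ?_
      · rintro i (⟨v, a⟩ | ⟨v, a⟩) (⟨j, x⟩ | ⟨j, x⟩) (⟨k, y⟩ | ⟨k, y⟩) hv hx hy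
        all_goals try (change none = some i at hx; cases hx)
        all_goals try (change none = some i at hy; cases hy)
        · simp only [Sum.elim_inl] at hv hx hy
          have hxL : x.1 ∉ L := fun h => by simp [h] at hx
          have hyL : y.1 ∉ L := fun h => by simp [h] at hy
          simp only [hxL, hyL, if_false, Option.some.injEq] at hx hy
          subst hx
          subst hy
          rw [PG.par_ll, PG.par_ll]
          by_cases hvj : v = k
          · subst hvj
            rw [PG.comp_same, PG.comp_same]
            have haL : a.1 ∈ L := by by_contra h; simp [h] at hv
            have key : ∀ z : SA v, z.1 ∉ L → ¬ X.adj a.1 z.1 := by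
              intro z hz h
              exact hz ((hF.same _ a.2.1 _ z.2.1 (a.2.2.1.trans z.2.2.1.symm) h).1.1 haL)
            exact ⟨fun h => (key x hxL h).elim, fun h => (key y hyL h).elim⟩
          · rw [PG.comp_diff _ _ _ _ _ _ hvj, PG.comp_diff _ _ _ _ _ _ hvj]
        · simp
      · rintro (x | x) <;> rfl
      · have fne : ∀ {x y : V} {i j : Fin n}, f x = ε i → f y = ε j → i ≠ j → f x ≠ f y := by
          intro x y i j hx hy hij h
          rw [hx, hy] at h
          exact hij (ε.injective (Subtype.ext h))
        have cross : ∀ (i j : Fin n) (x : SA i) (y : SB j), ¬ X.adj x.1 y.1 := by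
          intro i j x y h
          by_cases hij : i = j
          · subst hij
            exact x.2.2.2 ((hF.same _ x.2.1 _ y.2.1 (x.2.2.1.trans y.2.2.1.symm) h).2.2 y.2.2.2)
          · rcases (hF.cross _ x.2.1 _ y.2.1 (fne x.2.2.1 y.2.2.1 hij)).1 h with h | h
            · exact hF.disj _ h.2.1 y.2.2.2
            · exact x.2.2.2 h.1
        rintro (⟨i, x⟩ | ⟨i, x⟩) (⟨j, y⟩ | ⟨j, y⟩)
        · rw [PG.par_ll]
          by_cases hij : i = j
          · subst hij
            rw [PG.comp_same]
            change X.adj x.1 y.1 ↔ X.adj x.1 y.1 ∧ _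
            constructor
            · intro h
              refine ⟨h, ?_⟩
              have := (hF.same _ x.2.1 _ y.2.1 (x.2.2.1.trans y.2.2.1.symm) h).1
              simp only [Sum.elim_inl, this]
            · exact fun h => h.1
          · rw [PG.comp_diff _ _ _ _ _ _ hij]
            change X.adj x.1 y.1 ↔ (i ≠ j ∧ ¬ (i ≠ j ∧ Q (ε i) (ε j))) ∧ _
            rw [hF.cross _ x.2.1 _ y.2.1 (fne x.2.2.1 y.2.2.1 hij), x.2.2.1, y.2.2.1]
            have hx := x.2.2.2
            simp only [Sum.elim_inl]
            by_cases h1 : x.1 ∈ L <;> by_cases h2 : y.1 ∈ L <;> simp [h1, h2, hx, hij]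
        · exact ⟨fun h => (cross _ _ _ _ h).elim, fun h => h.1.elim⟩
        · exact ⟨fun h => (cross _ _ _ _ (X.symm h)).elim, fun h => h.1.elim⟩
        · rw [PG.par_rr]
          by_cases hij : i = j
          · subst hij
            rw [PG.comp_same]
            exact ⟨fun h => ⟨h, rfl⟩, fun h => h.1⟩
          · rw [PG.comp_diff _ _ _ _ _ _ hij]
            change X.adj x.1 y.1 ↔ (i ≠ j ∧ Q (ε i) (ε j)) ∧ none = none
            rw [hF.cross _ x.2.1 _ y.2.1 (fne x.2.2.1 y.2.2.1 hij), x.2.2.1, y.2.2.1]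
            have hx := x.2.2.2
            have hy := y.2.2.2
            have hx' : x.1 ∉ L := fun h => hF.disj _ h hx
            simp [hx, hy, hx', hij]
    refine (Deriv.trans' h1 h2).trans' (Deriv.of_iso (pull_iso_res _ _ ?_ _ ?_))
    · have fi : ∀ {x y : V} {i j : Fin n}, f x = ε i → f y = ε j → x = y → i = j := by
        intro x y i j hx hy h
        rw [h, hy] at hx
        exact (ε.injective (Subtype.ext hx)).symm
      rintro (⟨i, x⟩ | ⟨i, x⟩) (⟨j, y⟩ | ⟨j, y⟩) h
      · change x.1 = y.1 at h
        obtain rfl := fi x.2.2.1 y.2.2.1 h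
        rw [Subtype.ext h]
      · change x.1 = y.1 at h
        exact (x.2.2.2 (h ▸ y.2.2.2)).elim
      · change x.1 = y.1 at h
        exact (y.2.2.2 (h ▸ x.2.2.2)).elim
      · change x.1 = y.1 at h
        obtain rfl := fi x.2.2.1 y.2.2.1 h
        rw [Subtype.ext h]
    · ext x
      constructor
      · rintro ⟨⟨i, x⟩ | ⟨i, x⟩, rfl⟩
        · exact x.2.1
        · exact x.2.1
      · intro hx
        obtain ⟨i, hi⟩ := ε.surjective ⟨f x, hF.hf x hx⟩
        have hi' : f x = ε i := by rw [hi]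
        by_cases hR : x ∈ R
        · exact ⟨.inr ⟨i, x, hx, hi', hR⟩, rfl⟩
        · exact ⟨.inl ⟨i, x, hx, hi', hR⟩, rfl⟩

theorem TG.toGS {G : LGraph} (h : TG G) : Provable GSRule G := by
  refine Provable.of_iso ?_ (T.toGS h)
  refine iso_symm (iso_trans (iso_toLG G) ?_)
  exact toLG_iso _ _ (Equiv.Set.univ _).symm (fun _ _ => Iff.rfl) (fun _ => rfl)

/-! ### Dualizing derivations and the deduction theorem -/

theorem PG.dual_plug {V W : Type} (X : PG V) (S : Set V) (Y : PG W) (x y : V ⊕ W) :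
    (X.plug S Y).dual.adj x y ↔ (X.dual.plug Sᶜ Y.dual).adj x y := by
  rcases x with x | x <;> rcases y with y | y <;> simp

theorem PG.dual_comp {U : Type} {A : U → Type} (P Q : PG U) (M : ∀ v, PG (A v))
    (h : ∀ v w, v ≠ w → (Q.adj v w ↔ ¬ P.adj v w)) (x y : Σ v, A v) :
    (P.comp M).dual.adj x y ↔ (Q.comp fun v => (M v).dual).adj x y := by
  obtain ⟨v, a⟩ := x
  obtain ⟨w, b⟩ := y
  by_cases hvw : v = w
  · subst hvw
    simp
  · rw [PG.dual_adj, PG.comp_diff _ _ _ _ _ _ hvw, PG.comp_diff _ _ _ _ _ _ hvw, h v w hvw]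
    simp [hvw]

theorem dual_congr {G H : LGraph} (h : G.iso H) : G.dual.iso H.dual := by
  obtain ⟨⟨e, h1, h2⟩⟩ := h
  refine ⟨⟨e, ?_, ?_⟩⟩
  · intro v w
    exact and_congr (not_congr e.injective.eq_iff.symm) (not_congr (h1 v w))
  · intro v; exact congrArg dualAtom (h2 v)

theorem dual_plug (C : LGraph) (R : Set C.V) (G : LGraph) :
    (C.plug R G).dual.iso (C.dual.plug (Rᶜ : Set C.V) G.dual) := by
  refine ⟨⟨Equiv.refl _, ?_, ?_⟩⟩
  · rintro (v | v) (w | w)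
    · exact PG.dual_plug (pgOf C) R (pgOf G) (.inl v) (.inl w)
    · exact PG.dual_plug (pgOf C) R (pgOf G) (.inl v) (.inr w)
    · exact PG.dual_plug (pgOf C) R (pgOf G) (.inr v) (.inl w)
    · exact PG.dual_plug (pgOf C) R (pgOf G) (.inr v) (.inr w)
  · rintro (v | v) <;> rfl

theorem dual_par (G H : LGraph) : (G.par H).dual.iso (G.dual.tensor H.dual) := by
  refine iso_trans (dual_congr (par_iso_plug G H)) (iso_trans (dual_plug G ∅ H) ?_)
  rw [Set.compl_empty]
  exact iso_symm (tensor_iso_plug _ _)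

theorem dual_tensor (G H : LGraph) : (G.tensor H).dual.iso (G.dual.par H.dual) := by
  refine iso_trans (dual_congr (tensor_iso_plug G H)) (iso_trans (dual_plug G Set.univ H) ?_)
  rw [Set.compl_univ]
  exact iso_symm (par_iso_plug _ _)

theorem plug_congr_left {C D : LGraph} (h : C.iso D) (G : LGraph) :
    (C.plug Set.univ G).iso (D.plug Set.univ G) ∧ (C.plug ∅ G).iso (D.plug ∅ G) := by
  obtain ⟨⟨e, h1, h2⟩⟩ := h
  constructor
  · refine ⟨⟨Equiv.sumCongr e (Equiv.refl _), ?_, ?_⟩⟩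
    · rintro (v | v) (w | w)
      · exact h1 v w
      · exact Iff.rfl
      · exact Iff.rfl
      · exact Iff.rfl
    · rintro (v | v)
      · exact h2 v
      · rfl
  · refine ⟨⟨Equiv.sumCongr e (Equiv.refl _), ?_, ?_⟩⟩
    · rintro (v | v) (w | w)
      · exact h1 v w
      · exact Iff.rfl
      · exact Iff.rfl
      · exact Iff.rfl
    · rintro (v | v)
      · exact h2 v
      · rfl

theorem par_congr {G G' H H' : LGraph} (h : G.iso G') (h' : H.iso H') :
    (G.par H).iso (G'.par H') :=
  iso_trans (par_iso_plug _ _) (iso_trans (plug_congr G ∅ h')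
    (iso_trans (plug_congr_left h H').2 (iso_symm (par_iso_plug _ _))))

theorem tensor_congr {G G' H H' : LGraph} (h : G.iso G') (h' : H.iso H') :
    (G.tensor H).iso (G'.tensor H') :=
  iso_trans (tensor_iso_plug _ _) (iso_trans (plug_congr G Set.univ h')
    (iso_trans (plug_congr_left h H').1 (iso_symm (tensor_iso_plug _ _))))

theorem dual_empty : LGraph.empty.dual.iso LGraph.empty :=
  ⟨⟨Equiv.refl _, fun v => Empty.elim v, fun v => Empty.elim v⟩⟩

theorem dual_bigTensor (n : ℕ) : ∀ (F F' : Fin n → LGraph), (∀ i, (F i).dual.iso (F' i)) →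
    (bigTensor n F).dual.iso (bigPar n F') := by
  induction n with
  | zero => intro F F' _; exact dual_empty
  | succ n ih =>
    intro F F' h
    exact iso_trans (dual_tensor _ _) (par_congr (h 0) (ih _ _ fun i => h i.succ))

theorem dual_dual_comp (P : LGraph) (M : P.V → LGraph) :
    (P.dual.comp M).dual.iso (P.comp fun v => (M v).dual) := by
  refine ⟨⟨Equiv.refl _, ?_, fun _ => rfl⟩⟩
  intro x y
  exact PG.dual_comp (pgOf P).dual (pgOf P) (fun v => pgOf (M v))
    (fun v w hvw => by simp [hvw]) x y

theorem dual_comp (P : LGraph) (M : P.V → LGraph) :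
    (P.comp M).dual.iso (P.dual.comp fun v => (M v).dual) := by
  refine ⟨⟨Equiv.refl _, ?_, fun _ => rfl⟩⟩
  intro x y
  exact PG.dual_comp (pgOf P) (pgOf P).dual (fun v => pgOf (M v))
    (fun v w hvw => by simp [hvw]) x y

theorem GSRule.dual {p c : LGraph} (h : GSRule p c) :
    ∃ p' c', UpRule p' c' ∧ c.dual.iso p' ∧ p.dual.iso c' := by
  cases h with
  | ai a =>
    refine ⟨_, _, UpRule.ai a, ?_, dual_empty⟩
    refine iso_trans (dual_par _ _) (tensor_congr ?_ ?_)
    · refine ⟨⟨Equiv.refl _, fun v w => ?_, fun _ => ?_⟩⟩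
      · exact ⟨fun h => h.1 rfl, fun h => h.elim⟩
      · exact (dualAtom_dualAtom a).symm
    · refine ⟨⟨Equiv.refl _, fun v w => ?_, fun _ => rfl⟩⟩
      exact ⟨fun h => h.1 rfl, fun h => h.elim⟩
  | ss A B S hA hS =>
    refine ⟨_, _, UpRule.ss A.dual B.dual (Sᶜ : Set B.V) hA ?_, dual_par _ _, dual_plug _ _ _⟩
    intro h
    exact hS (Set.compl_univ_iff.1 h)
  | p n P e M N hP hn hM =>
    refine ⟨_, _, UpRule.p n P e (fun i => (M i).dual) (fun i => (N i).dual) hP hn hM, ?_, ?_⟩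
    · exact iso_trans (dual_par _ _) (tensor_congr (dual_dual_comp _ _) (dual_comp _ _))
    · exact dual_bigTensor n _ _ fun i => dual_par _ _

theorem Deriv.dual {G H : LGraph} (h : Deriv GSRule G H) : Deriv SGSRule H.dual G.dual := by
  induction h with
  | refl => exact Relation.ReflTransGen.refl
  | tail _ hs ih =>
    refine Relation.ReflTransGen.head ?_ ih
    rcases hs with hs | ⟨C, R, p, c, hr, h1, h2⟩
    · exact Or.inl (iso_symm (dual_congr hs))
    · obtain ⟨p', c', hu, i1, i2⟩ := hr.dual
      refine Or.inr ⟨C.dual, (Rᶜ : Set C.V), p', c', Or.inr hu, ?_, ?_⟩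
      · exact iso_trans (dual_congr h2) (iso_trans (dual_plug _ _ _) (plug_congr _ _ i1))
      · exact iso_trans (dual_congr h1) (iso_trans (dual_plug _ _ _) (plug_congr _ _ i2))

theorem dual_id_iso (G : LGraph) : (G.dual.par G).dual.iso (G.plug Set.univ G.dual) := by
  refine iso_trans (dual_par _ _) (iso_trans (tensor_iso_plug _ _) (plug_congr_left ?_ _).1)
  refine ⟨⟨Equiv.refl _, ?_, ?_⟩⟩
  · intro v w
    change (v ≠ w ∧ ¬ (v ≠ w ∧ ¬ G.adj v w)) ↔ G.adj v w
    constructor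
    · rintro ⟨h1, h2⟩
      by_contra h3
      exact h2 ⟨h1, h3⟩
    · intro h
      refine ⟨?_, fun h' => h'.2 h⟩
      rintro rfl
      exact G.irrefl _ h
  · intro v
    exact (dualAtom_dualAtom (G.label v)).symm

theorem cut_deriv (G : LGraph) : Deriv SGSRule (G.plug Set.univ G.dual) LGraph.empty := by
  have h1 : Provable GSRule (G.dual.par G) := TG.toGS ((Imp_def G G).2 (PImp.id _))
  exact ((Deriv.of_iso (iso_symm (dual_id_iso G))).trans' (Deriv.dual h1)).trans'
    (Deriv.of_iso dual_empty)

theorem ss_deriv (A B : LGraph) (S : Set B.V) : Deriv GSRule (B.plug S A) (B.par A) := by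
  by_cases hA : Nonempty A.V
  · by_cases hS : S = ∅
    · subst hS
      exact Deriv.of_iso (iso_symm (par_iso_plug _ _))
    · exact Deriv.rule (GSRule.ss A B S hA hS)
  · refine Deriv.of_iso ⟨⟨Equiv.refl _, ?_, fun _ => rfl⟩⟩
    rintro (v | v) (w | w)
    · exact Iff.rfl
    · exact (hA ⟨w⟩).elim
    · exact (hA ⟨v⟩).elim
    · exact Iff.rfl

theorem par_comm_iso (A B : LGraph) : (B.par A).iso (A.plug ∅ B) := by
  refine ⟨⟨Equiv.sumComm _ _, ?_, ?_⟩⟩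
  · rintro (v | v) (w | w) <;> exact Iff.rfl
  · rintro (v | v) <;> rfl

theorem Deriv.of_provable_imp {G H : LGraph} (h : Provable SGSRule (G.dual.par H)) :
    Deriv SGSRule G H := by
  have s1 : Deriv SGSRule G (G.plug Set.univ LGraph.empty) := Deriv.of_iso (plug_empty _ _)
  have s2 := Deriv.plug G Set.univ h
  have s3 : (G.plug Set.univ (G.dual.par H)).iso
      ((G.plug Set.univ G.dual).plug (nbr Set.univ ∅) H) :=
    iso_trans (plug_congr _ _ (par_iso_plug _ _)) (plug_assoc _ _ _ _ _)
  have s4 : Deriv SGSRule ((G.plug Set.univ G.dual).plug (nbr Set.univ ∅) H)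
      ((G.plug Set.univ G.dual).par H) :=
    Deriv.mono (fun _ _ h => Or.inl h) (ss_deriv _ _ _)
  have s5 := Deriv.plug H ∅ (cut_deriv G)
  exact ((((s1.trans' s2).trans' (Deriv.of_iso s3)).trans' s4).trans'
    (Deriv.of_iso (par_comm_iso _ _))).trans' (s5.trans' (Deriv.of_iso (iso_symm (plug_empty _ _))))


/-- **Deduction theorem.** For all graphs `G` and `H`, the following
are equivalent: (i) `Ḡ ⅋ H` is provable in GS; (ii) `Ḡ ⅋ H` is provable in SGS;
(iii) there is a derivation in SGS from `G` to `H`. -/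
theorem deduction_theorem (G H : LGraph) :
    (Provable GSRule (G.dual.par H) ↔ Provable SGSRule (G.dual.par H)) ∧
    (Provable SGSRule (G.dual.par H) ↔ Deriv SGSRule G H) := by
  refine ⟨⟨?_, ?_⟩, ⟨?_, ?_⟩⟩
  · exact Deriv.mono fun _ _ h => Or.inl h
  · intro h; exact TG.toGS (TG.of_provable h)
  · exact Deriv.of_provable_imp
  · intro h
    exact Deriv.mono (fun _ _ h => Or.inl h) (TG.toGS (Imp.of_deriv h))
end GSP
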